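/- Let n ≥ 2, 0 ≤ q ≤ n, s ≥ 1, k ≥ 1 integers, 0 < λ < λ' < 1, δ > 1, μ > 0, T > 0, and let w be a q-form in F^{k,s(s,λ,λ',δ)}_{T,Λ^q,D_{d⊕d*}}. Then the linear operators u ↦ Ψ_{μ,q} B_q(w,u), as an operator from F^{k,s(s,λ,λ',δ)}_{T,Λ^q} to itself, and u ↦ Ψ_{μ,q} W_q u, as an operator from F^{k,s(s,λ,λ',δ)}_{T,Λ^q,D_{d⊕d*}} to itself, are compact. -/

import Mathlib

open scoped BigOperators ENNReal Classical
open Filter MeasureTheory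

noncomputable section

namespace NSdeRham

/-- Euclidean space `ℝⁿ`. -/
abbrev Spc (n : ℕ) := EuclideanSpace ℝ (Fin n)

variable {n : ℕ}

/-- The weight `w(x) = √(1+|x|²)`. -/
def wt (x : Spc n) : ℝ := Real.sqrt (1 + ‖x‖ ^ 2)

/-- `w(x,y) = max (w x) (w y)`. -/
def wt2 (x y : Spc n) : ℝ := max (wt x) (wt y)

/-- Partial derivative in the `i`-th coordinate direction. -/
def pd (i : Fin n) (f : Spc n → ℝ) (x : Spc n) : ℝ :=
  fderiv ℝ f x (EuclideanSpace.single i 1)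

/-- The Laplace operator `Δ = ∑ ∂²/∂xᵢ²`. -/
def lap (f : Spc n → ℝ) (x : Spc n) : ℝ := ∑ i : Fin n, pd i (pd i f) x

section enorms

variable {F : Type*} [NormedAddCommGroup F]

/-- Weighted sup-"norm" `sup_x w(x)^δ ‖g x‖` (with values in `ℝ≥0∞`). -/
def eWSup (δ : ℝ) (g : Spc n → F) : ℝ≥0∞ :=
  ⨆ x : Spc n, ENNReal.ofReal (wt x ^ δ * ‖g x‖)

/-- Weighted Hölder seminorm `⟨g⟩_{λ,δ}`. -/
def eWHold (lam δ : ℝ) (g : Spc n → F) : ℝ≥0∞ :=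
  ⨆ (x : Spc n) (y : Spc n) (_ : x ≠ y ∧ ‖x - y‖ ≤ ‖x‖ / 2),
    ENNReal.ofReal (wt2 x y ^ (δ + lam) * ‖g x - g y‖ / ‖x - y‖ ^ lam)

/-- The ordinary Hölder norm on the (closed) unit ball around the origin. -/
def eOHold (lam : ℝ) (g : Spc n → F) : ℝ≥0∞ :=
  (⨆ (x : Spc n) (_ : ‖x‖ ≤ 1), ENNReal.ofReal ‖g x‖) +
    ⨆ (x : Spc n) (y : Spc n) (_ : ‖x‖ ≤ 1 ∧ ‖y‖ ≤ 1 ∧ x ≠ y),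
      ENNReal.ofReal (‖g x - g y‖ / ‖x - y‖ ^ lam)

/-- The norm of `C^{0,λ,δ}`; for `λ = 0` this is just the weighted sup-norm. -/
def eHol0 (lam δ : ℝ) (g : Spc n → F) : ℝ≥0∞ :=
  if lam = 0 then eWSup δ g else eOHold lam g + eWSup δ g + eWHold lam δ g

/-- The norm of the base anisotropic space `C^{𝐬(0,λ,δ)}_T`. -/
def eAniso0 (T lam δ : ℝ) (v : ℝ → Spc n → F) : ℝ≥0∞ :=
  (⨆ t : Set.Icc (0 : ℝ) T, eHol0 lam δ (v t)) +
    if lam = 0 then 0 else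
      ⨆ (t₁ : Set.Icc (0 : ℝ) T) (t₂ : Set.Icc (0 : ℝ) T) (_ : (t₁ : ℝ) ≠ (t₂ : ℝ))
        (x : Spc n),
        ENNReal.ofReal (wt x ^ δ * ‖v t₁ x - v t₂ x‖ / |(t₁ : ℝ) - (t₂ : ℝ)| ^ (lam / 2))

end enorms

/-- The norm of the static weighted Hölder space `C^{s,λ,δ}`. -/
def eHolS (s : ℕ) (lam δ : ℝ) (g : Spc n → ℝ) : ℝ≥0∞ :=
  ∑ m ∈ Finset.range (s + 1), eHol0 lam (δ + m) (iteratedFDeriv ℝ m g)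

/-- Membership in the static weighted Hölder space `C^{s,λ,δ}`. -/
def HolSMem (s : ℕ) (lam δ : ℝ) (g : Spc n → ℝ) : Prop :=
  ContDiff ℝ s g ∧ eHolS s lam δ g ≠ ⊤

/-- Time derivative of order `j` (within `[0,T]`). -/
def tDeriv (T : ℝ) (j : ℕ) (u : ℝ → Spc n → ℝ) (t : ℝ) (x : Spc n) : ℝ :=
  iteratedDerivWithin j (fun τ => u τ x) (Set.Icc 0 T) t

/-- Mixed derivative `∂_x^m ∂_t^j`. -/
def mixDeriv (T : ℝ) (m j : ℕ) (u : ℝ → Spc n → ℝ) (t : ℝ) :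
    Spc n → ContinuousMultilinearMap ℝ (fun _ : Fin m => Spc n) ℝ :=
  iteratedFDeriv ℝ m (fun x => tDeriv T j u t x)

/-- The norm of the anisotropic weighted parabolic Hölder space `C^{k,𝐬(s,λ,δ)}_T`. -/
def eAnisoKS (T : ℝ) (k s : ℕ) (lam δ : ℝ) (u : ℝ → Spc n → ℝ) : ℝ≥0∞ :=
  ∑ b ∈ Finset.range (k + 1), ∑ m ∈ Finset.range (2 * s + 1), ∑ j ∈ Finset.range (s + 1),
    if m + 2 * j ≤ 2 * s then eAniso0 T lam (δ + b + m) (mixDeriv T (b + m) j u) else 0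

/-- Regularity required of members of `C^{k,𝐬(s,λ,δ)}_T`. -/
def AnisoReg (T : ℝ) (k s : ℕ) (u : ℝ → Spc n → ℝ) : Prop :=
  (∀ x : Spc n, ContDiffOn ℝ s (fun t => u t x) (Set.Icc 0 T)) ∧
  (∀ j : ℕ, j ≤ s → ∀ t ∈ Set.Icc (0 : ℝ) T,
    ContDiff ℝ (2 * (s - j) + k) (fun x => tDeriv T j u t x)) ∧
  (∀ j m : ℕ, j ≤ s → m + 2 * j ≤ 2 * s + k →
    Continuous fun p : Set.Icc (0 : ℝ) T × Spc n => mixDeriv T m j u p.1 p.2)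

/-- Membership in `C^{k,𝐬(s,λ,δ)}_T`. -/
def AnisoMem (T : ℝ) (k s : ℕ) (lam δ : ℝ) (u : ℝ → Spc n → ℝ) : Prop :=
  AnisoReg T k s u ∧ eAnisoKS T k s lam δ u ≠ ⊤

/-- The norm of `𝓕^{k,𝐬(s,λ,λ',δ)}_T = C^{k+1,𝐬(s,λ,δ)}_T ∩ C^{k,𝐬(s,λ',δ)}_T`. -/
def eFn (T : ℝ) (k s : ℕ) (lam lam' δ : ℝ) (u : ℝ → Spc n → ℝ) : ℝ≥0∞ :=
  eAnisoKS T (k + 1) s lam δ u + eAnisoKS T k s lam' δ u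

/-- Membership in `𝓕^{k,𝐬(s,λ,λ',δ)}_T`. -/
def FMem (T : ℝ) (k s : ℕ) (lam lam' δ : ℝ) (u : ℝ → Spc n → ℝ) : Prop :=
  AnisoReg T (k + 1) s u ∧ eFn T k s lam lam' δ u ≠ ⊤

/-- Index set of a basis of `Λ^q`. -/
abbrev Idx (n q : ℕ) := {I : Finset (Fin n) // I.card = q}

/-- Static differential `q`-forms: coefficient functions. -/
abbrev FormS (n q : ℕ) := Idx n q → Spc n → ℝ

/-- Time-dependent differential `q`-forms. -/
abbrev FormT (n q : ℕ) := Idx n q → ℝ → Spc n → ℝ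

/-- Fibre of the bundle `Λ^q`. -/
abbrev Fib (n q : ℕ) := Idx n q → ℝ

/-- The exterior derivative `d_q` on static `q`-forms. -/
def dS {q : ℕ} (u : FormS n q) : FormS n (q + 1) := fun J x =>
  ∑ i : Fin n,
    if h : i ∈ J.1 then
      (-1 : ℝ) ^ (J.1.filter fun j => j < i).card *
        pd i (u ⟨J.1.erase i, by simp [Finset.card_erase_of_mem h, J.2]⟩) x
    else 0

/-- The exterior derivative `d_{q-1}` mapping `(q-1)`-forms to `q`-forms. -/
def dLowS {q : ℕ} (p : FormS n (q - 1)) : FormS n q := fun J x =>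
  ∑ i : Fin n,
    if h : i ∈ J.1 ∧ (J.1.erase i).card = q - 1 then
      (-1 : ℝ) ^ (J.1.filter fun j => j < i).card * pd i (p ⟨J.1.erase i, h.2⟩) x
    else 0

/-- The formal adjoint `d_{q-1}^*` mapping `q`-forms to `(q-1)`-forms. -/
def coDS {q : ℕ} (u : FormS n q) : FormS n (q - 1) := fun K x =>
  -∑ i : Fin n,
    if h : i ∉ K.1 ∧ (insert i K.1).card = q then
      (-1 : ℝ) ^ (K.1.filter fun j => j < i).card * pd i (u ⟨insert i K.1, h.2⟩) x
    else 0

/-- `d_q` on time-dependent forms. -/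
def dT {q : ℕ} (u : FormT n q) : FormT n (q + 1) := fun J t => dS (fun I => u I t) J

/-- `d_{q-1}` on time-dependent forms. -/
def dLowT {q : ℕ} (p : FormT n (q - 1)) : FormT n q := fun J t => dLowS (fun I => p I t) J

/-- `d_{q-1}^*` on time-dependent forms. -/
def coDT {q : ℕ} (u : FormT n q) : FormT n (q - 1) := fun K t => coDS (fun I => u I t) K

/-- Norm of `C^{k,𝐬(s,λ,δ)}_{T,Λ^q}`. -/
def eAnisoKSF {q : ℕ} (T : ℝ) (k s : ℕ) (lam δ : ℝ) (u : FormT n q) : ℝ≥0∞ :=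
  ∑ I : Idx n q, eAnisoKS T k s lam δ (u I)

/-- Membership in `C^{k,𝐬(s,λ,δ)}_{T,Λ^q}`. -/
def CMemF {q : ℕ} (T : ℝ) (k s : ℕ) (lam δ : ℝ) (u : FormT n q) : Prop :=
  (∀ I, AnisoReg T k s (u I)) ∧ eAnisoKSF T k s lam δ u ≠ ⊤

/-- Graph norm of `C^{k,𝐬(s,λ,δ)}_{T,Λ^q,𝒟_{d⊕d*}}`. -/
def eCD {q : ℕ} (T : ℝ) (k s : ℕ) (lam δ : ℝ) (u : FormT n q) : ℝ≥0∞ :=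
  eAnisoKSF T k s lam δ u + eAnisoKSF T k s lam (δ + 1) (dT u) +
    eAnisoKSF T k s lam (δ + 1) (coDT u)

/-- Membership in `C^{k,𝐬(s,λ,δ)}_{T,Λ^q,𝒟_{d⊕d*}}`. -/
def CMemD {q : ℕ} (T : ℝ) (k s : ℕ) (lam δ : ℝ) (u : FormT n q) : Prop :=
  CMemF T k s lam δ u ∧ CMemF T k s lam (δ + 1) (dT u) ∧ CMemF T k s lam (δ + 1) (coDT u)

/-- Norm of `𝓕^{k,𝐬(s,λ,λ',δ)}_{T,Λ^q}`. -/
def eFF {q : ℕ} (T : ℝ) (k s : ℕ) (lam lam' δ : ℝ) (u : FormT n q) : ℝ≥0∞ :=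
  ∑ I : Idx n q, eFn T k s lam lam' δ (u I)

/-- Membership in `𝓕^{k,𝐬(s,λ,λ',δ)}_{T,Λ^q}`. -/
def FMemF {q : ℕ} (T : ℝ) (k s : ℕ) (lam lam' δ : ℝ) (u : FormT n q) : Prop :=
  (∀ I, AnisoReg T (k + 1) s (u I)) ∧ eFF T k s lam lam' δ u ≠ ⊤

/-- Graph norm of `𝓕^{k,𝐬(s,λ,λ',δ)}_{T,Λ^q,𝒟_{d⊕d*}}`. -/
def eFD {q : ℕ} (T : ℝ) (k s : ℕ) (lam lam' δ : ℝ) (u : FormT n q) : ℝ≥0∞ :=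
  eFF T k s lam lam' δ u + eFF T k s lam lam' (δ + 1) (dT u) +
    eFF T k s lam lam' (δ + 1) (coDT u)

/-- Membership in `𝓕^{k,𝐬(s,λ,λ',δ)}_{T,Λ^q,𝒟_{d⊕d*}}`. -/
def FMemD {q : ℕ} (T : ℝ) (k s : ℕ) (lam lam' δ : ℝ) (u : FormT n q) : Prop :=
  FMemF T k s lam lam' δ u ∧ FMemF T k s lam lam' (δ + 1) (dT u) ∧
    FMemF T k s lam lam' (δ + 1) (coDT u)

/-- Norm of the static space `C^{s,λ,δ}_{Λ^q}`. -/
def eHolSF {q : ℕ} (s : ℕ) (lam δ : ℝ) (g : FormS n q) : ℝ≥0∞ :=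
  ∑ I : Idx n q, eHolS s lam δ (g I)

/-- Membership in the static space `C^{s,λ,δ}_{Λ^q}`. -/
def HolMemF {q : ℕ} (s : ℕ) (lam δ : ℝ) (g : FormS n q) : Prop :=
  (∀ I, ContDiff ℝ s (g I)) ∧ eHolSF s lam δ g ≠ ⊤

/-- Equality of time-dependent forms on `ℝⁿ × [0,T]`. -/
def EqOnT {q : ℕ} (T : ℝ) (u v : FormT n q) : Prop :=
  ∀ I, ∀ t ∈ Set.Icc (0 : ℝ) T, ∀ x, u I t x = v I t x

/-- The form `u` is co-closed (`d^* u = 0`) on `ℝⁿ × [0,T]`. -/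
def CoClosed {q : ℕ} (T : ℝ) (u : FormT n q) : Prop :=
  ∀ K, ∀ t ∈ Set.Icc (0 : ℝ) T, ∀ x, coDT u K t x = 0

/-- Type of the bilinear zero order operator `M₁^{(q)}`. -/
abbrev M1Type (n q : ℕ) := (Fib n (q + 1) × Fib n (q - 1)) →ₗ[ℝ] Fib n q →ₗ[ℝ] Fib n q

/-- Type of the bilinear zero order operator `M₂^{(q)}`. -/
abbrev M2Type (n q : ℕ) := Fib n q →ₗ[ℝ] Fib n q →ₗ[ℝ] Fib n (q - 1)

/-- Value of a time-dependent form at a point, as an element of the fibre. -/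
def fib {q : ℕ} (u : FormT n q) (t : ℝ) (x : Spc n) : Fib n q := fun I => u I t x

/-- Value of `(d_q ⊕ d_{q-1}^*) u` at a point. -/
def ddFib {q : ℕ} (u : FormT n q) (t : ℝ) (x : Spc n) : Fib n (q + 1) × Fib n (q - 1) :=
  (fun J => dT u J t x, fun K => coDT u K t x)

/-- The operator `W_q u = M₁((d⊕d^*)u, w) + M₁((d⊕d^*)w, u)`. -/
def Wop {q : ℕ} (M₁ : M1Type n q) (w u : FormT n q) : FormT n q := fun I t x =>
  M₁ (ddFib u t x) (fib w t x) I + M₁ (ddFib w t x) (fib u t x) I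

/-- The symmetric bilinearization `B_q(w,u)` of the nonlinearity. -/
def Bop {q : ℕ} (M₁ : M1Type n q) (M₂ : M2Type n q) (w u : FormT n q) : FormT n q :=
  fun I t x =>
    Wop M₁ w u I t x +
      dLowT (fun K t' x' =>
        M₂ (fib u t' x') (fib w t' x') K + M₂ (fib w t' x') (fib u t' x') K) I t x

/-- The nonlinearity `𝒩_q u = M₁((d⊕d^*)u, u) + d_{q-1} M₂(u,u)`. -/
def Nop {q : ℕ} (M₁ : M1Type n q) (M₂ : M2Type n q) (u : FormT n q) : FormT n q :=
  fun I t x =>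
    M₁ (ddFib u t x) (fib u t x) I +
      dLowT (fun K t' x' => M₂ (fib u t' x') (fib u t' x') K) I t x

/-- Fundamental solution of the heat operator `∂_t - μΔ`. -/
def heatKer (μ : ℝ) (x : Spc n) (t : ℝ) : ℝ :=
  if 0 < t then (4 * Real.pi * μ * t) ^ (-(n : ℝ) / 2) * Real.exp (-‖x‖ ^ 2 / (4 * μ * t))
  else 0

/-- Volume heat potential `Ψ_μ`. -/
def volPot (μ : ℝ) (f : ℝ → Spc n → ℝ) (t : ℝ) (x : Spc n) : ℝ :=
  ∫ τ in Set.Ioc (0 : ℝ) t, ∫ y : Spc n, heatKer μ (x - y) (t - τ) * f τ y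

/-- Poisson heat potential `Ψ_{μ,0}`. -/
def poisPot (μ : ℝ) (g : Spc n → ℝ) (t : ℝ) (x : Spc n) : ℝ :=
  ∫ y : Spc n, heatKer μ (x - y) t * g y

/-- Volume heat potential acting coefficient-wise on forms. -/
def volPotF {q : ℕ} (μ : ℝ) (f : FormT n q) : FormT n q := fun I => volPot μ (f I)

/-- Poisson heat potential acting coefficient-wise on forms. -/
def poisPotF {q : ℕ} (μ : ℝ) (g : FormS n q) : FormT n q := fun I => poisPot μ (g I)

/-- Area of the unit sphere in `ℝⁿ`. -/
def sphArea (n : ℕ) : ℝ := 2 * Real.pi ^ ((n : ℝ) / 2) / Real.Gamma ((n : ℝ) / 2)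

/-- Standard fundamental solution of the Laplace operator in `ℝⁿ`. -/
def lapKer (n : ℕ) (x : Spc n) : ℝ :=
  if n = 2 then (1 / Real.pi) * Real.log ‖x‖
  else ‖x‖ ^ (2 - (n : ℝ)) / (sphArea n * (2 - (n : ℝ)))

/-- Newtonian potential. -/
def newtPot (f : Spc n → ℝ) (x : Spc n) : ℝ := ∫ y : Spc n, lapKer n (x - y) * f y

/-- The integral operator `Φ_q` mapping `(q+1)`-forms to `q`-forms;
concretely `Φ_q f = -d^* (e * f)`. -/
def PhiOp {q : ℕ} (f : FormT n (q + 1)) : FormT n q := fun K t x =>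
  -coDS (n := n) (q := q + 1) (fun J y => newtPot (fun z => f J t z) y) K x

/-- Squared `L²` norm of a form at time `t`. -/
def l2Sq {q : ℕ} (u : FormT n q) (t : ℝ) : ℝ :=
  ∑ I : Idx n q, ∫ x : Spc n, (u I t x) ^ 2

/-- Squared `L²` norm of the spatial gradient of a form at time `t`. -/
def gradSq {q : ℕ} (u : FormT n q) (t : ℝ) : ℝ :=
  ∑ I : Idx n q, ∑ i : Fin n, ∫ x : Spc n, (pd i (fun y => u I t y) x) ^ 2

/-- The norm of `C^{0,𝐬(0,0,δ)}_{T,Λ^q}` (weighted sup-norm). -/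
def eSupT {q : ℕ} (T δ : ℝ) (u : FormT n q) : ℝ≥0∞ :=
  ∑ I : Idx n q,
    ⨆ (t : Set.Icc (0 : ℝ) T) (x : Spc n), ENNReal.ofReal (wt x ^ δ * |u I t x|)

/-- The norm `‖∇u‖_{C^{0,𝐬(0,0,δ)}_{T}}` of the spatial gradient. -/
def eSupGradT {q : ℕ} (T δ : ℝ) (u : FormT n q) : ℝ≥0∞ :=
  ∑ I : Idx n q, ∑ i : Fin n,
    ⨆ (t : Set.Icc (0 : ℝ) T) (x : Spc n),
      ENNReal.ofReal (wt x ^ δ * |pd i (fun y => u I t y) x|)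

/-- `q`-form with coefficients harmonic polynomials of degree at most `m`. -/
def HarmPolyForm {q : ℕ} (m : ℕ) (h : FormS n q) : Prop :=
  ∀ I, (∃ P : MvPolynomial (Fin n) ℝ, P.totalDegree ≤ m ∧
      ∀ x : Spc n, h I x = MvPolynomial.eval (fun i => x i) P) ∧
    ∀ x : Spc n, lap (h I) x = 0

/-- Classical solution of the Cauchy problem
`∂_t u - μ Δ u + extra = f` on `ℝⁿ × (0,T)`, `u(·,0) = u₀`. -/
def CauchySol {q : ℕ} (T μ : ℝ) (u extra f : FormT n q) (u₀ : FormS n q) : Prop :=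
  (∀ I, ∀ t ∈ Set.Ioo (0 : ℝ) T, ∀ x,
    deriv (fun τ => u I τ x) t - μ * lap (fun y => u I t y) x + extra I t x = f I t x) ∧
  ∀ I x, u I 0 x = u₀ I x

/-- `Ψ_{μ,q} 𝒩_q u`. -/
def NopPot {q : ℕ} (μ : ℝ) (M₁ : M1Type n q) (M₂ : M2Type n q) (u : FormT n q) : FormT n q :=
  volPotF μ (Nop M₁ M₂ u)

/-- `u + Ψ_{μ,q} 𝒩_q u`. -/
def TmapN {q : ℕ} (μ : ℝ) (M₁ : M1Type n q) (M₂ : M2Type n q) (u : FormT n q) : FormT n q :=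
  u + NopPot μ M₁ M₂ u

/-- The linearization `u + Ψ_{μ,q} B_q(v,u)`. -/
def LmapB {q : ℕ} (μ : ℝ) (M₁ : M1Type n q) (M₂ : M2Type n q) (v u : FormT n q) :
    FormT n q :=
  u + volPotF μ (Bop M₁ M₂ v u)

/-- `Φ_q d_q Ψ_{μ,q} 𝒩_q u`. -/
def PhiNpot {q : ℕ} (μ : ℝ) (M₁ : M1Type n q) (M₂ : M2Type n q) (u : FormT n q) :
    FormT n q :=
  PhiOp (dT (volPotF μ (Nop M₁ M₂ u)))

/-- `u + Φ_q d_q Ψ_{μ,q} 𝒩_q u`. -/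
def PhiNmap {q : ℕ} (μ : ℝ) (M₁ : M1Type n q) (M₂ : M2Type n q) (u : FormT n q) :
    FormT n q :=
  u + PhiNpot μ M₁ M₂ u

/-- The linearization `u + Φ_q d_q Ψ_{μ,q} B_q(v,u)`. -/
def PhiLmap {q : ℕ} (μ : ℝ) (M₁ : M1Type n q) (M₂ : M2Type n q) (v u : FormT n q) :
    FormT n q :=
  u + PhiOp (dT (volPotF μ (Bop M₁ M₂ v u)))

/-- The linear form on `ℝⁿ` with coefficients `a`. -/
def gradForm (a : Fin n → ℝ) : Spc n →L[ℝ] ℝ :=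
  ∑ i, a i • (EuclideanSpace.proj i : Spc n →L[ℝ] ℝ)

theorem gradForm_apply (a : Fin n → ℝ) (v : Spc n) : gradForm a v = ∑ i, a i * v i := by
  simp [gradForm]

theorem gradForm_single (a : Fin n → ℝ) (i : Fin n) :
    gradForm a (EuclideanSpace.single i 1) = a i := by
  simp [gradForm_apply]

theorem gradForm_apply_single (L : Spc n →L[ℝ] ℝ) :
    gradForm (fun i => L (EuclideanSpace.single i 1)) = L := by
  ext v
  rw [gradForm_apply]
  conv_rhs => rw [← (EuclideanSpace.basisFun (Fin n) ℝ).sum_repr v]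
  simp [mul_comm]

/-- `g` is the spatial gradient of `u` for times in `[0,T]`. -/
def HasDx (T : ℝ) (u : ℝ → Spc n → ℝ) (g : Fin n → ℝ → Spc n → ℝ) : Prop :=
  ∀ t ∈ Set.Icc 0 T, ∀ x, HasFDerivAt (u t) (gradForm fun i => g i t x) x

/-- `g` is the time derivative of `u` within `[0,T]`. -/
def HasDt (T : ℝ) (u g : ℝ → Spc n → ℝ) : Prop :=
  ∀ t ∈ Set.Icc 0 T, ∀ x, HasDerivWithinAt (fun τ => u τ x) (g t x) (Set.Icc 0 T) t

/-- Agreement of functions on `[0,T] × ℝⁿ`. -/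
def EqT {F : Type*} (T : ℝ) (u v : ℝ → Spc n → F) : Prop :=
  ∀ t ∈ Set.Icc 0 T, ∀ x, u t x = v t x

/-- Joint continuity on `[0,T] × ℝⁿ`. -/
def ContT {F : Type*} [TopologicalSpace F] (T : ℝ) (u : ℝ → Spc n → F) : Prop :=
  ContinuousOn (fun p : ℝ × Spc n => u p.1 p.2) (Set.Icc 0 T ×ˢ Set.univ)

/-- Continuity together with a weighted bound. -/
structure SupBd {F : Type*} [NormedAddCommGroup F] (T C σ : ℝ) (u : ℝ → Spc n → F) : Prop where
  cont : ContT T u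
  sup : ∀ t ∈ Set.Icc 0 T, ∀ x, wt x ^ σ * ‖u t x‖ ≤ C

/-- Continuity together with a weighted parabolic Hölder bound. -/
structure HolBd {F : Type*} [NormedAddCommGroup F] (T lam C σ : ℝ) (u : ℝ → Spc n → F) :
    Prop where
  cont : ContT T u
  sup : ∀ t ∈ Set.Icc 0 T, ∀ x, wt x ^ σ * ‖u t x‖ ≤ C
  near : ∀ t ∈ Set.Icc 0 T, ∀ x y, x ≠ y → ‖x - y‖ ≤ ‖x‖ / 2 →
    wt2 x y ^ (σ + lam) * ‖u t x - u t y‖ / ‖x - y‖ ^ lam ≤ C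
  ball : ∀ t ∈ Set.Icc 0 T, ∀ x y, ‖x‖ ≤ 1 → ‖y‖ ≤ 1 → x ≠ y →
    ‖u t x - u t y‖ / ‖x - y‖ ^ lam ≤ C
  time : ∀ t ∈ Set.Icc 0 T, ∀ t' ∈ Set.Icc 0 T, t ≠ t' → ∀ x,
    wt x ^ σ * ‖u t x - u t' x‖ / |t - t'| ^ (lam / 2) ≤ C

/-- All spatial derivatives of order at most `N` exist and satisfy `P`, the weight growing by one
with each derivative. -/
def SpReg (T : ℝ) (P : ℝ → (ℝ → Spc n → ℝ) → Prop) : ℕ → ℝ → (ℝ → Spc n → ℝ) → Prop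
  | 0, σ, u => P σ u
  | N + 1, σ, u => P σ u ∧ ∃ g : Fin n → ℝ → Spc n → ℝ, HasDx T u g ∧
      ∀ i, SpReg T P N (σ + 1) (g i)

/-- All derivatives `∂_x^a ∂_t^j` with `j ≤ s`, `a + 2 j ≤ K + 2 s` exist and satisfy `P`. -/
def ParReg (T : ℝ) (P : ℝ → (ℝ → Spc n → ℝ) → Prop) :
    ℕ → ℕ → ℝ → (ℝ → Spc n → ℝ) → Prop
  | 0, K, σ, u => SpReg T P K σ u
  | s + 1, K, σ, u => SpReg T P (K + 2 * (s + 1)) σ u ∧ ∃ g, HasDt T u g ∧ ParReg T P s K σ g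

theorem one_le_wt (x : Spc n) : 1 ≤ wt x := by
  unfold wt; rw [Real.one_le_sqrt]; nlinarith [norm_nonneg x]

theorem wt_pos (x : Spc n) : 0 < wt x := lt_of_lt_of_le one_pos (one_le_wt x)

theorem wt_sq (x : Spc n) : wt x ^ 2 = 1 + ‖x‖ ^ 2 := by
  unfold wt; rw [Real.sq_sqrt (by positivity)]

theorem norm_le_wt (x : Spc n) : ‖x‖ ≤ wt x :=
  abs_le_of_sq_le_sq' (by rw [wt_sq]; linarith) (wt_pos x).le |>.2

theorem wt_le_one_add_norm (x : Spc n) : wt x ≤ 1 + ‖x‖ :=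
  abs_le_of_sq_le_sq' (by rw [wt_sq]; nlinarith [norm_nonneg x]) (by positivity) |>.2

theorem wt_le_add (x y : Spc n) : wt x ≤ wt y + ‖x - y‖ := by
  refine (abs_le_of_sq_le_sq' ?_ (by have := wt_pos y; positivity)).2
  have h1 : ‖x‖ ≤ ‖y‖ + ‖x - y‖ := by
    calc ‖x‖ = ‖y + (x - y)‖ := by congr 1; abel
      _ ≤ _ := norm_add_le _ _
  have h2 := wt_sq y
  have h3 := norm_le_wt y
  rw [wt_sq]
  nlinarith [norm_nonneg x, norm_nonneg y, norm_nonneg (x - y),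
    mul_le_mul_of_nonneg_right h3 (norm_nonneg (x - y))]

theorem wt_le_mul (x y : Spc n) : wt x ≤ wt y * (1 + ‖x - y‖) := by
  have := wt_le_add x y
  nlinarith [one_le_wt y, norm_nonneg (x - y)]

theorem wt_rpow_le_mul {σ : ℝ} (hσ : 0 ≤ σ) (x y : Spc n) :
    wt x ^ σ ≤ wt y ^ σ * (1 + ‖x - y‖) ^ σ := by
  rw [← Real.mul_rpow (wt_pos y).le (by positivity)]
  exact Real.rpow_le_rpow (wt_pos x).le (wt_le_mul x y) hσ

theorem wt_rpow_pos (x : Spc n) (σ : ℝ) : 0 < wt x ^ σ := Real.rpow_pos_of_pos (wt_pos x) σ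

theorem one_le_wt_rpow (x : Spc n) {σ : ℝ} (hσ : 0 ≤ σ) : 1 ≤ wt x ^ σ :=
  Real.one_le_rpow (one_le_wt x) hσ

theorem wt_rpow_mono (x : Spc n) {σ τ : ℝ} (h : σ ≤ τ) : wt x ^ σ ≤ wt x ^ τ :=
  Real.rpow_le_rpow_of_exponent_le (one_le_wt x) h

section basic

variable {T : ℝ}

theorem EqT.symm {F : Type*} {u v : ℝ → Spc n → F} (h : EqT T u v) : EqT T v u :=
  fun t ht x => (h t ht x).symm

theorem HasDx.unique {u : ℝ → Spc n → ℝ} {g g' : Fin n → ℝ → Spc n → ℝ} (h : HasDx T u g)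
    (h' : HasDx T u g') (i : Fin n) : EqT T (g i) (g' i) := by
  intro t ht x
  have := (h t ht x).unique (h' t ht x)
  have := congrArg (fun L => L (EuclideanSpace.single i 1)) this
  simpa only [gradForm_single] using this

theorem HasDx.congr {u v : ℝ → Spc n → ℝ} {g : Fin n → ℝ → Spc n → ℝ} (h : HasDx T u g)
    (huv : EqT T u v) : HasDx T v g := by
  intro t ht x
  have : u t = v t := funext (huv t ht)
  rw [← this]; exact h t ht x

theorem HasDx.pd_eq {u : ℝ → Spc n → ℝ} {g : Fin n → ℝ → Spc n → ℝ} (h : HasDx T u g)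
    {t : ℝ} (ht : t ∈ Set.Icc 0 T) (x : Spc n) (i : Fin n) : pd i (u t) x = g i t x := by
  rw [pd, (h t ht x).fderiv, gradForm_single]

theorem HasDt.congr {u v g : ℝ → Spc n → ℝ} (h : HasDt T u g)
    (huv : EqT T u v) : HasDt T v g := by
  intro t ht x
  exact (h t ht x).congr (fun τ hτ => (huv τ hτ x).symm) (huv t ht x).symm

theorem ContT.congr {F : Type*} [TopologicalSpace F] {u v : ℝ → Spc n → F} (h : ContT T u)
    (huv : EqT T u v) : ContT T v :=
  ContinuousOn.congr h fun p hp => (huv p.1 hp.1 p.2).symm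

theorem ContT.space {F : Type*} [TopologicalSpace F] {u : ℝ → Spc n → F} (h : ContT T u)
    {t : ℝ} (ht : t ∈ Set.Icc 0 T) : Continuous (u t) := by
  have : ContinuousOn (u t) Set.univ :=
    ContinuousOn.comp (g := fun p : ℝ × Spc n => u p.1 p.2) h
      (f := fun x => (t, x)) (by fun_prop) (fun x _ => ⟨ht, trivial⟩)
  exact continuousOn_univ.mp this

theorem ContT.time {F : Type*} [TopologicalSpace F] {u : ℝ → Spc n → F} (h : ContT T u)
    (x : Spc n) : ContinuousOn (fun t => u t x) (Set.Icc 0 T) :=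
  ContinuousOn.comp (g := fun p : ℝ × Spc n => u p.1 p.2) h
      (f := fun t => (t, x)) (by fun_prop) (fun t ht => ⟨ht, trivial⟩)

/-- The predicate `P` only sees values on `[0,T]`. -/
def Local (T : ℝ) (P : ℝ → (ℝ → Spc n → ℝ) → Prop) : Prop :=
  ∀ σ u v, EqT T u v → P σ u → P σ v

theorem local_supBd (T C : ℝ) : Local (n := n) T (SupBd T C) := by
  intro σ u v h hu
  refine ⟨hu.cont.congr h, fun t ht x => ?_⟩
  rw [← h t ht x]; exact hu.sup t ht x

theorem HolBd.congr {F : Type*} [NormedAddCommGroup F] {lam C σ : ℝ} {u v : ℝ → Spc n → F}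
    (hu : HolBd T lam C σ u) (h : EqT T u v) : HolBd T lam C σ v := by
  refine ⟨hu.cont.congr h, fun t ht x => ?_, fun t ht x y hxy hd => ?_,
    fun t ht x y hx hy hxy => ?_, fun t ht t' ht' htt x => ?_⟩
  · rw [← h t ht x]; exact hu.sup t ht x
  · rw [← h t ht x, ← h t ht y]; exact hu.near t ht x y hxy hd
  · rw [← h t ht x, ← h t ht y]; exact hu.ball t ht x y hx hy hxy
  · rw [← h t ht x, ← h t' ht' x]; exact hu.time t ht t' ht' htt x

theorem local_holBd (T lam C : ℝ) : Local (n := n) T (HolBd T lam C) :=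
  fun _ _ _ h hu => hu.congr h

theorem SpReg.base {P : ℝ → (ℝ → Spc n → ℝ) → Prop} {N : ℕ} {σ : ℝ} {u : ℝ → Spc n → ℝ}
    (h : SpReg T P N σ u) : P σ u := by
  cases N with
  | zero => exact h
  | succ N => exact h.1

theorem ParReg.spReg {P : ℝ → (ℝ → Spc n → ℝ) → Prop} {s K : ℕ} {σ : ℝ} {u : ℝ → Spc n → ℝ}
    (h : ParReg T P s K σ u) : SpReg T P (K + 2 * s) σ u := by
  cases s with
  | zero => exact h
  | succ s => exact h.1

theorem ParReg.base {P : ℝ → (ℝ → Spc n → ℝ) → Prop} {s K : ℕ} {σ : ℝ} {u : ℝ → Spc n → ℝ}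
    (h : ParReg T P s K σ u) : P σ u := h.spReg.base

theorem SpReg.congr {P : ℝ → (ℝ → Spc n → ℝ) → Prop} (hP : Local T P) {N : ℕ} {σ : ℝ}
    {u v : ℝ → Spc n → ℝ} (h : SpReg T P N σ u) (huv : EqT T u v) : SpReg T P N σ v := by
  cases N with
  | zero => exact hP _ _ _ huv h
  | succ N =>
    obtain ⟨h1, g, hg, h2⟩ := h
    exact ⟨hP _ _ _ huv h1, g, hg.congr huv, h2⟩

theorem ParReg.congr {P : ℝ → (ℝ → Spc n → ℝ) → Prop} (hP : Local T P) {s K : ℕ} {σ : ℝ}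
    {u v : ℝ → Spc n → ℝ} (h : ParReg T P s K σ u) (huv : EqT T u v) : ParReg T P s K σ v := by
  cases s with
  | zero => exact SpReg.congr hP h huv
  | succ N =>
    obtain ⟨h1, g, hg, h2⟩ := h
    exact ⟨h1.congr hP huv, g, hg.congr huv, h2⟩

theorem SpReg.imp {P Q : ℝ → (ℝ → Spc n → ℝ) → Prop} {a σ₀ : ℝ}
    (hPQ : ∀ σ u, σ₀ ≤ σ → P σ u → Q (σ + a) u) {N : ℕ} {σ : ℝ} (hσ : σ₀ ≤ σ)
    {u : ℝ → Spc n → ℝ} (h : SpReg T P N σ u) : SpReg T Q N (σ + a) u := by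
  induction N generalizing σ u with
  | zero => exact hPQ _ _ hσ h
  | succ N ih =>
    obtain ⟨h1, g, hg, h2⟩ := h
    refine ⟨hPQ _ _ hσ h1, g, hg, fun i => ?_⟩
    have := ih (by linarith) (h2 i)
    rwa [add_right_comm] at this

theorem ParReg.imp {P Q : ℝ → (ℝ → Spc n → ℝ) → Prop} {a σ₀ : ℝ}
    (hPQ : ∀ σ u, σ₀ ≤ σ → P σ u → Q (σ + a) u) {s K : ℕ} {σ : ℝ} (hσ : σ₀ ≤ σ)
    {u : ℝ → Spc n → ℝ} (h : ParReg T P s K σ u) : ParReg T Q s K (σ + a) u := by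
  induction s generalizing u with
  | zero => exact SpReg.imp hPQ hσ h
  | succ N ih =>
    obtain ⟨h1, g, hg, h2⟩ := h
    exact ⟨h1.imp hPQ hσ, g, hg, ih h2⟩

theorem SpReg.mono_order {P : ℝ → (ℝ → Spc n → ℝ) → Prop} {N M : ℕ} (hMN : M ≤ N) {σ : ℝ}
    {u : ℝ → Spc n → ℝ} (h : SpReg T P N σ u) : SpReg T P M σ u := by
  induction M generalizing N σ u with
  | zero => exact h.base
  | succ M ih =>
    obtain ⟨N, rfl⟩ : ∃ N', N = N' + 1 := ⟨N - 1, by omega⟩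
    obtain ⟨h1, g, hg, h2⟩ := h
    exact ⟨h1, g, hg, fun i => ih (by omega) (h2 i)⟩

theorem ParReg.mono_order {P : ℝ → (ℝ → Spc n → ℝ) → Prop} {s K L : ℕ} (hKL : L ≤ K) {σ : ℝ}
    {u : ℝ → Spc n → ℝ} (h : ParReg T P s K σ u) : ParReg T P s L σ u := by
  induction s generalizing u with
  | zero => exact SpReg.mono_order hKL h
  | succ N ih =>
    obtain ⟨h1, g, hg, h2⟩ := h
    exact ⟨h1.mono_order (by omega), g, hg, ih h2⟩

theorem ParReg.drop_time {P : ℝ → (ℝ → Spc n → ℝ) → Prop} {s K : ℕ} {σ : ℝ}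
    {u : ℝ → Spc n → ℝ} (h : ParReg T P (s + 1) K σ u) : ParReg T P s (K + 2) σ u := by
  induction s generalizing u with
  | zero => exact h.1
  | succ s ih =>
    obtain ⟨h1, g, hg, h2⟩ := h
    exact ⟨by convert h1 using 1; ring, g, hg, ih h2⟩

theorem SupBd.mono {F : Type*} [NormedAddCommGroup F] {C C' σ τ : ℝ} {u : ℝ → Spc n → F}
    (h : SupBd T C σ u) (hC : C ≤ C') (hτ : τ ≤ σ) : SupBd T C' τ u :=
  ⟨h.cont, fun t ht x => (mul_le_mul_of_nonneg_right (wt_rpow_mono x hτ)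
    (norm_nonneg _)).trans ((h.sup t ht x).trans hC)⟩

theorem one_le_wt2 (x y : Spc n) : 1 ≤ wt2 x y := (one_le_wt x).trans (le_max_left _ _)

theorem HolBd.mono {F : Type*} [NormedAddCommGroup F] {lam C C' σ τ : ℝ} {u : ℝ → Spc n → F}
    (h : HolBd T lam C σ u) (hC : C ≤ C') (hτ : τ ≤ σ) : HolBd T lam C' τ u := by
  refine ⟨h.cont, fun t ht x => ?_, fun t ht x y hxy hd => ?_,
    fun t ht x y hx hy hxy => (h.ball t ht x y hx hy hxy).trans hC, fun t ht t' ht' htt x => ?_⟩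
  · exact (mul_le_mul_of_nonneg_right (wt_rpow_mono x hτ)
      (norm_nonneg _)).trans ((h.sup t ht x).trans hC)
  · refine le_trans ?_ ((h.near t ht x y hxy hd).trans hC)
    have := Real.rpow_le_rpow_of_exponent_le (one_le_wt2 x y) (add_le_add_left hτ lam)
    gcongr
  · refine le_trans ?_ ((h.time t ht t' ht' htt x).trans hC)
    have := wt_rpow_mono x hτ
    gcongr

theorem HolBd.supBd {F : Type*} [NormedAddCommGroup F] {lam C σ : ℝ} {u : ℝ → Spc n → F}
    (h : HolBd T lam C σ u) : SupBd T C σ u := ⟨h.cont, h.sup⟩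

theorem HasDx.add {u v : ℝ → Spc n → ℝ} {g g' : Fin n → ℝ → Spc n → ℝ} (h : HasDx T u g)
    (h' : HasDx T v g') : HasDx T (u + v) (g + g') := by
  intro t ht x
  refine ((h t ht x).add (h' t ht x)).congr_fderiv ?_
  ext w; simp [gradForm_apply, add_mul, Finset.sum_add_distrib]

theorem HasDx.smul {u : ℝ → Spc n → ℝ} {g : Fin n → ℝ → Spc n → ℝ} (c : ℝ) (h : HasDx T u g) :
    HasDx T (c • u) (c • g) := by
  intro t ht x
  refine ((h t ht x).const_smul c).congr_fderiv ?_
  ext w; simp [gradForm_apply, Finset.mul_sum, mul_assoc]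

theorem HasDx.mul {u v : ℝ → Spc n → ℝ} {g g' : Fin n → ℝ → Spc n → ℝ} (h : HasDx T u g)
    (h' : HasDx T v g') : HasDx T (u * v) (fun i => g i * v + u * g' i) := by
  intro t ht x
  refine ((h t ht x).mul (h' t ht x)).congr_fderiv ?_
  ext w
  simp only [gradForm_apply, Pi.add_apply, Pi.mul_apply, add_apply,
    smul_apply, smul_eq_mul, Finset.mul_sum, ← Finset.sum_add_distrib]
  exact Finset.sum_congr rfl fun i _ => by ring

theorem HasDt.add {u v g g' : ℝ → Spc n → ℝ} (h : HasDt T u g) (h' : HasDt T v g') :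
    HasDt T (u + v) (g + g') := fun t ht x => (h t ht x).add (h' t ht x)

theorem HasDt.smul {u g : ℝ → Spc n → ℝ} (c : ℝ) (h : HasDt T u g) :
    HasDt T (c • u) (c • g) := fun t ht x => (h t ht x).const_smul c

theorem HasDt.mul {u v g g' : ℝ → Spc n → ℝ} (h : HasDt T u g) (h' : HasDt T v g') :
    HasDt T (u * v) (g * v + u * g') := fun t ht x => (h t ht x).mul (h' t ht x)

theorem SpReg.add {P Q R : ℝ → (ℝ → Spc n → ℝ) → Prop}
    (hPQ : ∀ σ u v, P σ u → Q σ v → R σ (u + v)) {N : ℕ} {σ : ℝ}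
    {u v : ℝ → Spc n → ℝ} (h : SpReg T P N σ u) (h' : SpReg T Q N σ v) :
    SpReg T R N σ (u + v) := by
  induction N generalizing σ u v with
  | zero => exact hPQ _ _ _ h h'
  | succ N ih =>
    obtain ⟨h1, g, hg, h2⟩ := h
    obtain ⟨h1', g', hg', h2'⟩ := h'
    exact ⟨hPQ _ _ _ h1 h1', g + g', hg.add hg', fun i => ih (h2 i) (h2' i)⟩

theorem ParReg.add {P Q R : ℝ → (ℝ → Spc n → ℝ) → Prop}
    (hPQ : ∀ σ u v, P σ u → Q σ v → R σ (u + v)) {s K : ℕ} {σ : ℝ}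
    {u v : ℝ → Spc n → ℝ} (h : ParReg T P s K σ u) (h' : ParReg T Q s K σ v) :
    ParReg T R s K σ (u + v) := by
  induction s generalizing u v with
  | zero => exact SpReg.add hPQ h h'
  | succ N ih =>
    obtain ⟨h1, g, hg, h2⟩ := h
    obtain ⟨h1', g', hg', h2'⟩ := h'
    exact ⟨h1.add hPQ h1', g + g', hg.add hg', ih h2 h2'⟩

theorem SpReg.smul {P Q : ℝ → (ℝ → Spc n → ℝ) → Prop} {c : ℝ}
    (hPQ : ∀ σ u, P σ u → Q σ (c • u)) {N : ℕ} {σ : ℝ}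
    {u : ℝ → Spc n → ℝ} (h : SpReg T P N σ u) : SpReg T Q N σ (c • u) := by
  induction N generalizing σ u with
  | zero => exact hPQ _ _ h
  | succ N ih =>
    obtain ⟨h1, g, hg, h2⟩ := h
    exact ⟨hPQ _ _ h1, c • g, hg.smul c, fun i => ih (h2 i)⟩

theorem ParReg.smul {P Q : ℝ → (ℝ → Spc n → ℝ) → Prop} {c : ℝ}
    (hPQ : ∀ σ u, P σ u → Q σ (c • u)) {s K : ℕ} {σ : ℝ}
    {u : ℝ → Spc n → ℝ} (h : ParReg T P s K σ u) : ParReg T Q s K σ (c • u) := by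
  induction s generalizing u with
  | zero => exact SpReg.smul hPQ h
  | succ N ih =>
    obtain ⟨h1, g, hg, h2⟩ := h
    exact ⟨h1.smul hPQ, c • g, hg.smul c, ih h2⟩

theorem SupBd.add {F : Type*} [NormedAddCommGroup F] {C C' σ : ℝ} {u v : ℝ → Spc n → F}
    (h : SupBd T C σ u) (h' : SupBd T C' σ v) :
    SupBd T (C + C') σ (u + v) := by
  refine ⟨ContinuousOn.add h.cont h'.cont, fun t ht x => ?_⟩
  have h1 := h.sup t ht x
  have h2 := h'.sup t ht x
  calc _ ≤ wt x ^ σ * (‖u t x‖ + ‖v t x‖) := by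
        gcongr
        · exact (wt_rpow_pos x σ).le
        · exact norm_add_le _ _
    _ ≤ _ := by rw [mul_add]; exact add_le_add h1 h2

theorem SupBd.smul {C σ : ℝ} {u : ℝ → Spc n → ℝ} (c : ℝ) (h : SupBd T C σ u) :
    SupBd T (|c| * C) σ (c • u) := by
  refine ⟨ContinuousOn.const_smul h.cont c, fun t ht x => ?_⟩
  have h1 := h.sup t ht x
  simp only [Pi.smul_apply, norm_smul, Real.norm_eq_abs c]
  calc _ = |c| * (wt x ^ σ * ‖u t x‖) := by ring
    _ ≤ _ := by gcongr

theorem SupBd.mul {C C' σ σ' : ℝ} {u v : ℝ → Spc n → ℝ} (h : SupBd T C σ u)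
    (h' : SupBd T C' σ' v) (hC : 0 ≤ C) : SupBd T (C * C') (σ + σ') (u * v) := by
  refine ⟨ContinuousOn.mul h.cont h'.cont, fun t ht x => ?_⟩
  have h1 := h.sup t ht x
  have h2 := h'.sup t ht x
  simp only [Pi.mul_apply, norm_mul]
  rw [Real.rpow_add (wt_pos x)]
  calc _ = (wt x ^ σ * ‖u t x‖) * (wt x ^ σ' * ‖v t x‖) := by ring
    _ ≤ _ := mul_le_mul h1 h2 (mul_nonneg (wt_rpow_pos x σ').le (norm_nonneg _)) hC

theorem SpReg.mul_supBd {C C' : ℝ} (hC : 0 ≤ C) {N : ℕ} {σ σ' : ℝ} {u v : ℝ → Spc n → ℝ}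
    (h : SpReg T (SupBd T C) N σ u) (h' : SpReg T (SupBd T C') N σ' v) (hC' : 0 ≤ C') :
    SpReg T (SupBd T (2 ^ N * (C * C'))) N (σ + σ') (u * v) := by
  induction N generalizing σ σ' u v with
  | zero => simpa [SpReg] using SupBd.mul h h' hC
  | succ N ih =>
    have hu := h.mono_order (Nat.le_succ N)
    have hv := h'.mono_order (Nat.le_succ N)
    obtain ⟨h1, g, hg, h2⟩ := h
    obtain ⟨h1', g', hg', h2'⟩ := h'
    refine ⟨(h1.mul h1' hC).mono ?_ le_rfl, _, hg.mul hg', fun i => ?_⟩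
    · have : (1 : ℝ) ≤ 2 ^ (N + 1) := one_le_pow₀ (by norm_num)
      nlinarith [mul_nonneg hC hC']
    · have e1 := ih (h2 i) hv
      have e2 := ih hu (h2' i)
      rw [add_right_comm] at e1
      rw [← add_assoc] at e2
      refine SpReg.add (fun σ u v hu hv => ?_) e1 e2
      exact (hu.add hv).mono (by rw [pow_succ]; linarith) le_rfl

theorem ParReg.mul_supBd {C C' : ℝ} (hC : 0 ≤ C) (hC' : 0 ≤ C') {s K : ℕ} {σ σ' : ℝ}
    {u v : ℝ → Spc n → ℝ}
    (h : ParReg T (SupBd T C) s K σ u) (h' : ParReg T (SupBd T C') s K σ' v) :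
    ParReg T (SupBd T (2 ^ (K + 2 * s + s) * (C * C'))) s K (σ + σ') (u * v) := by
  induction s generalizing u v with
  | zero => exact SpReg.mul_supBd hC h h' hC'
  | succ s ih =>
    have hu := h.drop_time.mono_order (Nat.le_add_right K 2)
    have hv := h'.drop_time.mono_order (Nat.le_add_right K 2)
    obtain ⟨h1, g, hg, h2⟩ := h
    obtain ⟨h1', g', hg', h2'⟩ := h'
    have hCC := mul_nonneg hC hC'
    have key : ∀ {a b : ℕ}, a ≤ b → (2 : ℝ) ^ a * (C * C') ≤ 2 ^ b * (C * C') := fun hab =>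
      mul_le_mul_of_nonneg_right (pow_le_pow_right₀ (by norm_num) hab) hCC
    refine ⟨?_, _, hg.mul hg', ?_⟩
    · have := h1.mul_supBd hC h1' hC'
      have := SpReg.imp (a := 0) (σ₀ := σ + σ') (Q := SupBd T (2 ^ (K + 2 * (s + 1) + (s + 1)) * (C * C')))
        (fun τ w _ hw => hw.mono (key (by omega)) (by simp)) le_rfl this
      simpa using this
    · refine ParReg.add (fun σ u v hu hv => ?_) (ih h2 hv) (ih hu h2')
      refine (hu.add hv).mono ?_ le_rfl
      rw [← two_mul, ← mul_assoc, ← pow_succ']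
      exact key (by omega)

end basic

theorem norm_gradForm_le (a : Fin n → ℝ) {C : ℝ} (h : ∀ i, |a i| ≤ C) :
    ‖gradForm a‖ ≤ n * C := by
  have hp : ∀ i : Fin n, ‖(EuclideanSpace.proj i : Spc n →L[ℝ] ℝ)‖ ≤ 1 := fun i =>
    ContinuousLinearMap.opNorm_le_bound _ zero_le_one fun v => by
      simpa using PiLp.norm_apply_le v i
  calc ‖gradForm a‖ ≤ ∑ i, ‖a i • (EuclideanSpace.proj i : Spc n →L[ℝ] ℝ)‖ :=
        norm_sum_le _ _
    _ ≤ ∑ _i : Fin n, C := by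
        refine Finset.sum_le_sum fun i _ => ?_
        rw [norm_smul, Real.norm_eq_abs]
        exact (mul_le_of_le_one_right (abs_nonneg _) (hp i)).trans (h i)
    _ = n * C := by simp

theorem gradForm_sub (a b : Fin n → ℝ) :
    gradForm a - gradForm b = gradForm fun i => a i - b i := by
  ext v; simp [gradForm_apply, sub_mul]

theorem hasFDerivAt_integral_gradForm {α : Type*} [MeasurableSpace α] {ν : Measure α}
    {F : Spc n → α → ℝ} {G : Fin n → Spc n → α → ℝ} {bound : α → ℝ} {x₀ : Spc n}
    {s : Set (Spc n)} (hs : s ∈ nhds x₀)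
    (hF_meas : ∀ x, AEStronglyMeasurable (F x) ν) (hF_int : Integrable (F x₀) ν)
    (hG_meas : ∀ i, AEStronglyMeasurable (G i x₀) ν)
    (h_bound : ∀ᵐ a ∂ν, ∀ x ∈ s, ∀ i, |G i x a| ≤ bound a) (hb : Integrable bound ν)
    (h_diff : ∀ᵐ a ∂ν, ∀ x ∈ s, HasFDerivAt (fun x => F x a) (gradForm fun i => G i x a) x) :
    HasFDerivAt (fun x => ∫ a, F x a ∂ν) (gradForm fun i => ∫ a, G i x₀ a ∂ν) x₀ := by
  have hGint : ∀ i, Integrable (G i x₀) ν := fun i =>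
    hb.mono' (hG_meas i) (h_bound.mono fun a ha => ha x₀ (mem_of_mem_nhds hs) i)
  have key := hasFDerivAt_integral_of_dominated_of_fderiv_le (μ := ν) (F := F)
    (F' := fun x a => gradForm fun i => G i x a) (bound := fun a => n * bound a) hs
    (Eventually.of_forall hF_meas) hF_int ?_ ?_ (hb.const_mul _) h_diff
  · refine key.congr_fderiv ?_
    simp only [gradForm]
    rw [integral_finsetSum _ fun i _ => (hGint i).smul_const _]
    exact Finset.sum_congr rfl fun i _ => integral_smul_const _ _
  · simp only [gradForm]
    exact Finset.aestronglyMeasurable_fun_sum _ fun i _ =>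
      (hG_meas i).smul_const _
  · exact h_bound.mono fun a ha x hx => norm_gradForm_le _ (ha x hx)

section time

variable {T : ℝ}

theorem ContT.intervalIntegrable {g : ℝ → Spc n → ℝ} (hg : ContT T g) {a b : ℝ}
    (ha : a ∈ Set.Icc 0 T) (hb : b ∈ Set.Icc 0 T) (x : Spc n) :
    IntervalIntegrable (fun τ => g τ x) volume a b :=
  ((hg.time x).mono (Set.uIcc_subset_Icc ha hb)).intervalIntegrable

theorem HasDt.integral_eq {u g : ℝ → Spc n → ℝ} (h : HasDt T u g) (hg : ContT T g)
    {a b : ℝ} (ha : a ∈ Set.Icc 0 T) (hb : b ∈ Set.Icc 0 T) (x : Spc n) :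
    ∫ τ in a..b, g τ x = u b x - u a x := by
  have hsub := Set.uIcc_subset_Icc ha hb
  refine intervalIntegral.integral_eq_sub_of_hasDeriv_right (f := fun τ => u τ x) ?_ ?_
    (hg.intervalIntegrable ha hb x)
  · exact fun t ht => ((h t (hsub ht) x).continuousWithinAt).mono hsub
  · intro t ht
    have ht' := hsub (Set.Ioo_subset_Icc_self ht)
    have hlt : t < T := lt_of_lt_of_le ht.2 (max_le ha.2 hb.2)
    refine (h t ht' x).mono_of_mem_nhdsWithin ?_
    exact mem_of_superset (Ioo_mem_nhdsGT hlt) fun z hz => ⟨ht'.1.trans hz.1.le, hz.2.le⟩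

theorem hasDt_of_integral {u g : ℝ → Spc n → ℝ} (hg : ContT T g)
    (h : ∀ t ∈ Set.Icc 0 T, ∀ x, u t x = u 0 x + ∫ τ in (0 : ℝ)..t, g τ x) : HasDt T u g := by
  intro t ht x
  have hT : 0 ≤ T := ht.1.trans ht.2
  let G : ℝ → ℝ := fun τ => g (Set.projIcc 0 T hT τ) x
  have hG : Continuous G :=
    (continuousOn_iff_continuous_domRestrict.mp (hg.time x)).comp continuous_projIcc
  have hGeq : ∀ τ ∈ Set.Icc 0 T, G τ = g τ x := fun τ hτ => by
    simp only [G, Set.projIcc_of_mem hT hτ]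
  have hd : HasDerivAt (fun s => u 0 x + ∫ τ in (0 : ℝ)..s, G τ) (G t) t :=
    (intervalIntegral.integral_hasDerivAt_right (hG.intervalIntegrable _ _)
      (hG.stronglyMeasurableAtFilter _ _) hG.continuousAt).const_add _
  rw [hGeq t ht] at hd
  have e : ∀ s ∈ Set.Icc 0 T, u s x = u 0 x + ∫ τ in (0 : ℝ)..s, G τ := fun s hs => by
    rw [h s hs x]
    congr 1
    refine intervalIntegral.integral_congr fun τ hτ => (hGeq τ ?_).symm
    exact Set.uIcc_subset_Icc ⟨le_rfl, hT⟩ hs hτ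
  exact hd.hasDerivWithinAt.congr e (e t ht)

theorem ContT.exists_bound {g : ℝ → Spc n → ℝ} (hg : ContT T g) (x : Spc n) (r : ℝ) :
    ∃ B, ∀ t ∈ Set.Icc 0 T, ∀ y ∈ Metric.closedBall x r, |g t y| ≤ B := by
  obtain ⟨B, hB⟩ := (isCompact_Icc.prod (isCompact_closedBall x r)).exists_bound_of_continuousOn
    (f := fun p : ℝ × Spc n => g p.1 p.2) (ContinuousOn.mono hg fun p hp => ⟨hp.1, trivial⟩)
  exact ⟨B, fun t ht y hy => hB (t, y) ⟨ht, hy⟩⟩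

theorem HasDt.grad {u q : ℝ → Spc n → ℝ} {u' q' : Fin n → ℝ → Spc n → ℝ} (h : HasDt T u q)
    (hu : HasDx T u u') (hq : HasDx T q q') (hqc : ContT T q) (hqc' : ∀ i, ContT T (q' i))
    (i : Fin n) : HasDt T (u' i) (q' i) := by
  refine hasDt_of_integral (hqc' i) fun t ht x => ?_
  have h0 : (0 : ℝ) ∈ Set.Icc 0 T := ⟨le_rfl, ht.1.trans ht.2⟩
  have hsub : Set.uIoc 0 t ⊆ Set.Icc 0 T := fun τ hτ => by
    rw [Set.uIoc_of_le ht.1] at hτ; exact ⟨hτ.1.le, hτ.2.trans ht.2⟩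
  choose B hB using fun i => (hqc' i).exists_bound x 1
  have key := hasFDerivAt_integral_gradForm (ν := volume.restrict (Set.uIoc 0 t))
    (F := fun y τ => q τ y) (G := fun i y τ => q' i τ y) (x₀ := x)
    (bound := fun _ => ∑ i, |B i|) (Metric.closedBall_mem_nhds x one_pos)
    (fun y => (((hqc.time y).mono hsub).aestronglyMeasurable measurableSet_uIoc))
    ((hqc.intervalIntegrable h0 ht x).def')
    (fun i => ((((hqc' i).time x).mono hsub).aestronglyMeasurable measurableSet_uIoc))
    ?_ ?_ ?_
  · simp only [← intervalIntegral.integral_of_le ht.1, Set.uIoc_of_le ht.1] at key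
    have e : (fun y => ∫ τ in (0 : ℝ)..t, q τ y) = fun y => u t y - u 0 y :=
      funext fun y => h.integral_eq hqc h0 ht y
    rw [e] at key
    have := congrArg (fun L => L (EuclideanSpace.single i 1))
      (key.unique ((hu t ht x).sub (hu 0 h0 x)))
    simp only [sub_apply, gradForm_single] at this
    linarith
  · refine (ae_restrict_iff' measurableSet_uIoc).mpr (Eventually.of_forall fun τ hτ y hy j => ?_)
    exact ((hB j τ (hsub hτ) y hy).trans (le_abs_self _)).trans
      (Finset.single_le_sum (f := fun i => |B i|) (fun _ _ => abs_nonneg _) (Finset.mem_univ j))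
  · rw [Set.uIoc_of_le ht.1]; exact integrable_const _
  · exact (ae_restrict_iff' measurableSet_uIoc).mpr
      (Eventually.of_forall fun τ hτ y _ => hq τ (hsub hτ) y)

theorem SpReg.dx {P : ℝ → (ℝ → Spc n → ℝ) → Prop} (hP : Local T P) {N : ℕ} {σ : ℝ}
    {u : ℝ → Spc n → ℝ} {g : Fin n → ℝ → Spc n → ℝ} (h : SpReg T P (N + 1) σ u)
    (hg : HasDx T u g) (i : Fin n) : SpReg T P N (σ + 1) (g i) := by
  obtain ⟨_, g', hg', h2⟩ := h
  exact (h2 i).congr hP (hg'.unique hg i)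

theorem ParReg.dx {P : ℝ → (ℝ → Spc n → ℝ) → Prop} (hP : Local T P)
    (hPc : ∀ σ u, P σ u → ContT T u) {s K : ℕ} {σ : ℝ}
    {u : ℝ → Spc n → ℝ} {g : Fin n → ℝ → Spc n → ℝ} (h : ParReg T P s (K + 1) σ u)
    (hg : HasDx T u g) (i : Fin n) : ParReg T P s K (σ + 1) (g i) := by
  induction s generalizing u g with
  | zero => exact SpReg.dx hP h hg i
  | succ s ih =>
    obtain ⟨h1, q, hq, h2⟩ := h
    have e : K + 1 + 2 * (s + 1) = (K + 2 * (s + 1)) + 1 := by ring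
    rw [e] at h1
    refine ⟨h1.dx hP hg i, ?_⟩
    have h3 := h2.spReg
    rw [show K + 1 + 2 * s = (K + 2 * s) + 1 by ring] at h3
    obtain ⟨h4, q', hq', h5⟩ := h3
    exact ⟨q' i, hq.grad hg hq' (hPc _ _ h4) (fun j => hPc _ _ (h5 j).base) i, ih h2 hq'⟩

theorem ParReg.exists_dx {P : ℝ → (ℝ → Spc n → ℝ) → Prop} {s K : ℕ} {σ : ℝ}
    {u : ℝ → Spc n → ℝ} (h : ParReg T P s (K + 1) σ u) : ∃ g, HasDx T u g := by
  have h3 := h.spReg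
  rw [show K + 1 + 2 * s = (K + 2 * s) + 1 by ring] at h3
  exact ⟨_, h3.2.choose_spec.1⟩

/-- A spatial Lipschitz estimate for functions with weighted gradient bounds. -/
theorem HasDx.lipschitz {u : ℝ → Spc n → ℝ} {g : Fin n → ℝ → Spc n → ℝ} (hg : HasDx T u g)
    {C τ : ℝ} (hτ : 0 ≤ τ) {t : ℝ} (ht : t ∈ Set.Icc 0 T)
    (hC : ∀ i x, wt x ^ τ * |g i t x| ≤ C) {x y : Spc n} (hxy : ‖x - y‖ ≤ 1) :
    wt x ^ τ * |u t x - u t y| ≤ n * (2 ^ τ * C) * ‖x - y‖ := by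
  have hw := wt_rpow_pos x τ
  have hb : ∀ z ∈ Metric.closedBall x 1,
      ‖gradForm fun i => g i t z‖ ≤ n * (2 ^ τ * C) / wt x ^ τ := by
    intro z hz
    rw [mul_div_assoc]
    refine norm_gradForm_le _ fun i => ?_
    rw [le_div_iff₀ hw]
    have h1 : wt x ^ τ ≤ wt z ^ τ * 2 ^ τ := by
      refine (wt_rpow_le_mul hτ x z).trans ?_
      have : ‖x - z‖ ≤ 1 := by rw [← dist_eq_norm, dist_comm]; exact hz
      gcongr
      · exact (wt_rpow_pos z τ).le
      · linarith
    calc |g i t z| * wt x ^ τ ≤ |g i t z| * (wt z ^ τ * 2 ^ τ) := by gcongr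
      _ = 2 ^ τ * (wt z ^ τ * |g i t z|) := by ring
      _ ≤ _ := by gcongr; exact hC i z
  have := (convex_closedBall x 1).norm_image_sub_le_of_norm_hasFDerivWithin_le
    (f := u t) (f' := fun z => gradForm fun i => g i t z)
    (fun z _ => (hg t ht z).hasFDerivWithinAt) hb
    (x := y) (y := x) (by rw [Metric.mem_closedBall, dist_comm, dist_eq_norm]; exact hxy)
    (Metric.mem_closedBall_self zero_le_one)
  rw [Real.norm_eq_abs] at this
  calc _ ≤ wt x ^ τ * (n * (2 ^ τ * C) / wt x ^ τ * ‖x - y‖) := by gcongr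
    _ = _ := by field_simp

theorem HasDt.lipschitz {u q : ℝ → Spc n → ℝ} (hq : HasDt T u q) (hqc : ContT T q) {C τ : ℝ}
    (hC : ∀ t ∈ Set.Icc 0 T, ∀ x, wt x ^ τ * |q t x| ≤ C) {t t' : ℝ} (ht : t ∈ Set.Icc 0 T)
    (ht' : t' ∈ Set.Icc 0 T) (x : Spc n) :
    wt x ^ τ * |u t x - u t' x| ≤ C * |t - t'| := by
  have hw := wt_rpow_pos x τ
  rw [← hq.integral_eq hqc ht' ht x]
  have := intervalIntegral.norm_integral_le_of_norm_le_const (a := t') (b := t)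
    (f := fun τ => q τ x) (C := C / wt x ^ τ) (fun r hr => by
      rw [le_div_iff₀ hw, mul_comm]
      exact hC r (Set.uIcc_subset_Icc ht' ht (Set.uIoc_subset_uIcc hr)) x)
  rw [Real.norm_eq_abs] at this
  calc _ ≤ wt x ^ τ * (C / wt x ^ τ * |t - t'|) := by gcongr
    _ = _ := by field_simp

theorem rpow_le_rpow_mul_one_add {T d a b : ℝ} (hd : 0 ≤ d) (hdT : d ≤ T) (ha : 0 < a)
    (hab : a ≤ b) (hba : b ≤ a + 1) : d ^ b ≤ (1 + T) * d ^ a := by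
  rcases hd.eq_or_lt with rfl | hd
  · rw [Real.zero_rpow (by linarith), Real.zero_rpow ha.ne', mul_zero]
  · have : d ^ b = d ^ (b - a) * d ^ a := by rw [← Real.rpow_add hd]; congr 1; ring
    rw [this]
    gcongr
    calc d ^ (b - a) ≤ (1 + T) ^ (b - a) := Real.rpow_le_rpow hd.le (by linarith) (by linarith)
      _ ≤ (1 + T) ^ (1 : ℝ) := Real.rpow_le_rpow_of_exponent_le (by linarith) (by linarith)
      _ = 1 + T := Real.rpow_one _

/-- Local Hölder estimates with one extra power of the weight imply the weighted Hölder bound. -/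
theorem holBd_of_local {lam σ C : ℝ} (hl : 0 < lam) (hl1 : lam < 1) (hσ : 0 ≤ σ) (hC : 0 ≤ C)
    {u : ℝ → Spc n → ℝ}
    (hsup : ∀ t ∈ Set.Icc 0 T, ∀ x, wt x ^ (σ + 1) * |u t x| ≤ C)
    (hsp : ∀ t ∈ Set.Icc 0 T, ∀ x y, ‖x - y‖ ≤ 1 →
      wt x ^ (σ + 1) * |u t x - u t y| ≤ C * ‖x - y‖ ^ lam)
    (htm : ∀ t ∈ Set.Icc 0 T, ∀ t' ∈ Set.Icc 0 T, ∀ x,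
      wt x ^ σ * |u t x - u t' x| ≤ C * |t - t'| ^ (lam / 2)) :
    HolBd T lam (2 ^ (σ + 2) * C) σ u := by
  have hK : (1 : ℝ) ≤ 2 ^ (σ + 2) := Real.one_le_rpow (by norm_num) (by linarith)
  have hK2 : (2 : ℝ) ≤ 2 ^ (σ + 2) := by
    calc (2 : ℝ) = 2 ^ (1 : ℝ) := (Real.rpow_one 2).symm
      _ ≤ _ := Real.rpow_le_rpow_of_exponent_le (by norm_num) (by linarith)
  have hKC : C ≤ 2 ^ (σ + 2) * C := le_mul_of_one_le_left hC hK
  have hsp' : ∀ t ∈ Set.Icc 0 T, ∀ x y, ‖x - y‖ ≤ 1 →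
      |u t x - u t y| ≤ C * ‖x - y‖ ^ lam := fun t ht x y hxy =>
    (le_mul_of_one_le_left (abs_nonneg _) (one_le_wt_rpow x (by linarith))).trans
      (hsp t ht x y hxy)
  have htm' : ∀ t ∈ Set.Icc 0 T, ∀ t' ∈ Set.Icc 0 T, ∀ x,
      |u t x - u t' x| ≤ C * |t - t'| ^ (lam / 2) := fun t ht t' ht' x =>
    (le_mul_of_one_le_left (abs_nonneg _) (one_le_wt_rpow x hσ)).trans (htm t ht t' ht' x)
  have hsup' : ∀ t ∈ Set.Icc 0 T, ∀ x, |u t x| ≤ C := fun t ht x =>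
    (le_mul_of_one_le_left (abs_nonneg _) (one_le_wt_rpow x (by linarith))).trans
      (hsup t ht x)
  refine ⟨?_, fun t ht x => ?_, fun t ht x y hxy hd => ?_, fun t ht x y hx hy hxy => ?_,
    fun t ht t' ht' htt x => ?_⟩
  · rintro ⟨t, x⟩ ⟨ht, -⟩
    have hlim : Tendsto (fun p : ℝ × Spc n => C * ‖p.2 - x‖ ^ lam + C * |p.1 - t| ^ (lam / 2))
        (nhdsWithin (t, x) (Set.Icc 0 T ×ˢ Set.univ)) (nhds 0) := by
      have : Continuous fun p : ℝ × Spc n => C * ‖p.2 - x‖ ^ lam + C * |p.1 - t| ^ (lam / 2) := by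
        have h2 : 0 ≤ lam / 2 := by positivity
        exact (continuous_const.mul ((by fun_prop : Continuous fun p : ℝ × Spc n =>
          ‖p.2 - x‖).rpow_const fun _ => Or.inr hl.le)).add
          (continuous_const.mul ((by fun_prop : Continuous fun p : ℝ × Spc n =>
          |p.1 - t|).rpow_const fun _ => Or.inr h2))
      have h3 := this.tendsto (t, x)
      simp only [sub_self, norm_zero, abs_zero, Real.zero_rpow hl.ne',
        Real.zero_rpow (half_pos hl).ne', mul_zero, add_zero] at h3
      exact h3.mono_left nhdsWithin_le_nhds
    refine tendsto_iff_norm_sub_tendsto_zero.mpr ?_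
    refine squeeze_zero' (Eventually.of_forall fun _ => norm_nonneg _) ?_ hlim
    have hb : ∀ᶠ p : ℝ × Spc n in nhdsWithin (t, x) (Set.Icc 0 T ×ˢ Set.univ),
        ‖p.2 - x‖ ≤ 1 := by
      refine nhdsWithin_le_nhds ?_
      have : Tendsto (fun p : ℝ × Spc n => ‖p.2 - x‖) (nhds (t, x)) (nhds 0) := by
        have := (by fun_prop : Continuous fun p : ℝ × Spc n => ‖p.2 - x‖).tendsto (t, x)
        simpa using this
      exact (this.eventually (gt_mem_nhds one_pos)).mono fun _ h => h.le
    filter_upwards [hb, self_mem_nhdsWithin] with p hp hpT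
    calc ‖u p.1 p.2 - u t x‖ = |(u p.1 p.2 - u p.1 x) + (u p.1 x - u t x)| := by
          rw [Real.norm_eq_abs]; congr 1; ring
      _ ≤ _ := (abs_add_le _ _).trans (add_le_add (hsp' _ hpT.1 _ _ hp) (htm' _ hpT.1 _ ht x))
  · exact ((mul_le_mul_of_nonneg_right (wt_rpow_mono x (by linarith)) (norm_nonneg _)).trans
      (hsup t ht x)).trans hKC
  · have hpos : 0 < ‖x - y‖ := norm_pos_iff.mpr (sub_ne_zero.mpr hxy)
    have hpl : 0 < ‖x - y‖ ^ lam := Real.rpow_pos_of_pos hpos _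
    have hxy1 : ‖x‖ ≤ ‖y‖ + ‖x - y‖ := by
      calc ‖x‖ = ‖y + (x - y)‖ := by congr 1; abel
        _ ≤ _ := norm_add_le _ _
    have hyx1 : ‖y‖ ≤ ‖x‖ + ‖x - y‖ := by
      calc ‖y‖ = ‖x - (x - y)‖ := by congr 1; abel
        _ ≤ _ := norm_sub_le _ _
    have e1 : wt y ≤ 2 * wt x := by
      have := wt_le_add y x
      rw [norm_sub_rev] at this
      have := norm_le_wt x
      linarith [wt_pos x]
    have e2 : wt x ≤ 2 * wt y := by
      have := wt_le_add x y
      have := norm_le_wt y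
      linarith
    have w1 : wt2 x y ^ (σ + lam) ≤ 2 ^ (σ + 1) * wt x ^ (σ + 1) := by
      rw [← Real.mul_rpow (by norm_num) (wt_pos x).le]
      refine (Real.rpow_le_rpow_of_exponent_le (one_le_wt2 x y)
        (by linarith : σ + lam ≤ σ + 1)).trans ?_
      refine Real.rpow_le_rpow (by linarith [one_le_wt2 x y])
        (max_le (by linarith [wt_pos x]) e1) (by linarith)
    have w2 : wt2 x y ^ (σ + lam) ≤ 2 ^ (σ + 1) * wt y ^ (σ + 1) := by
      rw [← Real.mul_rpow (by norm_num) (wt_pos y).le]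
      refine (Real.rpow_le_rpow_of_exponent_le (one_le_wt2 x y)
        (by linarith : σ + lam ≤ σ + 1)).trans ?_
      refine Real.rpow_le_rpow (by linarith [one_le_wt2 x y])
        (max_le e2 (by linarith [wt_pos y])) (by linarith)
    have hpow : (2 : ℝ) ^ (σ + 2) = 2 * 2 ^ (σ + 1) := by
      rw [show σ + 2 = (σ + 1) + 1 by ring, Real.rpow_add_one (by norm_num)]; ring
    have h2pos : (0 : ℝ) < 2 ^ (σ + 1) := by positivity
    rw [div_le_iff₀ hpl, Real.norm_eq_abs]
    rcases le_or_gt ‖x - y‖ 1 with h1 | h1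
    · calc _ ≤ 2 ^ (σ + 1) * wt x ^ (σ + 1) * |u t x - u t y| := by gcongr
        _ = 2 ^ (σ + 1) * (wt x ^ (σ + 1) * |u t x - u t y|) := by ring
        _ ≤ 2 ^ (σ + 1) * (C * ‖x - y‖ ^ lam) := mul_le_mul_of_nonneg_left (hsp t ht x y h1) h2pos.le
        _ ≤ _ := by
          rw [hpow, mul_assoc]
          have : 0 ≤ 2 ^ (σ + 1) * (C * ‖x - y‖ ^ lam) := by positivity
          nlinarith
    · have hge : 1 ≤ ‖x - y‖ ^ lam := Real.one_le_rpow h1.le hl.le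
      have hw : 0 ≤ wt2 x y ^ (σ + lam) := Real.rpow_nonneg (by linarith [one_le_wt2 x y]) _
      calc wt2 x y ^ (σ + lam) * |u t x - u t y|
          ≤ wt2 x y ^ (σ + lam) * (|u t x| + |u t y|) := by gcongr; exact abs_sub _ _
        _ = wt2 x y ^ (σ + lam) * |u t x| + wt2 x y ^ (σ + lam) * |u t y| := by ring
        _ ≤ 2 ^ (σ + 1) * wt x ^ (σ + 1) * |u t x| + 2 ^ (σ + 1) * wt y ^ (σ + 1) * |u t y| := by
          gcongr
        _ ≤ 2 ^ (σ + 1) * C + 2 ^ (σ + 1) * C := by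
          rw [mul_assoc, mul_assoc]
          gcongr
          · exact hsup t ht x
          · exact hsup t ht y
        _ = 2 ^ (σ + 2) * C := by rw [hpow]; ring
        _ ≤ _ := le_mul_of_one_le_right (by positivity) hge
  · have hpos : 0 < ‖x - y‖ := norm_pos_iff.mpr (sub_ne_zero.mpr hxy)
    have hpl : 0 < ‖x - y‖ ^ lam := Real.rpow_pos_of_pos hpos _
    rw [div_le_iff₀ hpl, Real.norm_eq_abs]
    rcases le_or_gt ‖x - y‖ 1 with h1 | h1
    · exact (hsp' t ht x y h1).trans (by gcongr)
    · have hge : 1 ≤ ‖x - y‖ ^ lam := Real.one_le_rpow h1.le hl.le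
      calc |u t x - u t y| ≤ |u t x| + |u t y| := abs_sub _ _
        _ ≤ C + C := add_le_add (hsup' t ht x) (hsup' t ht y)
        _ = 2 * C := by ring
        _ ≤ 2 ^ (σ + 2) * C := by gcongr
        _ ≤ _ := le_mul_of_one_le_right (by positivity) hge
  · rw [div_le_iff₀ (Real.rpow_pos_of_pos (abs_pos.mpr (sub_ne_zero.mpr htt)) _)]
    exact (htm t ht t' ht' x).trans (by gcongr)

end time

section smoothToHolder

variable {T : ℝ}

theorem le_rpow_self_of_le_one {d a : ℝ} (h0 : 0 ≤ d) (h1 : d ≤ 1) (ha1 : a ≤ 1) (ha : 0 < a) :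
    d ≤ d ^ a := by
  rcases h0.eq_or_lt with rfl | hd
  · rw [Real.zero_rpow ha.ne']
  · calc d = d ^ (1 : ℝ) := (Real.rpow_one d).symm
      _ ≤ d ^ a := Real.rpow_le_rpow_of_exponent_ge hd h1 ha1

theorem holBd_of_deriv {lam σ C : ℝ} (hl : 0 < lam) (hl1 : lam < 1) (hσ : 0 ≤ σ)
    (hC : 0 ≤ C) {p : ℝ → Spc n → ℝ} {g : Fin n → ℝ → Spc n → ℝ} (hg : HasDx T p g)
    (hp : SupBd T C (σ + 1) p) (hgb : ∀ i, SupBd T C (σ + 1) (g i))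
    (htm : ∀ t ∈ Set.Icc 0 T, ∀ t' ∈ Set.Icc 0 T, ∀ x,
      wt x ^ σ * |p t x - p t' x| ≤ C * |t - t'| ^ (lam / 2)) :
    HolBd T lam (2 ^ (σ + 2) * ((n * 2 ^ (σ + 1) + 1) * C)) σ p := by
  have hC' : C ≤ (n * 2 ^ (σ + 1) + 1) * C := le_mul_of_one_le_left hC (by
    have : (0 : ℝ) ≤ n * 2 ^ (σ + 1) := by positivity
    linarith)
  refine holBd_of_local hl hl1 hσ (by positivity) (fun t ht x => (hp.sup t ht x).trans hC')
    (fun t ht x y hxy => ?_) (fun t ht t' ht' x => (htm t ht t' ht' x).trans (by gcongr))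
  refine (hg.lipschitz (by linarith) ht (fun i x => (hgb i).sup t ht x) hxy).trans ?_
  have h1 := le_rpow_self_of_le_one (norm_nonneg (x - y)) hxy hl1.le hl
  calc n * (2 ^ (σ + 1) * C) * ‖x - y‖ ≤ n * (2 ^ (σ + 1) * C) * ‖x - y‖ ^ lam := by gcongr
    _ = (n * 2 ^ (σ + 1)) * C * ‖x - y‖ ^ lam := by ring
    _ ≤ _ := by gcongr; linarith

theorem HasDt.holder {lam σ C : ℝ} (hl : 0 < lam) (hl1 : lam < 1) (hC : 0 ≤ C)
    {p q : ℝ → Spc n → ℝ} (hq : HasDt T p q) (hqb : SupBd T C σ q) :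
    ∀ t ∈ Set.Icc 0 T, ∀ t' ∈ Set.Icc 0 T, ∀ x,
      wt x ^ σ * |p t x - p t' x| ≤ (1 + T) * C * |t - t'| ^ (lam / 2) := by
  intro t ht t' ht' x
  refine (hq.lipschitz hqb.cont hqb.sup ht ht' x).trans ?_
  have hd : |t - t'| ≤ T := by
    rw [abs_le]; constructor <;> linarith [ht.1, ht.2, ht'.1, ht'.2]
  have := rpow_le_rpow_mul_one_add (abs_nonneg (t - t')) hd (half_pos hl)
    (by linarith : lam / 2 ≤ 1) (by linarith)
  rw [Real.rpow_one] at this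
  calc C * |t - t'| ≤ C * ((1 + T) * |t - t'| ^ (lam / 2)) := by gcongr
    _ = _ := by ring

theorem HasDx.taylor {p : ℝ → Spc n → ℝ} {g : Fin n → ℝ → Spc n → ℝ}
    {gg : Fin n → Fin n → ℝ → Spc n → ℝ} (hg : HasDx T p g) (hgg : ∀ i, HasDx T (g i) (gg i))
    {C τ : ℝ} (hτ : 0 ≤ τ) {t : ℝ} (ht : t ∈ Set.Icc 0 T)
    (hC : ∀ i j x, wt x ^ τ * |gg i j t x| ≤ C) (x : Spc n) (i : Fin n) {h : ℝ} (h0 : 0 ≤ h)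
    (h1 : h ≤ 1) :
    wt x ^ τ * |p t (x + EuclideanSpace.single i h) - p t x - h * g i t x| ≤
      n * (n * (2 ^ τ * C)) * h ^ 2 := by
  have hw := wt_rpow_pos x τ
  have hn : ‖(EuclideanSpace.single i h : Spc n)‖ = h := by
    rw [PiLp.norm_single, Real.norm_of_nonneg h0]
  have hb : ∀ z ∈ Metric.closedBall x h,
      ‖(gradForm fun j => g j t z) - gradForm fun j => g j t x‖ ≤
        n * (n * (2 ^ τ * C) * h / wt x ^ τ) := by
    intro z hz
    rw [gradForm_sub]
    refine norm_gradForm_le _ fun j => ?_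
    have hz' : ‖x - z‖ ≤ h := by rw [← dist_eq_norm, dist_comm]; exact hz
    rw [le_div_iff₀ hw, mul_comm, abs_sub_comm]
    refine ((hgg j).lipschitz hτ ht (fun l x => hC j l x) (hz'.trans h1)).trans ?_
    have hC0 : 0 ≤ C := (mul_nonneg hw.le (abs_nonneg _)).trans (hC i i x)
    gcongr
  have := (convex_closedBall x h).norm_image_sub_le_of_norm_hasFDerivWithin_le'
    (f := p t) (f' := fun z => gradForm fun j => g j t z) (φ := gradForm fun j => g j t x)
    (fun z _ => (hg t ht z).hasFDerivWithinAt) hb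
    (x := x) (y := x + EuclideanSpace.single i h) (Metric.mem_closedBall_self h0)
    (by rw [Metric.mem_closedBall, dist_eq_norm, add_sub_cancel_left, hn])
  rw [add_sub_cancel_left, hn, Real.norm_eq_abs, gradForm_apply] at this
  have e : ∑ j, g j t x * (EuclideanSpace.single i h : Spc n) j = h * g i t x := by
    simp [mul_comm]
  rw [e] at this
  calc _ ≤ wt x ^ τ * (n * (n * (2 ^ τ * C) * h / wt x ^ τ) * h) := by gcongr
    _ = _ := by field_simp

theorem HasDx.holder_time {p q : ℝ → Spc n → ℝ} {g : Fin n → ℝ → Spc n → ℝ}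
    {gg : Fin n → Fin n → ℝ → Spc n → ℝ} (hg : HasDx T p g) (hgg : ∀ i, HasDx T (g i) (gg i))
    (hq : HasDt T p q) {lam C τ : ℝ} (hl : 0 < lam) (hl1 : lam < 1) (hτ : 0 ≤ τ) (hC : 0 ≤ C)
    (hqb : SupBd T C τ q) (hgb : ∀ i, SupBd T C τ (g i))
    (hggb : ∀ i j, SupBd T C τ (gg i j)) (i : Fin n) :
    ∀ t ∈ Set.Icc 0 T, ∀ t' ∈ Set.Icc 0 T, ∀ x,
      wt x ^ τ * |g i t x - g i t' x| ≤
        (2 * (n * n * 2 ^ τ) + 2 * 2 ^ τ) * C * |t - t'| ^ (lam / 2) := by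
  intro t ht t' ht' x
  have hw := wt_rpow_pos x τ
  have h2 : (1 : ℝ) ≤ 2 ^ τ := Real.one_le_rpow (by norm_num) hτ
  rcases le_or_gt |t - t'| 1 with hd | hd
  · rcases (abs_nonneg (t - t')).eq_or_lt with h0 | hpos
    · have : t = t' := by rw [eq_comm, abs_eq_zero, sub_eq_zero] at h0; exact h0
      subst this
      simp only [sub_self, abs_zero, mul_zero]
      positivity
    set h := √|t - t'| with hh
    have hh0 : 0 < h := Real.sqrt_pos.mpr hpos
    have hh1 : h ≤ 1 := Real.sqrt_le_one.mpr hd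
    have hsq : h ^ 2 = |t - t'| := Real.sq_sqrt hpos.le
    set y := x + EuclideanSpace.single i h with hy
    have hxy : ‖x - y‖ = h := by
      rw [hy, sub_add_cancel_left, norm_neg, PiLp.norm_single,
        Real.norm_of_nonneg hh0.le]
    have a1 := hg.taylor hgg hτ ht (fun i j x => (hggb i j).sup t ht x) x i hh0.le hh1
    have a2 := hg.taylor hgg hτ ht' (fun i j x => (hggb i j).sup t' ht' x) x i hh0.le hh1
    have a3 := hq.lipschitz hqb.cont hqb.sup ht ht' x
    have a4 : wt x ^ τ * |p t y - p t' y| ≤ 2 ^ τ * (C * |t - t'|) := by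
      have h1 : wt x ^ τ ≤ wt y ^ τ * 2 ^ τ := by
        refine (wt_rpow_le_mul hτ x y).trans ?_
        rw [hxy]
        gcongr
        · exact (wt_rpow_pos y τ).le
        · linarith
      calc _ ≤ (wt y ^ τ * 2 ^ τ) * |p t y - p t' y| := by gcongr
        _ = 2 ^ τ * (wt y ^ τ * |p t y - p t' y|) := by ring
        _ ≤ _ := mul_le_mul_of_nonneg_left (hq.lipschitz hqb.cont hqb.sup ht ht' y) (by positivity)
    have key : h * (wt x ^ τ * |g i t x - g i t' x|) ≤
        h * ((2 * (n * n * 2 ^ τ) + 2 * 2 ^ τ) * C * h) := by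
      have e : h * (g i t x - g i t' x) =
          -(p t y - p t x - h * g i t x) + (p t' y - p t' x - h * g i t' x)
          + (p t y - p t' y) - (p t x - p t' x) := by ring
      calc h * (wt x ^ τ * |g i t x - g i t' x|)
          = wt x ^ τ * |h * (g i t x - g i t' x)| := by rw [abs_mul, abs_of_pos hh0]; ring
        _ ≤ wt x ^ τ * (|p t y - p t x - h * g i t x| + |p t' y - p t' x - h * g i t' x|
            + |p t y - p t' y| + |p t x - p t' x|) := by
          rw [e]
          gcongr
          refine (abs_sub _ _).trans ?_
          gcongr
          refine (abs_add_le _ _).trans ?_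
          gcongr
          refine (abs_add_le _ _).trans ?_
          rw [abs_neg]
        _ = wt x ^ τ * |p t y - p t x - h * g i t x| + wt x ^ τ * |p t' y - p t' x - h * g i t' x|
            + wt x ^ τ * |p t y - p t' y| + wt x ^ τ * |p t x - p t' x| := by ring
        _ ≤ n * (n * (2 ^ τ * C)) * h ^ 2 + n * (n * (2 ^ τ * C)) * h ^ 2
            + 2 ^ τ * (C * |t - t'|) + C * |t - t'| := by gcongr
        _ ≤ n * (n * (2 ^ τ * C)) * h ^ 2 + n * (n * (2 ^ τ * C)) * h ^ 2
            + 2 ^ τ * (C * |t - t'|) + 2 ^ τ * (C * |t - t'|) := by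
          have := le_mul_of_one_le_left (by positivity : 0 ≤ C * |t - t'|) h2
          linarith
        _ = _ := by rw [← hsq]; ring
    refine (le_of_mul_le_mul_left key hh0).trans ?_
    have : h ≤ |t - t'| ^ (lam / 2) := by
      rw [hh, Real.sqrt_eq_rpow]
      exact Real.rpow_le_rpow_of_exponent_ge hpos hd (by linarith)
    gcongr
  · have hge : 1 ≤ |t - t'| ^ (lam / 2) := Real.one_le_rpow hd.le (half_pos hl).le
    calc _ ≤ wt x ^ τ * (|g i t x| + |g i t' x|) := by gcongr; exact abs_sub _ _
      _ = wt x ^ τ * |g i t x| + wt x ^ τ * |g i t' x| := by ring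
      _ ≤ C + C := add_le_add ((hgb i).sup t ht x) ((hgb i).sup t' ht' x)
      _ ≤ (2 * (n * n * 2 ^ τ) + 2 * 2 ^ τ) * C := by
        have : (0 : ℝ) ≤ 2 * (n * n * 2 ^ τ) := by positivity
        nlinarith
      _ ≤ _ := le_mul_of_one_le_right (by positivity) hge

theorem SpReg.holBd_of_hasDt (hT : 0 ≤ T) {lam : ℝ} (hl : 0 < lam) (hl1 : lam < 1) (M : ℕ) :
    ∀ σ : ℝ, 0 ≤ σ → ∃ K : ℝ, 0 ≤ K ∧ ∀ C : ℝ, 0 ≤ C → ∀ p q : ℝ → Spc n → ℝ,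
      HasDt T p q → SpReg T (SupBd T C) (M + 2) (σ + 2) p → SpReg T (SupBd T C) M (σ + 2) q →
      SpReg T (HolBd T lam (K * C)) (M + 1) σ p := by
  have base : ∀ σ : ℝ, 0 ≤ σ → ∃ K : ℝ, 0 ≤ K ∧ ∀ C : ℝ, 0 ≤ C → ∀ p q : ℝ → Spc n → ℝ,
      HasDt T p q → SpReg T (SupBd T C) 1 (σ + 2) p → SpReg T (SupBd T C) 0 (σ + 2) q →
      HolBd T lam (K * C) σ p := by
    intro σ hσ
    refine ⟨2 ^ (σ + 2) * ((n * 2 ^ (σ + 1) + 1) * (1 + T)), by positivity,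
      fun C hC p q hq hp hqb => ?_⟩
    obtain ⟨hp1, g, hg, hgb⟩ := hp
    have hCT : C ≤ (1 + T) * C := le_mul_of_one_le_left hC (by linarith)
    have := holBd_of_deriv hl hl1 hσ (C := (1 + T) * C) (by positivity) hg
      (hp1.mono hCT (by linarith)) (fun i => SupBd.mono (hgb i) hCT (by linarith))
      (hq.holder hl hl1 hC (SupBd.mono hqb le_rfl (by linarith)))
    exact this.mono (le_of_eq (by ring)) le_rfl
  induction M with
  | zero =>
    intro σ hσ
    obtain ⟨K₁, hK₁, H⟩ := base σ hσ
    set A : ℝ := 2 * (n * n * 2 ^ (σ + 1)) + 2 * 2 ^ (σ + 1) with hA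
    have hA1 : 1 ≤ A := by
      have : (1 : ℝ) ≤ 2 ^ (σ + 1) := Real.one_le_rpow (by norm_num) (by linarith)
      have : (0 : ℝ) ≤ 2 * (n * n * 2 ^ (σ + 1)) := by positivity
      linarith
    have hA0 : 0 ≤ A := by linarith
    set K₂ : ℝ := 2 ^ (σ + 1 + 2) * ((n * 2 ^ (σ + 1 + 1) + 1) * A) with hK₂
    have hK₂0 : 0 ≤ K₂ := by positivity
    refine ⟨K₁ + K₂, by positivity, fun C hC p q hq hp hqb => ?_⟩
    have hp1 := H C hC p q hq (hp.mono_order (by norm_num)) hqb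
    obtain ⟨hp0, g, hg, hgb⟩ := hp
    refine ⟨hp1.mono (by nlinarith) le_rfl, g, hg, fun i => ?_⟩
    choose hgs gg hgg hggb using hgb
    have hAC : C ≤ A * C := le_mul_of_one_le_left hC hA1
    have tm := hg.holder_time hgg hq hl hl1 (by linarith : 0 ≤ σ + 1) hC
      (SupBd.mono hqb le_rfl (by linarith)) (fun i => (hgs i).mono le_rfl (by linarith))
      (fun i j => SupBd.mono (hggb i j) le_rfl (by linarith)) i
    have := holBd_of_deriv hl hl1 (by linarith : 0 ≤ σ + 1) (C := A * C) (by positivity)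
      (hgg i) ((hgs i).mono hAC (by linarith))
      (fun j => SupBd.mono (hggb i j) hAC (by linarith)) tm
    refine HolBd.mono this ?_ le_rfl
    calc _ = K₂ * C := by rw [hK₂]; ring
      _ ≤ _ := by nlinarith
  | succ M ih =>
    intro σ hσ
    obtain ⟨K₁, hK₁, H⟩ := base σ hσ
    obtain ⟨K₂, hK₂, H'⟩ := ih (σ + 1) (by linarith)
    refine ⟨K₁ + K₂, by positivity, fun C hC p q hq hp hqb => ?_⟩
    have hp1 := H C hC p q hq (hp.mono_order (by omega)) (hqb.mono_order (by omega))
    obtain ⟨hp0, g, hg, hgb⟩ := hp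
    refine ⟨hp1.mono (by nlinarith) le_rfl, g, hg, fun i => ?_⟩
    obtain ⟨hq0, q', hq', hqb'⟩ := hqb
    have := H' C hC (g i) (q' i) (hq.grad hg hq' hq0.cont (fun j => (hqb' j).base.cont) i)
      (by rw [show σ + 1 + 2 = σ + 2 + 1 by ring]; exact hgb i)
      (by rw [show σ + 1 + 2 = σ + 2 + 1 by ring]; exact hqb' i)
    have := SpReg.imp (Q := HolBd T lam ((K₁ + K₂) * C)) (a := 0) (σ₀ := 0)
      (fun τ u _ h => by rw [add_zero]; exact h.mono (by nlinarith) le_rfl)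
      (by linarith : 0 ≤ σ + 1) this
    rwa [add_zero] at this

theorem SpReg.holBd_mono {lam C C' σ : ℝ} {N : ℕ} {u : ℝ → Spc n → ℝ} (hC : C ≤ C')
    (h : SpReg T (HolBd T lam C) N σ u) : SpReg T (HolBd T lam C') N σ u := by
  have := SpReg.imp (Q := HolBd T lam C') (a := 0) (σ₀ := σ)
      (fun τ u _ h => by rw [add_zero]; exact h.mono hC le_rfl) le_rfl h
  rwa [add_zero] at this

theorem ParReg.holBd_mono {lam C C' σ : ℝ} {s N : ℕ} {u : ℝ → Spc n → ℝ} (hC : C ≤ C')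
    (h : ParReg T (HolBd T lam C) s N σ u) : ParReg T (HolBd T lam C') s N σ u := by
  have := ParReg.imp (Q := HolBd T lam C') (a := 0) (σ₀ := σ)
      (fun τ u _ h => by rw [add_zero]; exact h.mono hC le_rfl) le_rfl h
  rwa [add_zero] at this

/-- One time derivative can be traded for a Hölder bound. -/
theorem ParReg.holBd_of_supBd (hT : 0 ≤ T) {lam : ℝ} (hl : 0 < lam) (hl1 : lam < 1) (s k : ℕ)
    {σ : ℝ} (hσ : 0 ≤ σ) : ∃ K : ℝ, 0 ≤ K ∧ ∀ C : ℝ, 0 ≤ C → ∀ f : ℝ → Spc n → ℝ,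
      ParReg T (SupBd T C) (s + 1) k (σ + 2) f →
      ParReg T (HolBd T lam (K * C)) s (k + 1) σ f := by
  induction s with
  | zero =>
    obtain ⟨K, hK, H⟩ := SpReg.holBd_of_hasDt (n := n) hT hl hl1 k σ hσ
    refine ⟨K, hK, fun C hC f hf => ?_⟩
    obtain ⟨h1, q, hq, h2⟩ := hf
    exact H C hC f q hq h1 h2
  | succ s ih =>
    obtain ⟨K, hK, H⟩ := SpReg.holBd_of_hasDt (n := n) hT hl hl1 (k + 2 * (s + 1)) σ hσ
    obtain ⟨K', hK', H'⟩ := ih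
    refine ⟨K + K', by positivity, fun C hC f hf => ?_⟩
    obtain ⟨h1, q, hq, h2⟩ := hf
    refine ⟨?_, q, hq, (H' C hC q h2).holBd_mono (by nlinarith)⟩
    have := (H C hC f q hq h1 h2.spReg).holBd_mono (C' := (K + K') * C) (by nlinarith)
    rwa [show k + 2 * (s + 1) + 1 = k + 1 + 2 * (s + 1) by ring] at this

end smoothToHolder

theorem integrable_gaussian {b : ℝ} (hb : 0 < b) :
    Integrable fun z : Spc n => Real.exp (-b * ‖z‖ ^ 2) := by
  have := (GaussianFourier.integrable_cexp_neg_mul_sq_norm_add (V := Spc n) (b := (b : ℂ))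
    (by simpa using hb) 0 0).norm
  refine this.congr (Eventually.of_forall fun z => ?_)
  simp only [Complex.norm_exp]
  congr 1
  simp [← Complex.ofReal_pow]

theorem exp_neg_sq_le_of_shift {z : Spc n} {r : ℝ} {h : Spc n} (hr : 1 / 2 ≤ r) (hh : ‖h‖ ≤ 1) :
    Real.exp (-(‖r • z + h‖ ^ 2) / 2) ≤ Real.exp (1 / 2) * Real.exp (-(‖z‖ ^ 2) / 16) := by
  rw [← Real.exp_add]
  refine Real.exp_le_exp.mpr ?_
  have h1 : 1 / 2 * ‖z‖ ≤ ‖r • z + h‖ + 1 := by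
    calc 1 / 2 * ‖z‖ ≤ r * ‖z‖ := by gcongr
      _ = ‖r • z‖ := by rw [norm_smul, Real.norm_of_nonneg (by linarith)]
      _ = ‖(r • z + h) - h‖ := by rw [add_sub_cancel_right]
      _ ≤ ‖r • z + h‖ + ‖h‖ := norm_sub_le _ _
      _ ≤ _ := by gcongr
  have h2 := mul_self_le_mul_self (by positivity) h1
  nlinarith [sq_nonneg (‖r • z + h‖ - 1)]

theorem one_add_mul_exp_le (a : ℝ) :
    (1 + a) * Real.exp (-(a ^ 2) / 16) ≤ Real.exp 8 * Real.exp (-(a ^ 2) / 32) := by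
  calc _ ≤ Real.exp a * Real.exp (-(a ^ 2) / 16) := by
        gcongr; linarith [Real.add_one_le_exp a]
    _ ≤ _ := by
      rw [← Real.exp_add, ← Real.exp_add]
      refine Real.exp_le_exp.mpr ?_
      nlinarith [sq_nonneg (a - 16)]

/-- Kernels dominated by a Gaussian, with Gaussian control of affine perturbations. -/
structure GaussBd (K : ℝ) (φ : Spc n → ℝ) : Prop where
  cont : Continuous φ
  bd : ∀ z, |φ z| ≤ K * Real.exp (-(‖z‖ ^ 2) / 32)
  diff : ∀ z h : Spc n, ∀ r : ℝ, 1 / 2 ≤ r → r ≤ 1 → ‖h‖ ≤ 1 →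
    |φ z - r ^ n * φ (r • z + h)| ≤ K * (1 - r + ‖h‖) * Real.exp (-(‖z‖ ^ 2) / 32)

theorem gaussBd_of_gradient {K : ℝ} (hK : 0 ≤ K) {φ : Spc n → ℝ} {φ' : Fin n → Spc n → ℝ}
    (hd : ∀ z, HasFDerivAt φ (gradForm fun i => φ' i z) z)
    (hb : ∀ z, |φ z| ≤ K * Real.exp (-(‖z‖ ^ 2) / 2))
    (hb' : ∀ i z, |φ' i z| ≤ K * Real.exp (-(‖z‖ ^ 2) / 2)) :
    ∃ K', 0 ≤ K' ∧ GaussBd K' φ := by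
  set A : ℝ := 2 * n * K * Real.exp (1 / 2) * Real.exp 8 with hA
  have hA0 : 0 ≤ A := by positivity
  refine ⟨K + A, by positivity, continuous_iff_continuousAt.mpr fun z => (hd z).continuousAt,
    fun z => ?_, fun z h r hr hr1 hh => ?_⟩
  · refine (hb z).trans ?_
    gcongr ?_ * Real.exp ?_
    · linarith
    · nlinarith [sq_nonneg ‖z‖]
  · have hpath : ∀ s : ℝ, HasDerivAt (fun s : ℝ => (1 + s * (r - 1)) • z + s • h)
        ((r - 1) • z + h) s := fun s => by
      have h1 : HasDerivAt (fun s : ℝ => 1 + s * (r - 1)) (1 * (r - 1)) s :=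
        ((hasDerivAt_id s).mul_const _).const_add _
      exact ((h1.smul_const z).add ((hasDerivAt_id s).smul_const h)).congr_deriv (by simp)
    have hpow : ∀ s : ℝ, HasDerivAt (fun s : ℝ => (1 + s * (r - 1)) ^ n)
        (n * (1 + s * (r - 1)) ^ (n - 1) * (r - 1)) s := fun s => by
      have h1 : HasDerivAt (fun s : ℝ => 1 + s * (r - 1)) (1 * (r - 1)) s :=
        ((hasDerivAt_id s).mul_const _).const_add _
      exact (h1.pow n).congr_deriv (by simp)
    have key := norm_image_sub_le_of_norm_deriv_le_segment_01'
      (f := fun s : ℝ => (1 + s * (r - 1)) ^ n * φ ((1 + s * (r - 1)) • z + s • h))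
      (C := A * (1 - r + ‖h‖) * Real.exp (-(‖z‖ ^ 2) / 32))
      (fun s _ => ((hpow s).mul ((hd _).comp_hasDerivAt s (hpath s))).hasDerivWithinAt) ?_
    · have key' : |φ z - r ^ n * φ (r • z + h)| ≤
          A * (1 - r + ‖h‖) * Real.exp (-(‖z‖ ^ 2) / 32) := by
        rw [abs_sub_comm]
        simpa using key
      refine key'.trans ?_
      have : 0 ≤ 1 - r + ‖h‖ := by linarith [norm_nonneg h]
      gcongr
      linarith
    · intro s hs
      set ρ := 1 + s * (r - 1) with hρ
      have hρ1 : 1 / 2 ≤ ρ := by nlinarith [hs.1, hs.2]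
      have hρ2 : ρ ≤ 1 := by nlinarith [hs.1, hs.2]
      have hsh : ‖s • h‖ ≤ 1 := by
        rw [norm_smul, Real.norm_of_nonneg hs.1]
        nlinarith [hs.1, hs.2, norm_nonneg h]
      set E := Real.exp (1 / 2) * Real.exp (-(‖z‖ ^ 2) / 16) with hE
      have hE0 : 0 ≤ E := by positivity
      have e1 := exp_neg_sq_le_of_shift (z := z) hρ1 hsh
      have b1 : |φ (ρ • z + s • h)| ≤ K * E := (hb _).trans (by gcongr)
      have b2 : ‖gradForm fun i => φ' i (ρ • z + s • h)‖ ≤ n * (K * E) :=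
        norm_gradForm_le _ fun i => (hb' i _).trans (by gcongr)
      have b3 : ‖(r - 1) • z + h‖ ≤ (1 - r + ‖h‖) * (1 + ‖z‖) := by
        refine (norm_add_le _ _).trans ?_
        rw [norm_smul, Real.norm_eq_abs, abs_sub_comm, abs_of_nonneg (by linarith : 0 ≤ 1 - r)]
        nlinarith [norm_nonneg h, norm_nonneg z, mul_nonneg (norm_nonneg h) (norm_nonneg z)]
      have p1 : ρ ^ (n - 1) ≤ 1 := pow_le_one₀ (by linarith) hρ2
      have p2 : ρ ^ n ≤ 1 := pow_le_one₀ (by linarith) hρ2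
      have p0 : 0 ≤ ρ ^ (n - 1) := by positivity
      have p3 : 0 ≤ ρ ^ n := by positivity
      have hr0 : 0 ≤ 1 - r := by linarith
      have hX : 0 ≤ 1 - r + ‖h‖ := by positivity
      rw [Real.norm_eq_abs]
      calc |n * ρ ^ (n - 1) * (r - 1) * φ (ρ • z + s • h) +
            ρ ^ n * (gradForm fun i => φ' i (ρ • z + s • h)) ((r - 1) • z + h)|
          ≤ n * ρ ^ (n - 1) * (1 - r) * |φ (ρ • z + s • h)| +
            ρ ^ n * (‖gradForm fun i => φ' i (ρ • z + s • h)‖ * ‖(r - 1) • z + h‖) := by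
            refine (abs_add_le _ _).trans ?_
            rw [abs_mul, abs_mul, abs_mul, abs_mul, abs_sub_comm r 1, abs_of_nonneg hr0,
              abs_of_nonneg p3, abs_of_nonneg p0, Nat.abs_cast]
            gcongr
            exact (gradForm fun i => φ' i (ρ • z + s • h)).le_opNorm _
        _ ≤ n * 1 * ((1 - r + ‖h‖) * (1 + ‖z‖)) * (K * E) +
            1 * (n * (K * E) * ((1 - r + ‖h‖) * (1 + ‖z‖))) := by
            gcongr
            nlinarith [norm_nonneg h, norm_nonneg z, mul_nonneg hX (norm_nonneg z)]
        _ = 2 * n * K * Real.exp (1 / 2) * (1 - r + ‖h‖) *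
            ((1 + ‖z‖) * Real.exp (-(‖z‖ ^ 2) / 16)) := by rw [hE]; ring
        _ ≤ 2 * n * K * Real.exp (1 / 2) * (1 - r + ‖h‖) *
            (Real.exp 8 * Real.exp (-(‖z‖ ^ 2) / 32)) :=
            mul_le_mul_of_nonneg_left (one_add_mul_exp_le ‖z‖) (by positivity)
        _ = _ := by rw [hA]; ring

/-- The normalized Gaussian. -/
def gam (z : Spc n) : ℝ := Real.pi ^ (-(n : ℝ) / 2) * Real.exp (-(‖z‖ ^ 2))

/-- The partial derivatives of the normalized Gaussian. -/
def gamD (i : Fin n) (z : Spc n) : ℝ := -2 * z i * gam z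

theorem hasFDerivAt_gam (z : Spc n) : HasFDerivAt gam (gradForm fun i => gamD i z) z := by
  have h1 := ((hasStrictFDerivAt_norm_sq z).hasFDerivAt.neg.exp).const_mul
    (Real.pi ^ (-(n : ℝ) / 2))
  refine h1.congr_fderiv ?_
  ext v
  simp only [gradForm_apply, gamD, gam, smul_apply, neg_apply, coe_innerSL_apply, smul_eq_mul,
    PiLp.inner_apply, Finset.mul_sum, nsmul_eq_mul, ← Finset.sum_neg_distrib]
  refine Finset.sum_congr rfl fun i _ => ?_
  simp
  ring

theorem hasFDerivAt_gamD (i : Fin n) (z : Spc n) : HasFDerivAt (gamD i)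
    (gradForm fun j => (if i = j then -2 * gam z else 0) + -2 * z i * gamD j z) z := by
  have h1 : HasFDerivAt (fun z : Spc n => -2 * z i)
      ((-2 : ℝ) • (EuclideanSpace.proj i : Spc n →L[ℝ] ℝ)) z :=
    (EuclideanSpace.proj i : Spc n →L[ℝ] ℝ).hasFDerivAt.const_mul (-2)
  refine (h1.mul (hasFDerivAt_gam z)).congr_fderiv ?_
  ext v
  simp [gradForm_apply, add_mul, Finset.sum_add_distrib, Finset.mul_sum, mul_assoc]
  ring

theorem mul_exp_neg_sq_le {a b : ℝ} (hb : 0 ≤ b) (ha : |a| ≤ b) :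
    |a| * Real.exp (-(b ^ 2)) ≤ Real.exp (-(b ^ 2) / 2) ∧
    |a| * |a| * Real.exp (-(b ^ 2)) ≤ 2 * Real.exp (-(b ^ 2) / 2) := by
  have e : Real.exp (-(b ^ 2)) = Real.exp (-(b ^ 2) / 2) * Real.exp (-(b ^ 2) / 2) := by
    rw [← Real.exp_add]; congr 1; ring
  have e1 : 1 = Real.exp (b ^ 2 / 2) * Real.exp (-(b ^ 2) / 2) := by
    rw [← Real.exp_add, ← Real.exp_zero]; congr 1; ring
  have h1 : b ^ 2 / 2 + 1 ≤ Real.exp (b ^ 2 / 2) := Real.add_one_le_exp _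
  have h2 : b ≤ Real.exp (b ^ 2 / 2) := by nlinarith [sq_nonneg (b - 1)]
  have hp := Real.exp_pos (-(b ^ 2) / 2)
  have h3 : |a| * Real.exp (-(b ^ 2) / 2) ≤ 1 := by
    rw [e1]; gcongr; exact ha.trans h2
  have h4 : |a| * |a| * Real.exp (-(b ^ 2) / 2) ≤ 2 := by
    calc |a| * |a| * Real.exp (-(b ^ 2) / 2) ≤ b * b * Real.exp (-(b ^ 2) / 2) := by gcongr
      _ ≤ (2 * Real.exp (b ^ 2 / 2)) * Real.exp (-(b ^ 2) / 2) :=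
        mul_le_mul_of_nonneg_right (by nlinarith) hp.le
      _ = 2 := by rw [mul_assoc, ← e1, mul_one]
  constructor
  · rw [e, ← mul_assoc]; nlinarith
  · rw [e, ← mul_assoc]; nlinarith

theorem abs_coord_le (z : Spc n) (i : Fin n) : |z i| ≤ ‖z‖ := PiLp.norm_apply_le z i

theorem gam_bounds : ∃ K : ℝ, 0 ≤ K ∧ (∀ z : Spc n, |gam z| ≤ K * Real.exp (-(‖z‖ ^ 2) / 2)) ∧
    (∀ i, ∀ z : Spc n, |gamD i z| ≤ K * Real.exp (-(‖z‖ ^ 2) / 2)) ∧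
    ∀ i j, ∀ z : Spc n, |(if i = j then -2 * gam z else 0) + -2 * z i * gamD j z| ≤
      K * Real.exp (-(‖z‖ ^ 2) / 2) := by
  set κ : ℝ := Real.pi ^ (-(n : ℝ) / 2) with hκ
  have hκ0 : 0 < κ := Real.rpow_pos_of_pos Real.pi_pos _
  have hg : ∀ z : Spc n, |gam z| = κ * Real.exp (-(‖z‖ ^ 2)) := fun z =>
    abs_of_nonneg (by unfold gam; positivity)
  have h0 : ∀ z : Spc n, Real.exp (-(‖z‖ ^ 2)) ≤ Real.exp (-(‖z‖ ^ 2) / 2) := fun z =>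
    Real.exp_le_exp.mpr (by nlinarith [sq_nonneg ‖z‖])
  refine ⟨10 * κ, by positivity, fun z => ?_, fun i z => ?_, fun i j z => ?_⟩
  · rw [hg]
    have := mul_le_mul_of_nonneg_left (h0 z) hκ0.le
    have := Real.exp_pos (-(‖z‖ ^ 2) / 2)
    nlinarith
  · rw [gamD, abs_mul, abs_mul, hg]
    have h1 := mul_le_mul_of_nonneg_left
      (mul_exp_neg_sq_le (norm_nonneg z) (abs_coord_le z i)).1 hκ0.le
    have := Real.exp_pos (-(‖z‖ ^ 2) / 2)
    norm_num
    nlinarith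
  · have hE := Real.exp_pos (-(‖z‖ ^ 2) / 2)
    have a1 : |if i = j then -2 * gam z else 0| ≤ 2 * (κ * Real.exp (-(‖z‖ ^ 2) / 2)) := by
      split_ifs
      · rw [abs_mul, hg]
        norm_num
        exact mul_le_mul_of_nonneg_left (h0 z) hκ0.le
      · simp; positivity
    have a2 : |-2 * z i * gamD j z| ≤ 8 * (κ * Real.exp (-(‖z‖ ^ 2) / 2)) := by
      rw [gamD, abs_mul, abs_mul, abs_mul, abs_mul, hg]
      have m : |‖z‖| ≤ ‖z‖ := by rw [abs_of_nonneg (norm_nonneg z)]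
      have h1 := (mul_exp_neg_sq_le (norm_nonneg z) m).2
      rw [abs_of_nonneg (norm_nonneg z)] at h1
      have h2 : |z i| * |z j| ≤ ‖z‖ * ‖z‖ := by
        gcongr <;> exact abs_coord_le z _
      have h3 := (mul_le_mul_of_nonneg_right h2 (Real.exp_pos (-(‖z‖ ^ 2))).le).trans h1
      have h4 := mul_le_mul_of_nonneg_left h3 hκ0.le
      norm_num
      nlinarith
    calc _ ≤ _ := abs_add_le _ _
      _ ≤ _ := add_le_add a1 a2
      _ = _ := by ring

theorem gaussBd_gam : ∃ K, 0 ≤ K ∧ GaussBd K (gam (n := n)) ∧ ∀ i, GaussBd K (gamD (n := n) i) := by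
  obtain ⟨K, hK, b0, b1, b2⟩ := gam_bounds (n := n)
  obtain ⟨K₀, hK₀, H₀⟩ := gaussBd_of_gradient hK hasFDerivAt_gam b0 b1
  choose K₁ hK₁ H₁ using fun i => gaussBd_of_gradient hK (hasFDerivAt_gamD i) (b1 i) (b2 i)
  have mono : ∀ {K K' : ℝ} {φ : Spc n → ℝ}, K ≤ K' → GaussBd K φ → GaussBd K' φ :=
    fun h H => ⟨H.cont, fun z => (H.bd z).trans (by gcongr), fun z v r h1 h2 h3 =>
      (H.diff z v r h1 h2 h3).trans (by
        have : 0 ≤ 1 - r + ‖v‖ := by linarith [norm_nonneg v]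
        gcongr)⟩
  have hs : 0 ≤ ∑ i, K₁ i := Finset.sum_nonneg fun i _ => hK₁ i
  refine ⟨K₀ + ∑ i, K₁ i, by positivity, mono (by linarith) H₀, fun i => mono ?_ (H₁ i)⟩
  have := Finset.single_le_sum (fun i _ => hK₁ i) (Finset.mem_univ i)
  linarith

theorem integral_gam : ∫ z : Spc n, gam z = 1 := by
  have h := GaussianFourier.integral_rexp_neg_mul_sq_norm (V := Spc n) one_pos
  simp only [neg_mul, one_mul, div_one, finrank_euclideanSpace, Fintype.card_fin] at h
  unfold gam
  rw [integral_const_mul, h, ← Real.rpow_add Real.pi_pos]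
  rw [show -(n : ℝ) / 2 + n / 2 = 0 by ring, Real.rpow_zero]

/-- Average of `g` against the kernel `φ` at scale `c`. -/
def avg (φ : Spc n → ℝ) (c : ℝ) (g : Spc n → ℝ) (x : Spc n) : ℝ :=
  ∫ z, φ z * g (x - c • z)

/-- The constant in the weighted bounds for `avg`. -/
def avgConst (n : ℕ) (σ c₁ : ℝ) : ℝ :=
  Real.exp (16 * σ ^ 2 * c₁ ^ 2) * ∫ z : Spc n, Real.exp (-(1 / 64) * ‖z‖ ^ 2)

theorem avgConst_nonneg (σ c₁ : ℝ) : 0 ≤ avgConst n σ c₁ :=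
  mul_nonneg (Real.exp_pos _).le (integral_nonneg fun _ => (Real.exp_pos _).le)

theorem avg_integrand_le {σ C c c₁ A : ℝ} (hσ : 0 ≤ σ) (hc : 0 ≤ c) (hc₁ : c ≤ c₁) (hC : 0 ≤ C)
    (hA : 0 ≤ A) {ψ g : Spc n → ℝ} (hψ : ∀ z, |ψ z| ≤ A * Real.exp (-(‖z‖ ^ 2) / 32))
    (hg : ∀ x, wt x ^ σ * |g x| ≤ C) (x z : Spc n) :
    wt x ^ σ * |ψ z * g (x - c • z)| ≤
      A * C * (Real.exp (16 * σ ^ 2 * c₁ ^ 2) * Real.exp (-(1 / 64) * ‖z‖ ^ 2)) := by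
  have h1 : wt x ^ σ ≤ wt (x - c • z) ^ σ * Real.exp (σ * c * ‖z‖) := by
    refine (wt_rpow_le_mul hσ x (x - c • z)).trans ?_
    have : ‖x - (x - c • z)‖ = c * ‖z‖ := by
      rw [sub_sub_cancel, norm_smul, Real.norm_of_nonneg hc]
    rw [this]
    gcongr
    · exact (wt_rpow_pos _ σ).le
    · calc (1 + c * ‖z‖) ^ σ ≤ Real.exp (c * ‖z‖) ^ σ := by
            gcongr; linarith [Real.add_one_le_exp (c * ‖z‖)]
        _ = Real.exp (σ * c * ‖z‖) := by rw [← Real.exp_mul]; congr 1; ring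
  rw [abs_mul]
  calc wt x ^ σ * (|ψ z| * |g (x - c • z)|)
      ≤ (wt (x - c • z) ^ σ * Real.exp (σ * c * ‖z‖)) *
        ((A * Real.exp (-(‖z‖ ^ 2) / 32)) * |g (x - c • z)|) := by
        gcongr
        · exact mul_nonneg (wt_rpow_pos _ σ).le (Real.exp_pos _).le
        · exact hψ z
    _ = A * (wt (x - c • z) ^ σ * |g (x - c • z)|) *
        (Real.exp (σ * c * ‖z‖) * Real.exp (-(‖z‖ ^ 2) / 32)) := by ring
    _ ≤ A * C * (Real.exp (16 * σ ^ 2 * c₁ ^ 2) * Real.exp (-(1 / 64) * ‖z‖ ^ 2)) := by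
        rw [← Real.exp_add, ← Real.exp_add]
        have : σ * c ≤ σ * c₁ := mul_le_mul_of_nonneg_left hc₁ hσ
        have h0 : 0 ≤ σ * c := by positivity
        refine mul_le_mul (mul_le_mul_of_nonneg_left (hg _) hA) (Real.exp_le_exp.mpr ?_)
          (Real.exp_pos _).le (by positivity)
        nlinarith [sq_nonneg (‖z‖ / 8 - 4 * (σ * c₁)), norm_nonneg z,
          mul_le_mul_of_nonneg_right this (norm_nonneg z)]

theorem integrable_avg_majorant (a : ℝ) :
    Integrable fun z : Spc n => a * Real.exp (-(1 / 64) * ‖z‖ ^ 2) :=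
  (integrable_gaussian (by norm_num : (0 : ℝ) < 1 / 64)).const_mul a

theorem weighted_integral_le {σ C c c₁ A : ℝ} (hσ : 0 ≤ σ) (hc : 0 ≤ c) (hc₁ : c ≤ c₁)
    (hC : 0 ≤ C) (hA : 0 ≤ A) {ψ g : Spc n → ℝ}
    (hψ : ∀ z, |ψ z| ≤ A * Real.exp (-(‖z‖ ^ 2) / 32))
    (hg : ∀ x, wt x ^ σ * |g x| ≤ C) (x : Spc n) :
    wt x ^ σ * |∫ z, ψ z * g (x - c • z)| ≤ A * C * avgConst n σ c₁ := by
  have hw := wt_rpow_pos x σ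
  have := norm_integral_le_of_norm_le (f := fun z => wt x ^ σ * (ψ z * g (x - c • z)))
    (integrable_avg_majorant (n := n) (A * C * Real.exp (16 * σ ^ 2 * c₁ ^ 2)))
    (Eventually.of_forall fun z => by
      rw [Real.norm_eq_abs, abs_mul, abs_of_pos hw]
      refine (avg_integrand_le hσ hc hc₁ hC hA hψ hg x z).trans (le_of_eq ?_)
      ring)
  rw [integral_const_mul, integral_const_mul, Real.norm_eq_abs, abs_mul, abs_of_pos hw] at this
  exact this.trans (le_of_eq (by rw [avgConst]; ring))

theorem integrable_avg {K C : ℝ} {φ g : Spc n → ℝ} (hφ : GaussBd K φ) (hK : 0 ≤ K)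
    (hgc : Continuous g) (hg : ∀ x, |g x| ≤ C) (c : ℝ) (x : Spc n) :
    Integrable fun z => φ z * g (x - c • z) := by
  refine (integrable_avg_majorant (n := n) (K * C)).mono'
    ((hφ.cont.mul (hgc.comp (by fun_prop))).aestronglyMeasurable) (Eventually.of_forall fun z => ?_)
  have hC : 0 ≤ C := (abs_nonneg _).trans (hg 0)
  rw [Real.norm_eq_abs, abs_mul]
  calc |φ z| * |g (x - c • z)| ≤ (K * Real.exp (-(‖z‖ ^ 2) / 32)) * C := by
        gcongr
        · exact hφ.bd z
        · exact hg _
    _ = K * C * Real.exp (-(‖z‖ ^ 2) / 32) := by ring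
    _ ≤ _ := by gcongr; nlinarith [sq_nonneg ‖z‖]

theorem abs_le_of_weighted {σ C : ℝ} (hσ : 0 ≤ σ) {g : Spc n → ℝ}
    (hg : ∀ x, wt x ^ σ * |g x| ≤ C) (x : Spc n) : |g x| ≤ C :=
  (le_mul_of_one_le_left (abs_nonneg _) (one_le_wt_rpow x hσ)).trans (hg x)

theorem avg_eq_rescaled (φ g : Spc n → ℝ) {c c' : ℝ} (hc : 0 < c) (hc' : 0 < c')
    (x x' : Spc n) : avg φ c' g x' =
      ∫ z, ((c / c') ^ n * φ ((c / c') • z + c'⁻¹ • (x' - x))) * g (x - c • z) := by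
  set r := c / c' with hr
  have hr0 : 0 < r := by positivity
  set F : Spc n → ℝ := fun z => φ z * g (x' - c' • z) with hF
  have h1 : ∫ z, F z = ∫ z, F (z + c'⁻¹ • (x' - x)) := (integral_add_right_eq_self F _).symm
  have h2 := Measure.integral_comp_smul_of_nonneg (volume : Measure (Spc n))
    (fun z => F (z + c'⁻¹ • (x' - x))) r (hR := hr0.le)
  rw [← h1, finrank_euclideanSpace, Fintype.card_fin] at h2
  have h3 : ∫ z, F z = r ^ n * ∫ z, F (r • z + c'⁻¹ • (x' - x)) := by
    rw [h2, smul_eq_mul, ← mul_assoc, mul_inv_cancel₀ (by positivity), one_mul]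
  rw [avg, h3, ← integral_const_mul]
  refine integral_congr_ae (Eventually.of_forall fun z => ?_)
  have : x' - c' • (r • z + c'⁻¹ • (x' - x)) = x - c • z := by
    rw [smul_add, smul_smul, smul_smul, mul_inv_cancel₀ hc'.ne', hr, mul_div_cancel₀ _ hc'.ne',
      one_smul]
    abel
  simp only [hF, this]
  ring

section estimates

variable {σ C K c₁ : ℝ} {φ g : Spc n → ℝ}

theorem avg_le (hφ : GaussBd K φ) (hK : 0 ≤ K) (hσ : 0 ≤ σ) (hC : 0 ≤ C)
    (hg : ∀ x, wt x ^ σ * |g x| ≤ C) {c : ℝ} (hc : 0 ≤ c) (hc₁ : c ≤ c₁) (x : Spc n) :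
    wt x ^ σ * |avg φ c g x| ≤ K * C * avgConst n σ c₁ :=
  weighted_integral_le hσ hc hc₁ hC hK hφ.bd hg x

theorem avg_sub_le (hφ : GaussBd K φ) (hK : 0 ≤ K) (hσ : 0 ≤ σ) (hC : 0 ≤ C) (hgc : Continuous g)
    (hg : ∀ x, wt x ^ σ * |g x| ≤ C) {c c' : ℝ} (hc : 0 < c) (hcc' : c ≤ c') (h2 : c' ≤ 2 * c)
    (hc₁ : c' ≤ c₁) {x x' : Spc n} (hx : ‖x' - x‖ ≤ c') :
    wt x ^ σ * |avg φ c g x - avg φ c' g x'| ≤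
      K * (1 - c / c' + ‖x' - x‖ / c') * C * avgConst n σ c₁ := by
  have hc' : 0 < c' := hc.trans_le hcc'
  have hr1 : 1 / 2 ≤ c / c' := by rw [div_le_div_iff₀ two_pos hc']; linarith
  have hr2 : c / c' ≤ 1 := (div_le_one hc').mpr hcc'
  have hh : ‖c'⁻¹ • (x' - x)‖ = ‖x' - x‖ / c' := by
    rw [norm_smul, norm_inv, Real.norm_of_nonneg hc'.le]; field_simp
  have hh1 : ‖c'⁻¹ • (x' - x)‖ ≤ 1 := by rw [hh]; exact (div_le_one hc').mpr hx
  have hb := abs_le_of_weighted hσ hg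
  have i1 := integrable_avg hφ hK hgc hb c x
  have i2 : Integrable fun z =>
      ((c / c') ^ n * φ ((c / c') • z + c'⁻¹ • (x' - x))) * g (x - c • z) := by
    have i3 := integrable_avg hφ hK hgc hb c' x'
    have i4 := (i3.comp_add_right (c'⁻¹ • (x' - x))).comp_smul
      (R := c / c') (by positivity : c / c' ≠ 0)
    refine (i4.const_mul ((c / c') ^ n)).congr (Eventually.of_forall fun z => ?_)
    have : x' - c' • ((c / c') • z + c'⁻¹ • (x' - x)) = x - c • z := by
      rw [smul_add, smul_smul, smul_smul, mul_inv_cancel₀ hc'.ne', mul_div_cancel₀ _ hc'.ne',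
        one_smul]
      abel
    simp only [this]
    ring
  rw [avg_eq_rescaled φ g hc hc' x x', avg, ← integral_sub i1 i2]
  simp only [← sub_mul]
  have hnn : 0 ≤ 1 - c / c' + ‖x' - x‖ / c' := by
    have : 0 ≤ ‖x' - x‖ / c' := by positivity
    linarith
  refine weighted_integral_le hσ hc.le (hcc'.trans hc₁) hC (by positivity) (fun z => ?_) hg x
  have := hφ.diff z (c'⁻¹ • (x' - x)) (c / c') hr1 hr2 hh1
  rwa [hh] at this

theorem avg_holder (hφ : GaussBd K φ) (hK : 0 ≤ K) (hσ : 0 ≤ σ) (hC : 0 ≤ C) (hgc : Continuous g)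
    (hg : ∀ x, wt x ^ σ * |g x| ≤ C) {c : ℝ} (hc : 0 < c) (hc₁ : c ≤ c₁) {a : ℝ} (ha : 0 < a)
    (ha1 : a ≤ 1) {x x' : Spc n} (hx : ‖x - x'‖ ≤ 1) :
    wt x ^ σ * |avg φ c g x - avg φ c g x'| ≤
      (1 + 2 ^ σ) * (K * C * avgConst n σ c₁) * (‖x - x'‖ / c) ^ a := by
  have hB := avgConst_nonneg (n := n) σ c₁
  have h2 : (0 : ℝ) ≤ 2 ^ σ := by positivity
  have hM : 0 ≤ K * C * avgConst n σ c₁ := by positivity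
  rcases le_or_gt ‖x - x'‖ c with h | h
  · have h' : ‖x' - x‖ ≤ c := by rwa [norm_sub_rev]
    have := avg_sub_le hφ hK hσ hC hgc hg hc le_rfl (by linarith) hc₁ h'
    rw [div_self hc.ne', sub_self, zero_add, norm_sub_rev] at this
    refine this.trans ?_
    have hd : ‖x - x'‖ / c ≤ (‖x - x'‖ / c) ^ a :=
      le_rpow_self_of_le_one (by positivity) ((div_le_one hc).mpr h) ha1 ha
    calc K * (‖x - x'‖ / c) * C * avgConst n σ c₁
        = (K * C * avgConst n σ c₁) * (‖x - x'‖ / c) := by ring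
      _ ≤ (K * C * avgConst n σ c₁) * (‖x - x'‖ / c) ^ a := by gcongr
      _ ≤ _ := by
        have h5 : 0 ≤ K * C * avgConst n σ c₁ * (‖x - x'‖ / c) ^ a := by positivity
        nlinarith
  · have hge : 1 ≤ (‖x - x'‖ / c) ^ a := Real.one_le_rpow ((one_le_div hc).mpr h.le) ha.le
    have hw : wt x ^ σ ≤ wt x' ^ σ * 2 ^ σ := by
      refine (wt_rpow_le_mul hσ x x').trans ?_
      gcongr
      · exact (wt_rpow_pos _ σ).le
      · linarith
    calc _ ≤ wt x ^ σ * (|avg φ c g x| + |avg φ c g x'|) := by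
          have := (wt_rpow_pos x σ).le
          gcongr; exact abs_sub _ _
      _ = wt x ^ σ * |avg φ c g x| + wt x ^ σ * |avg φ c g x'| := by ring
      _ ≤ wt x ^ σ * |avg φ c g x| + (wt x' ^ σ * 2 ^ σ) * |avg φ c g x'| := by gcongr
      _ = wt x ^ σ * |avg φ c g x| + 2 ^ σ * (wt x' ^ σ * |avg φ c g x'|) := by ring
      _ ≤ K * C * avgConst n σ c₁ + 2 ^ σ * (K * C * avgConst n σ c₁) :=
          add_le_add (avg_le hφ hK hσ hC hg hc.le hc₁ x)
            (mul_le_mul_of_nonneg_left (avg_le hφ hK hσ hC hg hc.le hc₁ x') h2)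
      _ = (1 + 2 ^ σ) * (K * C * avgConst n σ c₁) := by ring
      _ ≤ _ := le_mul_of_one_le_right (by positivity) hge

theorem avg_scale (hφ : GaussBd K φ) (hK : 0 ≤ K) (hσ : 0 ≤ σ) (hC : 0 ≤ C) (hgc : Continuous g)
    (hg : ∀ x, wt x ^ σ * |g x| ≤ C) {c c' : ℝ} (hc : 0 < c) (hcc' : c ≤ c')
    (hc₁ : c' ≤ c₁) (x : Spc n) :
    wt x ^ σ * |avg φ c g x - avg φ c' g x| ≤
      4 * (K * C * avgConst n σ c₁) * (1 - c / c') := by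
  have hB := avgConst_nonneg (n := n) σ c₁
  have hM : 0 ≤ K * C * avgConst n σ c₁ := by positivity
  have hc' : 0 < c' := hc.trans_le hcc'
  have hr2 : c / c' ≤ 1 := (div_le_one hc').mpr hcc'
  rcases le_or_gt c' (2 * c) with h | h
  · have := avg_sub_le hφ hK hσ hC hgc hg hc hcc' h hc₁ (x := x) (x' := x) (by simpa using hc'.le)
    rw [sub_self, norm_zero, zero_div, add_zero] at this
    refine this.trans ?_
    have : 0 ≤ K * C * avgConst n σ c₁ * (1 - c / c') := mul_nonneg hM (by linarith)
    linarith
  · have hr : c / c' ≤ 1 / 2 := by rw [div_le_div_iff₀ hc' two_pos]; linarith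
    calc _ ≤ wt x ^ σ * (|avg φ c g x| + |avg φ c' g x|) := by
          have := (wt_rpow_pos x σ).le
          gcongr; exact abs_sub _ _
      _ = wt x ^ σ * |avg φ c g x| + wt x ^ σ * |avg φ c' g x| := by ring
      _ ≤ K * C * avgConst n σ c₁ + K * C * avgConst n σ c₁ :=
          add_le_add (avg_le hφ hK hσ hC hg hc.le (hcc'.trans hc₁) x)
            (avg_le hφ hK hσ hC hg hc'.le hc₁ x)
      _ ≤ _ := by nlinarith

end estimates

theorem continuousOn_avg {T C K : ℝ} {φ : Spc n → ℝ} (hφ : GaussBd K φ) (hK : 0 ≤ K)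
    {g : ℝ → Spc n → ℝ} (hgc : ContT T g) (hg : ∀ t ∈ Set.Icc 0 T, ∀ x, |g t x| ≤ C) :
    ContinuousOn (fun p : ℝ × ℝ × Spc n => avg φ p.2.1 (g p.1) p.2.2)
      (Set.Icc 0 T ×ˢ Set.univ) := by
  unfold avg
  refine continuousOn_of_dominated (bound := fun z => K * C * Real.exp (-(1 / 64) * ‖z‖ ^ 2))
    (fun p hp => ?_) (fun p hp => Eventually.of_forall fun z => ?_)
    (integrable_avg_majorant _) (Eventually.of_forall fun z => ?_)
  · exact (hφ.cont.mul ((hgc.space hp.1).comp (by fun_prop))).aestronglyMeasurable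
  · have hC : 0 ≤ C := (abs_nonneg _).trans (hg _ hp.1 0)
    rw [Real.norm_eq_abs, abs_mul]
    calc _ ≤ (K * Real.exp (-(‖z‖ ^ 2) / 32)) * C := by
          gcongr
          · exact hφ.bd z
          · exact hg _ hp.1 _
      _ = K * C * Real.exp (-(‖z‖ ^ 2) / 32) := by ring
      _ ≤ _ := by gcongr; nlinarith [sq_nonneg ‖z‖]
  · refine continuousOn_const.mul ?_
    exact ContinuousOn.comp (g := fun p : ℝ × Spc n => g p.1 p.2) hgc
      (f := fun p : ℝ × ℝ × Spc n => (p.1, p.2.2 - p.2.1 • z)) (by fun_prop)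
      (fun p hp => ⟨hp.1, trivial⟩)

section deriv

variable {C K : ℝ} {φ g : Spc n → ℝ} {g' : Fin n → Spc n → ℝ}

theorem hasFDerivAt_avg (hφ : GaussBd K φ) (hK : 0 ≤ K) (hg : ∀ x, |g x| ≤ C)
    (hd : ∀ x, HasFDerivAt g (gradForm fun i => g' i x) x) (hgc' : ∀ i, Continuous (g' i))
    (hg' : ∀ i x, |g' i x| ≤ C) (c : ℝ) (x : Spc n) :
    HasFDerivAt (avg φ c g) (gradForm fun i => avg φ c (g' i) x) x := by
  have hgc : Continuous g := continuous_iff_continuousAt.mpr fun z => (hd z).continuousAt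
  refine hasFDerivAt_integral_gradForm (ν := volume) (F := fun x z => φ z * g (x - c • z))
    (G := fun i x z => φ z * g' i (x - c • z)) (s := Set.univ)
    (bound := fun z => K * C * Real.exp (-(1 / 64) * ‖z‖ ^ 2)) univ_mem
    (fun y => (integrable_avg hφ hK hgc hg c y).aestronglyMeasurable)
    (integrable_avg hφ hK hgc hg c x)
    (fun i => (integrable_avg hφ hK (hgc' i) (hg' i) c x).aestronglyMeasurable)
    (Eventually.of_forall fun z y _ i => ?_) (integrable_avg_majorant _)
    (Eventually.of_forall fun z y _ => ?_)
  · have hC : 0 ≤ C := (abs_nonneg _).trans (hg 0)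
    rw [abs_mul]
    calc _ ≤ (K * Real.exp (-(‖z‖ ^ 2) / 32)) * C := by
          gcongr
          · exact hφ.bd z
          · exact hg' _ _
      _ = K * C * Real.exp (-(‖z‖ ^ 2) / 32) := by ring
      _ ≤ _ := by gcongr; nlinarith [sq_nonneg ‖z‖]
  · have h1 : HasFDerivAt (fun y => g (y - c • z)) (gradForm fun i => g' i (y - c • z)) y :=
      ((hd (y - c • z)).comp y ((hasFDerivAt_id y).sub_const (c • z))).congr_fderiv (by ext v; simp)
    refine (h1.const_mul (φ z)).congr_fderiv ?_
    ext v
    simp [gradForm_apply, Finset.mul_sum, mul_assoc]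

theorem avg_gamD (hg : ∀ x, |g x| ≤ C)
    (hd : ∀ x, HasFDerivAt g (gradForm fun i => g' i x) x) (hgc' : ∀ i, Continuous (g' i))
    (hg' : ∀ i x, |g' i x| ≤ C) (c : ℝ) (x : Spc n) (i : Fin n) :
    avg (gamD i) c g x = c * avg gam c (g' i) x := by
  obtain ⟨K, hK, h0, h1⟩ := gaussBd_gam (n := n)
  have hgc : Continuous g := continuous_iff_continuousAt.mpr fun z => (hd z).continuousAt
  have hd2 : ∀ z, HasFDerivAt (fun z => g (x - c • z))
      ((-c) • gradForm fun i => g' i (x - c • z)) z := fun z => by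
    have e : HasFDerivAt (fun z : Spc n => x - c • z) (-(c • ContinuousLinearMap.id ℝ (Spc n))) z :=
      ((hasFDerivAt_id z).const_smul c).const_sub x
    refine ((hd (x - c • z)).comp z e).congr_fderiv ?_
    ext v; simp
  have f1 : ∀ z : Spc n, fderiv ℝ gam z (EuclideanSpace.single i 1) = gamD i z := fun z => by
    rw [(hasFDerivAt_gam z).fderiv, gradForm_single]
  have f2 : ∀ z : Spc n, fderiv ℝ (fun z => g (x - c • z)) z (EuclideanSpace.single i 1) =
      -c * g' i (x - c • z) := fun z => by
    rw [(hd2 z).fderiv, smul_apply, gradForm_single, smul_eq_mul]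
  have key := integral_mul_fderiv_eq_neg_fderiv_mul_of_integrable (μ := (volume : Measure (Spc n)))
    (f := gam) (g := fun z => g (x - c • z)) (v := EuclideanSpace.single i 1)
    (by simp only [f1]; exact integrable_avg (h1 i) hK hgc hg c x)
    (by
      simp only [f2]
      refine ((integrable_avg h0 hK (hgc' i) (hg' i) c x).const_mul (-c)).congr
        (Eventually.of_forall fun z => ?_)
      simp only []; ring)
    (integrable_avg h0 hK hgc hg c x)
    (fun z _ => (hasFDerivAt_gam z).differentiableAt) (fun z _ => (hd2 z).differentiableAt)
  simp only [f1, f2] at key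
  have e : ∫ z, gam z * (-c * g' i (x - c • z)) = -c * ∫ z, gam z * g' i (x - c • z) := by
    rw [← integral_const_mul]; congr 1; ext z; ring
  rw [e] at key
  unfold avg
  linarith

theorem hasDerivAt_avg_scale {g'' : Fin n → Fin n → Spc n → ℝ} (hg : ∀ x, |g x| ≤ C)
    (hd : ∀ x, HasFDerivAt g (gradForm fun i => g' i x) x) (hgc' : ∀ i, Continuous (g' i))
    (hg' : ∀ i x, |g' i x| ≤ C)
    (hd' : ∀ i x, HasFDerivAt (g' i) (gradForm fun j => g'' i j x) x)
    (hgc'' : ∀ i j, Continuous (g'' i j)) (hg'' : ∀ i j x, |g'' i j x| ≤ C) (c : ℝ) (x : Spc n) :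
    HasDerivAt (fun c => avg gam c g x) (c / 2 * ∑ i, avg gam c (g'' i i) x) c := by
  obtain ⟨K, hK, h0, h1⟩ := gaussBd_gam (n := n)
  have hgc : Continuous g := continuous_iff_continuousAt.mpr fun z => (hd z).continuousAt
  have hC : 0 ≤ C := (abs_nonneg _).trans (hg 0)
  have key := (hasDerivAt_integral_of_dominated_loc_of_deriv_le (μ := (volume : Measure (Spc n)))
    (F := fun c z => gam z * g (x - c • z)) (x₀ := c) (s := Set.univ)
    (F' := fun c z => ∑ i, 1 / 2 * (gamD i z * g' i (x - c • z)))
    (bound := fun z => ∑ _i : Fin n, 1 / 2 * (K * C * Real.exp (-(1 / 64) * ‖z‖ ^ 2))) univ_mem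
    (Eventually.of_forall fun c => (integrable_avg h0 hK hgc hg c x).aestronglyMeasurable)
    (integrable_avg h0 hK hgc hg c x)
    (Finset.aestronglyMeasurable_fun_sum _ fun i _ =>
      ((integrable_avg (h1 i) hK (hgc' i) (hg' i) c x).const_mul _).aestronglyMeasurable)
    (Eventually.of_forall fun z c _ => ?_)
    (integrable_finsetSum _ fun i _ => (integrable_avg_majorant _).const_mul _)
    (Eventually.of_forall fun z c _ => ?_)).2
  · refine key.congr_deriv ?_
    rw [integral_finsetSum _ fun i _ => (integrable_avg (h1 i) hK (hgc' i) (hg' i) c x).const_mul _,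
      Finset.mul_sum]
    refine Finset.sum_congr rfl fun i _ => ?_
    rw [integral_const_mul]
    have := avg_gamD (hg' i) (hd' i) (hgc'' i) (hg'' i) c x i
    rw [avg] at this
    rw [this]
    ring
  · refine (norm_sum_le _ _).trans (Finset.sum_le_sum fun i _ => ?_)
    rw [Real.norm_eq_abs, abs_mul, abs_mul, abs_of_pos (by norm_num : (0 : ℝ) < 1 / 2)]
    refine mul_le_mul_of_nonneg_left ?_ (by norm_num)
    calc |gamD i z| * |g' i (x - c • z)| ≤ (K * Real.exp (-(‖z‖ ^ 2) / 32)) * C :=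
          mul_le_mul ((h1 i).bd z) (hg' _ _) (abs_nonneg _) (by positivity)
      _ = K * C * Real.exp (-(‖z‖ ^ 2) / 32) := by ring
      _ ≤ _ := by gcongr; nlinarith [sq_nonneg ‖z‖]
  · have e : HasDerivAt (fun c : ℝ => x - c • z) (-z) c := by
      simpa using ((hasDerivAt_id c).smul_const z).const_sub x
    refine (((hd (x - c • z)).comp_hasDerivAt c e).const_mul (gam z)).congr_deriv ?_
    simp only [gradForm_apply, gamD, PiLp.neg_apply, Finset.mul_sum]
    exact Finset.sum_congr rfl fun i _ => by ring

theorem avg_zero (g : Spc n → ℝ) (x : Spc n) : avg gam 0 g x = g x := by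
  simp [avg, integral_mul_const, integral_gam]

end deriv

/-- An integral with an algebraic singularity at the right end point. -/
theorem singular_integral_le {a b e D : ℝ} (hab : a ≤ b) (he : e < 1) {f : ℝ → ℝ}
    (hf : ContinuousOn f (Set.Ioo a b)) (hb : ∀ τ ∈ Set.Ioo a b, |f τ| ≤ D * (b - τ) ^ (-e)) :
    IntervalIntegrable f volume a b ∧ |∫ τ in a..b, f τ| ≤ D * ((b - a) ^ (1 - e) / (1 - e)) := by
  have i0 : IntervalIntegrable (fun τ => (b - τ) ^ (-e)) volume a b := by
    have := (intervalIntegral.intervalIntegrable_rpow' (a := 0) (b := b - a)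
      (r := -e) (by linarith)).comp_sub_left b
    simpa using this.symm
  have i1 := i0.const_mul D
  have i2 : IntervalIntegrable f volume a b := by
    rw [intervalIntegrable_iff_integrableOn_Ioo_of_le hab] at i1 ⊢
    exact Integrable.mono' i1 (hf.aestronglyMeasurable measurableSet_Ioo)
      (ae_restrict_of_forall_mem measurableSet_Ioo hb)
  refine ⟨i2, ?_⟩
  have h := intervalIntegral.norm_integral_le_of_norm_le (f := f)
    (g := fun τ => D * (b - τ) ^ (-e)) (μ := volume) hab ?_ i1
  · refine h.trans (le_of_eq ?_)
    rw [intervalIntegral.integral_const_mul,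
      intervalIntegral.integral_comp_sub_left (fun τ => τ ^ (-e)), sub_self,
      integral_rpow (Or.inl (by linarith)), Real.zero_rpow (by linarith), sub_zero,
      show -e + 1 = 1 - e by ring]
  · have : ∀ᵐ τ ∂(volume : Measure ℝ), τ ≠ b := by
      simp [ae_iff]
    filter_upwards [this] with τ hτ hτ2
    exact hb τ ⟨hτ2.1, lt_of_le_of_ne hτ2.2 hτ⟩

/-- The length scale `√(4 μ r)` of the heat kernel at time `r`. -/
def heatScale (μ r : ℝ) : ℝ := Real.sqrt (4 * μ) * Real.sqrt r

theorem continuous_heatScale (μ : ℝ) : Continuous (heatScale μ) :=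
  continuous_const.mul Real.continuous_sqrt

theorem heatScale_nonneg (μ r : ℝ) : 0 ≤ heatScale μ r :=
  mul_nonneg (Real.sqrt_nonneg _) (Real.sqrt_nonneg _)

theorem heatScale_pos {μ r : ℝ} (hμ : 0 < μ) (hr : 0 < r) : 0 < heatScale μ r :=
  mul_pos (Real.sqrt_pos.mpr (by linarith)) (Real.sqrt_pos.mpr hr)

theorem heatScale_mono (μ : ℝ) {r r' : ℝ} (h : r ≤ r') : heatScale μ r ≤ heatScale μ r' :=
  mul_le_mul_of_nonneg_left (Real.sqrt_le_sqrt h) (Real.sqrt_nonneg _)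

theorem heatScale_div {μ r r' : ℝ} (hμ : 0 < μ) :
    heatScale μ r / heatScale μ r' = Real.sqrt r / Real.sqrt r' :=
  mul_div_mul_left _ _ (Real.sqrt_pos.mpr (by linarith)).ne'

theorem sing_mul {r d lam : ℝ} (hr : 0 < r) (hd : 0 ≤ d) :
    1 / Real.sqrt r * (d / Real.sqrt r) ^ lam = d ^ lam * r ^ (-((1 + lam) / 2)) := by
  have hs := Real.sqrt_nonneg r
  rw [Real.div_rpow hd hs, one_div (Real.sqrt r), Real.sqrt_eq_rpow, ← Real.rpow_mul hr.le,
    ← Real.rpow_neg hr.le, div_eq_mul_inv (d ^ lam), ← Real.rpow_neg hr.le, mul_left_comm,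
    ← Real.rpow_add hr]
  congr 2; ring

theorem one_sub_sqrt_div_le {r r' lam : ℝ} (hr : 0 < r) (hrr : r ≤ r') (hl : 0 < lam)
    (hl1 : lam ≤ 1) :
    1 - Real.sqrt r / Real.sqrt r' ≤ (Real.sqrt (r' - r) / Real.sqrt r) ^ lam := by
  have h0 := Real.sqrt_pos.mpr hr
  have h0' := Real.sqrt_pos.mpr (hr.trans_le hrr)
  have hy : 0 ≤ Real.sqrt (r' - r) / Real.sqrt r := by positivity
  rcases le_or_gt 1 (Real.sqrt (r' - r) / Real.sqrt r) with h | h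
  · have h1 := Real.one_le_rpow h hl.le
    have : 0 ≤ Real.sqrt r / Real.sqrt r' := by positivity
    linarith
  · refine le_trans ?_ (le_rpow_self_of_le_one hy h.le hl1 hl)
    have h1 : Real.sqrt r' ≤ Real.sqrt r + Real.sqrt (r' - r) := by
      rw [Real.sqrt_le_left (by positivity)]
      nlinarith [Real.sq_sqrt hr.le, Real.sq_sqrt (sub_nonneg.mpr hrr),
        Real.sqrt_nonneg r, Real.sqrt_nonneg (r' - r),
        mul_nonneg (Real.sqrt_nonneg r) (Real.sqrt_nonneg (r' - r))]
    calc 1 - Real.sqrt r / Real.sqrt r' = (Real.sqrt r' - Real.sqrt r) / Real.sqrt r' := by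
          field_simp
      _ ≤ Real.sqrt (r' - r) / Real.sqrt r' := by gcongr; linarith
      _ ≤ Real.sqrt (r' - r) / Real.sqrt r := by
          gcongr

/-- Weights in time with at most an inverse square root singularity at `0`. -/
structure SingWt (T A : ℝ) (ρ : ℝ → ℝ) : Prop where
  cont : ContinuousOn ρ (Set.Ioi 0)
  bd : ∀ r, 0 < r → r ≤ T → |ρ r| ≤ A * (1 / Real.sqrt r)
  diff : ∀ r r', 0 < r → r ≤ r' → r' ≤ T →
    |ρ r - ρ r'| ≤ A * (1 / Real.sqrt r) * (1 - Real.sqrt r / Real.sqrt r')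

theorem singWt_one (T : ℝ) : SingWt T (Real.sqrt T) fun _ => 1 where
  cont := continuousOn_const
  bd r hr hrT := by
    rw [abs_one, mul_one_div, one_le_div (Real.sqrt_pos.mpr hr)]
    exact Real.sqrt_le_sqrt hrT
  diff r r' hr hrr _ := by
    rw [sub_self, abs_zero]
    refine mul_nonneg (by positivity) (sub_nonneg.mpr ?_)
    exact (div_le_one (Real.sqrt_pos.mpr (hr.trans_le hrr))).mpr (Real.sqrt_le_sqrt hrr)

theorem singWt_inv {μ : ℝ} (hμ : 0 < μ) (T : ℝ) :
    SingWt T (1 / Real.sqrt (4 * μ)) fun r => 1 / heatScale μ r where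
  cont := continuousOn_const.div (continuous_heatScale μ).continuousOn fun r hr =>
    (heatScale_pos hμ hr).ne'
  bd r hr _ := by
    rw [abs_of_nonneg (one_div_nonneg.mpr (heatScale_nonneg μ r)), heatScale, one_div_mul_one_div]
  diff r r' hr hrr _ := by
    have hm := Real.sqrt_pos.mpr (by linarith : (0 : ℝ) < 4 * μ)
    have h0 := Real.sqrt_pos.mpr hr
    have h0' := Real.sqrt_pos.mpr (hr.trans_le hrr)
    have : 1 / heatScale μ r - 1 / heatScale μ r' =
        1 / Real.sqrt (4 * μ) * (1 / Real.sqrt r) * (1 - Real.sqrt r / Real.sqrt r') := by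
      rw [heatScale, heatScale]; field_simp
    rw [this, abs_of_nonneg]
    refine mul_nonneg (by positivity) (sub_nonneg.mpr ?_)
    exact (div_le_one h0').mpr (Real.sqrt_le_sqrt hrr)

/-- The potential with kernel profile `φ` and weight `ρ`. -/
def profPot (μ : ℝ) (φ : Spc n → ℝ) (ρ : ℝ → ℝ) (g : ℝ → Spc n → ℝ) (t : ℝ) (x : Spc n) : ℝ :=
  ∫ τ in (0 : ℝ)..t, ρ (t - τ) * avg φ (heatScale μ (t - τ)) (g τ) x

section profPot

variable {T μ A K C σ : ℝ} {φ : Spc n → ℝ} {ρ : ℝ → ℝ} {g : ℝ → Spc n → ℝ}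

theorem continuousOn_profPot_integrand (hρ : SingWt T A ρ) (hφ : GaussBd K φ) (hK : 0 ≤ K)
    (hσ : 0 ≤ σ) (hg : SupBd T C σ g) {t s : ℝ} (hs : s ≤ t) (ht : t ≤ T) (x : Spc n) :
    ContinuousOn (fun τ => ρ (t - τ) * avg φ (heatScale μ (t - τ)) (g τ) x) (Set.Ioo 0 s) := by
  have h1 : ContinuousOn (fun τ => ρ (t - τ)) (Set.Ioo 0 s) :=
    hρ.cont.comp (by fun_prop) fun τ hτ => by
      have := hτ.2
      simp only [Set.mem_Ioi]; linarith
  refine h1.mul ?_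
  have := continuousOn_avg hφ hK hg.cont fun t ht x => abs_le_of_weighted hσ (hg.sup t ht) x
  refine ContinuousOn.comp (g := fun p : ℝ × ℝ × Spc n => avg φ p.2.1 (g p.1) p.2.2) this
    (f := fun τ => (τ, heatScale μ (t - τ), x)) ?_ fun τ hτ => ⟨⟨hτ.1.le, ?_⟩, trivial⟩
  · have := continuous_heatScale μ
    fun_prop
  · linarith [hτ.2]

theorem profPot_integrand_le (hρ : SingWt T A ρ) (hA : 0 ≤ A) (hφ : GaussBd K φ) (hK : 0 ≤ K)
    (hσ : 0 ≤ σ) (hC : 0 ≤ C) (hg : SupBd T C σ g) {t τ : ℝ} (hτ : 0 ≤ τ) (hτt : τ < t)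
    (ht : t ≤ T) (x : Spc n) :
    |wt x ^ σ * (ρ (t - τ) * avg φ (heatScale μ (t - τ)) (g τ) x)| ≤
      A * (K * C * avgConst n σ (heatScale μ T)) * (t - τ) ^ (-(1 / 2 : ℝ)) := by
  have hr : 0 < t - τ := by linarith
  have h1 := avg_le hφ hK hσ hC (hg.sup τ ⟨hτ, by linarith⟩) (heatScale_nonneg μ (t - τ))
    (heatScale_mono μ (by linarith : t - τ ≤ T)) x
  have h2 := hρ.bd _ hr (by linarith)
  have hw := (wt_rpow_pos x σ).le
  have h3 : 1 / Real.sqrt (t - τ) = (t - τ) ^ (-(1 / 2 : ℝ)) := by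
    rw [Real.sqrt_eq_rpow, Real.rpow_neg hr.le, one_div]
  calc _ = |ρ (t - τ)| * (wt x ^ σ * |avg φ (heatScale μ (t - τ)) (g τ) x|) := by
        rw [abs_mul, abs_mul, abs_of_nonneg hw]; ring
    _ ≤ (A * (1 / Real.sqrt (t - τ))) * (K * C * avgConst n σ (heatScale μ T)) :=
        mul_le_mul h2 h1 (by positivity) (by positivity)
    _ = _ := by rw [h3]; ring

theorem profPot_intervalIntegrable (hρ : SingWt T A ρ) (hA : 0 ≤ A) (hφ : GaussBd K φ)
    (hK : 0 ≤ K) (hσ : 0 ≤ σ) (hC : 0 ≤ C) (hg : SupBd T C σ g) {t : ℝ} (ht : t ∈ Set.Icc 0 T)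
    (x : Spc n) :
    IntervalIntegrable (fun τ => ρ (t - τ) * avg φ (heatScale μ (t - τ)) (g τ) x) volume 0 t := by
  have h0 : SupBd T C 0 g := hg.mono le_rfl hσ
  refine (singular_integral_le (e := 1 / 2) (D := A * (K * C * avgConst n 0 (heatScale μ T))) ht.1
    (by norm_num) (continuousOn_profPot_integrand hρ hφ hK hσ hg le_rfl ht.2 x) fun τ hτ => ?_).1
  have := profPot_integrand_le (μ := μ) hρ hA hφ hK le_rfl hC h0 hτ.1.le hτ.2 ht.2 x
  simpa using this

theorem profPot_sup (hρ : SingWt T A ρ) (hA : 0 ≤ A) (hφ : GaussBd K φ) (hK : 0 ≤ K)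
    (hσ : 0 ≤ σ) (hC : 0 ≤ C) (hg : SupBd T C σ g) {t : ℝ} (ht : t ∈ Set.Icc 0 T) (x : Spc n) :
    wt x ^ σ * |profPot μ φ ρ g t x| ≤
      A * (K * C * avgConst n σ (heatScale μ T)) * (T ^ (1 / 2 : ℝ) * 2) := by
  have hw := wt_rpow_pos x σ
  have hB := avgConst_nonneg (n := n) σ (heatScale μ T)
  have h := (singular_integral_le (e := 1 / 2)
    (f := fun τ => wt x ^ σ * (ρ (t - τ) * avg φ (heatScale μ (t - τ)) (g τ) x)) ht.1 (by norm_num)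
    (continuousOn_const.mul (continuousOn_profPot_integrand (μ := μ) hρ hφ hK hσ hg le_rfl ht.2 x))
    fun τ hτ => profPot_integrand_le (μ := μ) hρ hA hφ hK hσ hC hg hτ.1.le hτ.2 ht.2 x).2
  rw [intervalIntegral.integral_const_mul, abs_mul, abs_of_pos hw] at h
  refine h.trans ?_
  refine mul_le_mul_of_nonneg_left ?_ (by positivity)
  have := Real.rpow_le_rpow ht.1 ht.2 (by norm_num : (0 : ℝ) ≤ 1 / 2)
  norm_num at this ⊢
  linarith

theorem profPot_space (hμ : 0 < μ) (hρ : SingWt T A ρ) (hA : 0 ≤ A) (hφ : GaussBd K φ)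
    (hK : 0 ≤ K) (hσ : 0 ≤ σ) (hC : 0 ≤ C) (hg : SupBd T C σ g) {lam : ℝ} (hl : 0 < lam)
    (hl1 : lam < 1) {t : ℝ} (ht : t ∈ Set.Icc 0 T) {x y : Spc n} (hxy : ‖x - y‖ ≤ 1) :
    wt x ^ σ * |profPot μ φ ρ g t x - profPot μ φ ρ g t y| ≤
      A * ((1 + 2 ^ σ) * (K * C * avgConst n σ (heatScale μ T))) * (Real.sqrt (4 * μ))⁻¹ ^ lam *
        (T ^ ((1 - lam) / 2) / ((1 - lam) / 2)) * ‖x - y‖ ^ lam := by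
  have hw := wt_rpow_pos x σ
  have hB := avgConst_nonneg (n := n) σ (heatScale μ T)
  have h := (singular_integral_le (e := (1 + lam) / 2)
    (D := A * ((1 + 2 ^ σ) * (K * C * avgConst n σ (heatScale μ T))) *
      (Real.sqrt (4 * μ))⁻¹ ^ lam * ‖x - y‖ ^ lam) ht.1 (by linarith)
    (continuousOn_const.mul ((continuousOn_profPot_integrand (μ := μ) hρ hφ hK hσ hg le_rfl ht.2
      x).sub (continuousOn_profPot_integrand (μ := μ) hρ hφ hK hσ hg le_rfl ht.2 y)))
    (f := fun τ => wt x ^ σ * (ρ (t - τ) * avg φ (heatScale μ (t - τ)) (g τ) x -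
      ρ (t - τ) * avg φ (heatScale μ (t - τ)) (g τ) y)) fun τ hτ => ?_).2
  · rw [intervalIntegral.integral_const_mul, abs_mul, abs_of_pos hw,
      intervalIntegral.integral_sub (profPot_intervalIntegrable hρ hA hφ hK hσ hC hg ht x)
      (profPot_intervalIntegrable hρ hA hφ hK hσ hC hg ht y)] at h
    refine h.trans ?_
    rw [show 1 - (1 + lam) / 2 = (1 - lam) / 2 by ring, sub_zero]
    have h1 : t ^ ((1 - lam) / 2) / ((1 - lam) / 2) ≤ T ^ ((1 - lam) / 2) / ((1 - lam) / 2) :=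
      div_le_div_of_nonneg_right (Real.rpow_le_rpow ht.1 ht.2 (by linarith)) (by linarith)
    refine (mul_le_mul_of_nonneg_left h1 (by positivity)).trans (le_of_eq ?_)
    ring
  · have hr : 0 < t - τ := by linarith [hτ.2]
    have h1 := avg_holder hφ hK hσ hC (hg.cont.space ⟨hτ.1.le, by linarith [hτ.2, ht.2]⟩)
      (hg.sup τ ⟨hτ.1.le, by linarith [hτ.2, ht.2]⟩) (heatScale_pos hμ hr)
      (heatScale_mono μ (by linarith [hτ.1, ht.2] : t - τ ≤ T)) hl hl1.le hxy
    have h2 := hρ.bd _ hr (by linarith [hτ.1, ht.2])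
    have h3 : (‖x - y‖ / heatScale μ (t - τ)) ^ lam =
        (Real.sqrt (4 * μ))⁻¹ ^ lam * (‖x - y‖ / Real.sqrt (t - τ)) ^ lam := by
      rw [← Real.mul_rpow (by positivity) (by positivity), heatScale]
      congr 1; field_simp
    calc _ = |ρ (t - τ)| * (wt x ^ σ * |avg φ (heatScale μ (t - τ)) (g τ) x -
            avg φ (heatScale μ (t - τ)) (g τ) y|) := by
          rw [← mul_sub, abs_mul, abs_mul, abs_of_pos hw]; ring
      _ ≤ (A * (1 / Real.sqrt (t - τ))) * ((1 + 2 ^ σ) * (K * C * avgConst n σ (heatScale μ T)) *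
            ((Real.sqrt (4 * μ))⁻¹ ^ lam * (‖x - y‖ / Real.sqrt (t - τ)) ^ lam)) := by
          rw [← h3]
          exact mul_le_mul h2 h1 (by positivity) (by positivity)
      _ = A * ((1 + 2 ^ σ) * (K * C * avgConst n σ (heatScale μ T))) *
            (Real.sqrt (4 * μ))⁻¹ ^ lam * (1 / Real.sqrt (t - τ) *
              (‖x - y‖ / Real.sqrt (t - τ)) ^ lam) := by ring
      _ = _ := by rw [sing_mul hr (norm_nonneg _)]; ring

theorem profPot_time (hμ : 0 < μ) (hρ : SingWt T A ρ) (hA : 0 ≤ A) (hφ : GaussBd K φ)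
    (hK : 0 ≤ K) (hσ : 0 ≤ σ) (hC : 0 ≤ C) (hg : SupBd T C σ g) {lam : ℝ} (hl : 0 < lam)
    (hl1 : lam < 1) {t t' : ℝ} (ht : 0 ≤ t) (htt : t ≤ t') (ht' : t' ≤ T) (x : Spc n) :
    wt x ^ σ * |profPot μ φ ρ g t' x - profPot μ φ ρ g t x| ≤
      A * (K * C * avgConst n σ (heatScale μ T)) *
        (2 * (1 + T) + 5 * (T ^ ((1 - lam) / 2) / ((1 - lam) / 2))) * (t' - t) ^ (lam / 2) := by
  have hw := wt_rpow_pos x σ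
  have hB := avgConst_nonneg (n := n) σ (heatScale μ T)
  have hT : t ≤ T := htt.trans ht'
  set B := K * C * avgConst n σ (heatScale μ T) with hBd
  have hB0 : 0 ≤ B := by positivity
  set h : ℝ → ℝ → ℝ := fun t τ => ρ (t - τ) * avg φ (heatScale μ (t - τ)) (g τ) x with hh
  have it : IntervalIntegrable (h t) volume 0 t :=
    profPot_intervalIntegrable hρ hA hφ hK hσ hC hg ⟨ht, hT⟩ x
  have it' : IntervalIntegrable (h t') volume 0 t' :=
    profPot_intervalIntegrable hρ hA hφ hK hσ hC hg ⟨ht.trans htt, ht'⟩ x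
  have it1 : IntervalIntegrable (h t') volume 0 t := it'.mono_set (by
    rw [Set.uIcc_of_le ht, Set.uIcc_of_le (ht.trans htt)]
    exact Set.Icc_subset_Icc le_rfl htt)
  have it2 : IntervalIntegrable (h t') volume t t' := it'.mono_set (by
    rw [Set.uIcc_of_le htt, Set.uIcc_of_le (ht.trans htt)]
    exact Set.Icc_subset_Icc ht le_rfl)
  have e : profPot μ φ ρ g t' x - profPot μ φ ρ g t x =
      (∫ τ in t..t', h t' τ) + ∫ τ in (0 : ℝ)..t, (h t' τ - h t τ) := by
    rw [intervalIntegral.integral_sub it1 it, profPot, profPot,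
      ← intervalIntegral.integral_add_adjacent_intervals it1 it2]
    ring
  have b1 : wt x ^ σ * |∫ τ in t..t', h t' τ| ≤ A * B * (2 * (1 + T)) * (t' - t) ^ (lam / 2) := by
    have h := (singular_integral_le (e := 1 / 2) (f := fun τ => wt x ^ σ * h t' τ) htt (by norm_num)
      ((continuousOn_const.mul (continuousOn_profPot_integrand (μ := μ) hρ hφ hK hσ hg le_rfl ht'
        x)).mono (Set.Ioo_subset_Ioo ht le_rfl))
      fun τ hτ => profPot_integrand_le (μ := μ) hρ hA hφ hK hσ hC hg (ht.trans hτ.1.le) hτ.2 ht'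
        x).2
    rw [intervalIntegral.integral_const_mul, abs_mul, abs_of_pos hw] at h
    refine h.trans ?_
    have h1 := rpow_le_rpow_mul_one_add (T := T) (d := t' - t) (a := lam / 2) (b := 1 / 2)
      (by linarith) (by linarith) (by linarith) (by linarith) (by linarith)
    calc _ = A * B * 2 * (t' - t) ^ (1 / 2 : ℝ) := by norm_num; ring
      _ ≤ A * B * 2 * ((1 + T) * (t' - t) ^ (lam / 2)) := by gcongr
      _ = _ := by ring
  have b2 : wt x ^ σ * |∫ τ in (0 : ℝ)..t, (h t' τ - h t τ)| ≤
      A * B * (5 * (T ^ ((1 - lam) / 2) / ((1 - lam) / 2))) * (t' - t) ^ (lam / 2) := by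
    have h := (singular_integral_le (e := (1 + lam) / 2)
      (f := fun τ => wt x ^ σ * (h t' τ - h t τ)) (D := A * (5 * B) * (t' - t) ^ (lam / 2)) ht
      (by linarith)
      (continuousOn_const.mul ((continuousOn_profPot_integrand (μ := μ) hρ hφ hK hσ hg htt ht'
        x).sub (continuousOn_profPot_integrand (μ := μ) hρ hφ hK hσ hg le_rfl hT x)))
      fun τ hτ => ?_).2
    · rw [intervalIntegral.integral_const_mul, abs_mul, abs_of_pos hw] at h
      refine h.trans ?_
      rw [show 1 - (1 + lam) / 2 = (1 - lam) / 2 by ring, sub_zero]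
      have h1 : t ^ ((1 - lam) / 2) / ((1 - lam) / 2) ≤ T ^ ((1 - lam) / 2) / ((1 - lam) / 2) :=
        div_le_div_of_nonneg_right (Real.rpow_le_rpow ht hT (by linarith)) (by linarith)
      have h0 : 0 ≤ A * (5 * B) * (t' - t) ^ (lam / 2) :=
        mul_nonneg (by positivity) (Real.rpow_nonneg (by linarith) _)
      refine (mul_le_mul_of_nonneg_left h1 h0).trans (le_of_eq ?_)
      ring
    · have hr : 0 < t - τ := by linarith [hτ.2]
      have hrr : t - τ ≤ t' - τ := by linarith
      have hr' : 0 < t' - τ := by linarith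
      have hτT : τ ∈ Set.Icc 0 T := ⟨hτ.1.le, by linarith [hτ.2]⟩
      have hT' : t' - τ ≤ T := by linarith [hτ.1]
      have a1 := avg_le hφ hK hσ hC (hg.sup τ hτT) (heatScale_nonneg μ (t - τ))
        (heatScale_mono μ (hrr.trans hT')) x
      have a2 := avg_scale hφ hK hσ hC (hg.cont.space hτT) (hg.sup τ hτT) (heatScale_pos hμ hr)
        (heatScale_mono μ hrr) (heatScale_mono μ hT') x
      rw [heatScale_div hμ] at a2
      have r1 := hρ.diff _ _ hr hrr hT'
      have r2 := hρ.bd _ hr' hT'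
      have hs := Real.sqrt_pos.mpr hr
      have hss := Real.sqrt_le_sqrt hrr
      have r3 : |ρ (t' - τ)| ≤ A * (1 / Real.sqrt (t - τ)) := r2.trans (by gcongr)
      have hq := one_sub_sqrt_div_le hr hrr hl hl1.le
      have hq0 : 0 ≤ 1 - Real.sqrt (t - τ) / Real.sqrt (t' - τ) :=
        sub_nonneg.mpr ((div_le_one (Real.sqrt_pos.mpr hr')).mpr hss)
      set q := 1 - Real.sqrt (t - τ) / Real.sqrt (t' - τ)
      set v := avg φ (heatScale μ (t - τ)) (g τ) x
      set v' := avg φ (heatScale μ (t' - τ)) (g τ) x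
      calc |wt x ^ σ * (ρ (t' - τ) * v' - ρ (t - τ) * v)|
          = wt x ^ σ * |(ρ (t - τ) - ρ (t' - τ)) * v + ρ (t' - τ) * (v - v')| := by
            rw [abs_mul, abs_of_pos hw, ← abs_neg]; congr 2; ring
        _ ≤ wt x ^ σ * (|ρ (t - τ) - ρ (t' - τ)| * |v| + |ρ (t' - τ)| * |v - v'|) := by
            refine mul_le_mul_of_nonneg_left ((abs_add_le _ _).trans ?_) hw.le
            rw [abs_mul, abs_mul]
        _ = |ρ (t - τ) - ρ (t' - τ)| * (wt x ^ σ * |v|) +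
              |ρ (t' - τ)| * (wt x ^ σ * |v - v'|) := by ring
        _ ≤ A * (1 / Real.sqrt (t - τ)) * q * B + A * (1 / Real.sqrt (t - τ)) * (4 * B * q) := by
            refine add_le_add (mul_le_mul r1 a1 (by positivity) (by positivity))
              (mul_le_mul r3 a2 (by positivity) (by positivity))
        _ = A * (5 * B) * (1 / Real.sqrt (t - τ) * q) := by ring
        _ ≤ A * (5 * B) * (1 / Real.sqrt (t - τ) *
              (Real.sqrt (t' - τ - (t - τ)) / Real.sqrt (t - τ)) ^ lam) := by gcongr
        _ = _ := by
            rw [sing_mul hr (Real.sqrt_nonneg _), show t' - τ - (t - τ) = t' - t by ring,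
              Real.sqrt_eq_rpow, ← Real.rpow_mul (by linarith)]
            ring_nf
  calc _ ≤ wt x ^ σ * (|∫ τ in t..t', h t' τ| + |∫ τ in (0 : ℝ)..t, (h t' τ - h t τ)|) := by
        rw [e]; exact mul_le_mul_of_nonneg_left (abs_add_le _ _) hw.le
    _ ≤ _ := by rw [mul_add]; refine (add_le_add b1 b2).trans (le_of_eq ?_); ring

end profPot

/-- The potentials `profPot` gain Hölder regularity at the cost of one power of the weight. -/
theorem holBd_profPot {T μ A K lam σ : ℝ} (hT : 0 ≤ T) (hμ : 0 < μ) {φ : Spc n → ℝ} {ρ : ℝ → ℝ}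
    (hρ : SingWt T A ρ) (hA : 0 ≤ A) (hφ : GaussBd K φ) (hK : 0 ≤ K) (hl : 0 < lam)
    (hl1 : lam < 1) (hσ : 0 ≤ σ) :
    ∃ K' : ℝ, 0 ≤ K' ∧ ∀ C : ℝ, 0 ≤ C → ∀ g : ℝ → Spc n → ℝ, SupBd T C (σ + 1) g →
      HolBd T lam (K' * C) σ (profPot μ φ ρ g) := by
  have hB := avgConst_nonneg (n := n) (σ + 1) (heatScale μ T)
  have hq : 0 < (1 - lam) / 2 := by linarith
  set a := avgConst n (σ + 1) (heatScale μ T)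
  set c1 := A * (K * a) * (T ^ (1 / 2 : ℝ) * 2)
  set c2 := A * ((1 + 2 ^ (σ + 1)) * (K * a)) * (Real.sqrt (4 * μ))⁻¹ ^ lam *
    (T ^ ((1 - lam) / 2) / ((1 - lam) / 2))
  set c3 := A * (K * a) * (2 * (1 + T) + 5 * (T ^ ((1 - lam) / 2) / ((1 - lam) / 2)))
  have p1 : 0 ≤ c1 := by positivity
  have p2 : 0 ≤ c2 := by positivity
  have p3 : 0 ≤ c3 := by positivity
  refine ⟨2 ^ (σ + 2) * (c1 + c2 + c3), by positivity, fun C hC g hg => ?_⟩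
  have hσ1 : 0 ≤ σ + 1 := by linarith
  have key := holBd_of_local (T := T) (u := profPot μ φ ρ g) (C := (c1 + c2 + c3) * C) hl hl1 hσ
    (by positivity) (fun t ht x => ?_) (fun t ht x y hxy => ?_) (fun t ht t' ht' x => ?_)
  · rwa [← mul_assoc] at key
  · refine (profPot_sup hρ hA hφ hK hσ1 hC hg ht x).trans ?_
    have : 0 ≤ (c2 + c3) * C := by positivity
    calc _ = c1 * C := by ring
      _ ≤ _ := by linarith
  · refine (profPot_space hμ hρ hA hφ hK hσ1 hC hg hl hl1 ht hxy).trans ?_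
    calc _ = c2 * C * ‖x - y‖ ^ lam := by ring
      _ ≤ _ := by gcongr; linarith
  · have hw := wt_rpow_mono x (by linarith : σ ≤ σ + 1)
    have main : ∀ t ∈ Set.Icc 0 T, ∀ t' ∈ Set.Icc 0 T, t ≤ t' →
        wt x ^ σ * |profPot μ φ ρ g t' x - profPot μ φ ρ g t x| ≤
          (c1 + c2 + c3) * C * |t' - t| ^ (lam / 2) := by
      intro t ht t' ht' htt
      refine (mul_le_mul_of_nonneg_right hw (abs_nonneg _)).trans ?_
      refine (profPot_time hμ hρ hA hφ hK hσ1 hC hg hl hl1 ht.1 htt ht'.2 x).trans ?_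
      rw [abs_of_nonneg (by linarith)]
      calc _ = c3 * C * (t' - t) ^ (lam / 2) := by ring
        _ ≤ _ := by
          have : 0 ≤ (t' - t) ^ (lam / 2) := Real.rpow_nonneg (by linarith) _
          gcongr; linarith
    rcases le_total t t' with h | h
    · rw [abs_sub_comm, abs_sub_comm t t']; exact main t ht t' ht' h
    · exact main t' ht' t ht h

section sums

variable {T lam : ℝ}

theorem HolBd.add {F : Type*} [NormedAddCommGroup F] {C C' σ : ℝ} {u v : ℝ → Spc n → F}
    (h : HolBd T lam C σ u)
    (h' : HolBd T lam C' σ v) : HolBd T lam (C + C') σ (u + v) := by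
  have key : ∀ (w d : ℝ) (a b c e : F), 0 ≤ w → 0 ≤ d → w * ‖a - b‖ / d ≤ C → w * ‖c - e‖ / d ≤ C' →
      w * ‖a + c - (b + e)‖ / d ≤ C + C' := by
    intro w d a b c e hw hd h1 h2
    calc w * ‖a + c - (b + e)‖ / d ≤ w * (‖a - b‖ + ‖c - e‖) / d := by
          rw [add_sub_add_comm]; gcongr; exact norm_add_le _ _
      _ = w * ‖a - b‖ / d + w * ‖c - e‖ / d := by ring
      _ ≤ _ := add_le_add h1 h2
  have hs := h.supBd.add h'.supBd
  refine ⟨hs.cont, hs.sup, fun t ht x y hxy h2 => ?_, fun t ht x y hx hy hxy => ?_,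
    fun t ht t' ht' hne x => ?_⟩
  · exact key _ _ _ _ _ _ (Real.rpow_nonneg (by linarith [one_le_wt2 x y]) _) (by positivity)
      (h.near t ht x y hxy h2) (h'.near t ht x y hxy h2)
  · have h1 := h.ball t ht x y hx hy hxy
    have h2 := h'.ball t ht x y hx hy hxy
    have := key 1 (‖x - y‖ ^ lam) _ _ _ _ zero_le_one (by positivity)
      (by rwa [one_mul]) (by rwa [one_mul])
    rwa [one_mul] at this
  · exact key _ _ _ _ _ _ (wt_rpow_pos x σ).le (by positivity) (h.time t ht t' ht' hne x)
      (h'.time t ht t' ht' hne x)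

theorem HolBd.smul {C σ : ℝ} {u : ℝ → Spc n → ℝ} (c : ℝ) (h : HolBd T lam C σ u) :
    HolBd T lam (|c| * C) σ (c • u) := by
  have key : ∀ w d a b : ℝ, w * ‖a - b‖ / d ≤ C → w * ‖c • a - c • b‖ / d ≤ |c| * C := by
    intro w d a b h1
    calc w * ‖c • a - c • b‖ / d = |c| * (w * ‖a - b‖ / d) := by
          rw [← smul_sub, norm_smul, Real.norm_eq_abs c]; ring
      _ ≤ _ := by gcongr
  have hs := h.supBd.smul c
  refine ⟨hs.cont, hs.sup, fun t ht x y hxy h2 => key _ _ _ _ (h.near t ht x y hxy h2),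
    fun t ht x y hx hy hxy => ?_, fun t ht t' ht' hne x => key _ _ _ _ (h.time t ht t' ht' hne x)⟩
  have h1 := h.ball t ht x y hx hy hxy
  have := key 1 (‖x - y‖ ^ lam) _ _ (by rwa [one_mul])
  rwa [one_mul] at this

theorem SpReg.zero {P : ℝ → (ℝ → Spc n → ℝ) → Prop} (hP : ∀ σ, P σ 0) (N : ℕ) (σ : ℝ) :
    SpReg T P N σ 0 := by
  induction N generalizing σ with
  | zero => exact hP σ
  | succ N ih =>
    refine ⟨hP σ, 0, fun t _ x => ?_, fun i => ih _⟩
    exact (hasFDerivAt_const (0 : ℝ) x).congr_fderiv (by ext v; simp [gradForm_apply])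

theorem ParReg.zero {P : ℝ → (ℝ → Spc n → ℝ) → Prop} (hP : ∀ σ, P σ 0) (s K : ℕ) (σ : ℝ) :
    ParReg T P s K σ 0 := by
  induction s with
  | zero => exact SpReg.zero hP K σ
  | succ s ih => exact ⟨SpReg.zero hP _ σ, 0, fun t _ x => hasDerivWithinAt_const _ _ _, ih⟩

theorem holBd_zero (σ : ℝ) : HolBd T lam 0 σ (0 : ℝ → Spc n → ℝ) where
  cont := continuousOn_const
  sup := by simp
  near := by simp
  ball := by simp
  time := by simp

theorem supBd_zero (σ : ℝ) : SupBd T 0 σ (0 : ℝ → Spc n → ℝ) where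
  cont := continuousOn_const
  sup := by simp

theorem ParReg.sum_holBd {ι : Type*} {C σ : ℝ} {s K : ℕ} (S : Finset ι)
    {f : ι → ℝ → Spc n → ℝ} (h : ∀ i ∈ S, ParReg T (HolBd T lam C) s K σ (f i)) :
    ParReg T (HolBd T lam (S.card * C)) s K σ (∑ i ∈ S, f i) := by
  induction S using Finset.induction_on with
  | empty => simpa using ParReg.zero (T := T) (n := n) (holBd_zero (lam := lam)) s K σ
  | insert a S ha ih =>
    rw [Finset.sum_insert ha, Finset.card_insert_of_notMem ha]
    have := ParReg.add (R := HolBd T lam (C + S.card * C)) (fun _ _ _ => HolBd.add)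
      (h a (Finset.mem_insert_self _ _)) (ih fun i hi => h i (Finset.mem_insert_of_mem hi))
    rwa [show C + S.card * C = ((S.card + 1 : ℕ) : ℝ) * C by push_cast; ring] at this

theorem ParReg.sum_supBd {ι : Type*} {C σ : ℝ} {s K : ℕ} (S : Finset ι)
    {f : ι → ℝ → Spc n → ℝ} (h : ∀ i ∈ S, ParReg T (SupBd T C) s K σ (f i)) :
    ParReg T (SupBd T (S.card * C)) s K σ (∑ i ∈ S, f i) := by
  induction S using Finset.induction_on with
  | empty => simpa using ParReg.zero (T := T) (n := n) supBd_zero s K σ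
  | insert a S ha ih =>
    rw [Finset.sum_insert ha, Finset.card_insert_of_notMem ha]
    have := ParReg.add (R := SupBd T (C + S.card * C)) (fun _ _ _ => SupBd.add)
      (h a (Finset.mem_insert_self _ _)) (ih fun i hi => h i (Finset.mem_insert_of_mem hi))
    rwa [show C + S.card * C = ((S.card + 1 : ℕ) : ℝ) * C by push_cast; ring] at this

end sums

theorem heatKer_integral {μ r : ℝ} (hμ : 0 < μ) (hr : 0 < r) (f : Spc n → ℝ) (x : Spc n) :
    ∫ y, heatKer μ (x - y) r * f y = avg gam (heatScale μ r) f x := by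
  have hc := heatScale_pos hμ hr
  set c := heatScale μ r with hcd
  have hc2 : c ^ 2 = 4 * μ * r := by
    rw [hcd, heatScale, mul_pow, Real.sq_sqrt (by linarith), Real.sq_sqrt hr.le]
  have e1 := integral_sub_left_eq_self (μ := (volume : Measure (Spc n)))
    (fun y => heatKer μ (x - y) r * f y) x
  have e2 := Measure.integral_comp_smul_of_nonneg (volume : Measure (Spc n))
    (fun y => heatKer μ (x - (x - y)) r * f (x - y)) c (hR := hc.le)
  rw [e1, finrank_euclideanSpace, Fintype.card_fin, smul_eq_mul] at e2
  have e3 : ∫ y, heatKer μ (x - y) r * f y =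
      c ^ n * ∫ z, heatKer μ (x - (x - c • z)) r * f (x - c • z) := by
    rw [e2, ← mul_assoc, mul_inv_cancel₀ (by positivity), one_mul]
  rw [e3, ← integral_const_mul, avg]
  refine integral_congr_ae (Eventually.of_forall fun z => ?_)
  have hp : (4 * Real.pi * μ * r) ^ (-(n : ℝ) / 2) = Real.pi ^ (-(n : ℝ) / 2) * (c ^ n)⁻¹ := by
    rw [show 4 * Real.pi * μ * r = Real.pi * c ^ 2 by rw [hc2]; ring,
      Real.mul_rpow Real.pi_pos.le (by positivity), ← Real.rpow_natCast, ← Real.rpow_mul hc.le,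
      ← Real.rpow_natCast, ← Real.rpow_neg hc.le]
    congr 2
    push_cast
    ring
  simp only [heatKer, if_pos hr, sub_sub_cancel, gam, hp, norm_smul, Real.norm_of_nonneg hc.le,
    mul_pow, ← hc2]
  have he : -(c ^ 2 * ‖z‖ ^ 2) / c ^ 2 = -‖z‖ ^ 2 := by field_simp
  rw [he]
  field_simp

theorem volPot_eq {μ : ℝ} (hμ : 0 < μ) (f : ℝ → Spc n → ℝ) {t : ℝ} (ht : 0 ≤ t) (x : Spc n) :
    volPot μ f t x = profPot μ gam (fun _ => 1) f t x := by
  rw [volPot, profPot, intervalIntegral.integral_of_le ht, integral_Ioc_eq_integral_Ioo,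
    integral_Ioc_eq_integral_Ioo]
  refine setIntegral_congr_fun measurableSet_Ioo fun τ hτ => ?_
  simp only [one_mul]
  exact heatKer_integral hμ (by linarith [hτ.2]) _ x

section derivs

variable {T μ A K C : ℝ} {φ : Spc n → ℝ} {ρ : ℝ → ℝ} {f : ℝ → Spc n → ℝ}
  {f' : Fin n → ℝ → Spc n → ℝ}

theorem hasDx_profPot (hρ : SingWt T A ρ) (hA : 0 ≤ A) (hφ : GaussBd K φ) (hK : 0 ≤ K)
    (hC : 0 ≤ C) (hf : SupBd T C 0 f) (hd : HasDx T f f') (hf' : ∀ i, SupBd T C 0 (f' i)) :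
    HasDx T (profPot μ φ ρ f) fun i => profPot μ φ ρ (f' i) := by
  intro t ht x
  have int : ∀ g, SupBd T C 0 g → ∀ x, IntegrableOn
      (fun τ => ρ (t - τ) * avg φ (heatScale μ (t - τ)) (g τ) x) (Set.Ioc 0 t) volume :=
    fun g hg x => (intervalIntegrable_iff_integrableOn_Ioc_of_le ht.1).mp
      (profPot_intervalIntegrable hρ hA hφ hK le_rfl hC hg ht x)
  have hb : IntegrableOn (fun τ => A * (K * C * avgConst n 0 (heatScale μ T)) *
      (t - τ) ^ (-(1 / 2 : ℝ))) (Set.Ioc 0 t) volume := by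
    refine (intervalIntegrable_iff_integrableOn_Ioc_of_le ht.1).mp ?_
    have := (intervalIntegral.intervalIntegrable_rpow' (a := 0) (b := t)
      (r := -(1 / 2)) (by norm_num)).comp_sub_left t
    simpa using (this.const_mul (A * (K * C * avgConst n 0 (heatScale μ T)))).symm
  have hne : ∀ᵐ τ ∂(volume.restrict (Set.Ioc 0 t)), τ ∈ Set.Ioo 0 t := by
    rw [← restrict_Ioo_eq_restrict_Ioc]
    exact ae_restrict_mem measurableSet_Ioo
  have e : ∀ g, profPot μ φ ρ g t = fun y => ∫ τ in Set.Ioc 0 t,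
      ρ (t - τ) * avg φ (heatScale μ (t - τ)) (g τ) y := fun g => by
    ext y
    rw [profPot, intervalIntegral.integral_of_le ht.1]
  simp only [e]
  refine hasFDerivAt_integral_gradForm (s := Set.univ) univ_mem
    (fun y => (int f hf y).aestronglyMeasurable) (int f hf x)
    (fun i => (int (f' i) (hf' i) x).aestronglyMeasurable)
    (G := fun i y τ => ρ (t - τ) * avg φ (heatScale μ (t - τ)) (f' i τ) y) ?_ hb ?_
  · filter_upwards [hne] with τ hτ y _ i
    have := profPot_integrand_le (μ := μ) hρ hA hφ hK le_rfl hC (hf' i) hτ.1.le hτ.2 ht.2 y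
    simpa using this
  · filter_upwards [hne] with τ hτ y _
    have hτT : τ ∈ Set.Icc 0 T := ⟨hτ.1.le, hτ.2.le.trans ht.2⟩
    have := hasFDerivAt_avg hφ hK (fun x => abs_le_of_weighted le_rfl (hf.sup τ hτT) x)
      (hd τ hτT) (fun i => (hf' i).cont.space hτT)
      (fun i x => abs_le_of_weighted le_rfl ((hf' i).sup τ hτT) x) (heatScale μ (t - τ)) y
    refine (this.const_mul (ρ (t - τ))).congr_fderiv ?_
    ext v
    simp [gradForm_apply, Finset.mul_sum, mul_assoc]

theorem profPot_gamD (hμ : 0 < μ) (hf : SupBd T C 0 f) (hd : HasDx T f f')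
    (hf' : ∀ i, SupBd T C 0 (f' i)) (i : Fin n) :
    EqT T (profPot μ gam (fun _ => 1) (f' i))
      (profPot μ (gamD i) (fun r => 1 / heatScale μ r) f) := by
  intro t ht x
  rw [profPot, profPot, intervalIntegral.integral_of_le ht.1, integral_Ioc_eq_integral_Ioo,
    intervalIntegral.integral_of_le ht.1, integral_Ioc_eq_integral_Ioo]
  refine setIntegral_congr_fun measurableSet_Ioo fun τ hτ => ?_
  have hτT : τ ∈ Set.Icc 0 T := ⟨hτ.1.le, hτ.2.le.trans ht.2⟩
  have hc := (heatScale_pos hμ (by linarith [hτ.2] : 0 < t - τ)).ne'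
  rw [avg_gamD (fun x => abs_le_of_weighted le_rfl (hf.sup τ hτT) x)
      (hd τ hτT) (fun i => (hf' i).cont.space hτT)
      (fun i x => abs_le_of_weighted le_rfl ((hf' i).sup τ hτT) x)]
  field_simp

/-- Interchange of the order of integration over a triangle. -/
theorem integral_triangle_swap {H : ℝ → ℝ → ℝ} {t : ℝ} (ht : 0 ≤ t)
    (hH : ContinuousOn (Function.uncurry H) (Set.Icc 0 t ×ˢ Set.Icc 0 t)) :
    ∫ τ in (0 : ℝ)..t, ∫ s in τ..t, H τ s = ∫ s in (0 : ℝ)..t, ∫ τ in (0 : ℝ)..s, H τ s := by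
  set G : ℝ → ℝ → ℝ := fun τ s => ({p : ℝ × ℝ | p.1 < p.2}).indicator (Function.uncurry H) (τ, s)
    with hG
  have h_int : Integrable (Function.uncurry G)
      ((volume.restrict (Set.Ioc 0 t)).prod (volume.restrict (Set.Ioc 0 t))) := by
    have h1 : IntegrableOn (Function.uncurry H) (Set.Icc 0 t ×ˢ Set.Icc 0 t)
        ((volume : Measure ℝ).prod volume) :=
      hH.integrableOn_compact (isCompact_Icc.prod isCompact_Icc)
    rw [Measure.prod_restrict]
    have h2 := h1.mono_set (Set.prod_mono Set.Ioc_subset_Icc_self Set.Ioc_subset_Icc_self)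
    exact (h2.indicator (measurableSet_lt measurable_fst measurable_snd)).congr
      (Eventually.of_forall fun p => rfl)
  have hswap := integral_integral_swap h_int
  have e1 : ∫ τ in (0 : ℝ)..t, ∫ s in τ..t, H τ s =
      ∫ τ in Set.Ioc 0 t, ∫ s in Set.Ioc 0 t, G τ s := by
    rw [intervalIntegral.integral_of_le ht]
    refine setIntegral_congr_fun measurableSet_Ioc fun τ hτ => ?_
    have : ∀ s, G τ s = (Set.Ioi τ).indicator (H τ) s := fun s => by
      simp only [hG, Set.indicator_apply, Set.mem_ofPred_eq, Set.mem_Ioi, Function.uncurry]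
    simp only [this]
    rw [setIntegral_indicator measurableSet_Ioi, intervalIntegral.integral_of_le hτ.2]
    congr 2
    ext s; simp only [Set.mem_Ioc, Set.mem_inter_iff, Set.mem_Ioi]
    constructor
    · exact fun h => ⟨⟨hτ.1.trans h.1, h.2⟩, h.1⟩
    · exact fun h => ⟨h.2, h.1.2⟩
  have e2 : ∫ s in (0 : ℝ)..t, ∫ τ in (0 : ℝ)..s, H τ s =
      ∫ s in Set.Ioc 0 t, ∫ τ in Set.Ioc 0 t, G τ s := by
    rw [intervalIntegral.integral_of_le ht]
    refine setIntegral_congr_fun measurableSet_Ioc fun s hs => ?_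
    have : ∀ τ, G τ s = (Set.Iio s).indicator (fun τ => H τ s) τ := fun τ => by
      simp only [hG, Set.indicator_apply, Set.mem_ofPred_eq, Set.mem_Iio, Function.uncurry]
    simp only [this]
    rw [setIntegral_indicator measurableSet_Iio, intervalIntegral.integral_of_le hs.1.le,
      integral_Ioc_eq_integral_Ioo]
    congr 2
    ext τ; simp only [Set.mem_Ioc, Set.mem_inter_iff, Set.mem_Iio, Set.mem_Ioo]
    constructor
    · exact fun h => ⟨⟨h.1, h.2.le.trans hs.2⟩, h.2⟩
    · exact fun h => ⟨h.1.1, h.2⟩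
  rw [e1, e2, hswap]

theorem hasDerivAt_heatScale {μ r : ℝ} (hr : 0 < r) :
    HasDerivAt (heatScale μ) (Real.sqrt (4 * μ) * (1 / (2 * Real.sqrt r))) r :=
  (Real.hasDerivAt_sqrt hr.ne').const_mul _

theorem hasDt_profPot (hμ : 0 < μ) {f'' : Fin n → Fin n → ℝ → Spc n → ℝ} (hC : 0 ≤ C)
    (hf : SupBd T C 0 f) (hd : HasDx T f f') (hf' : ∀ i, SupBd T C 0 (f' i))
    (hd' : ∀ i, HasDx T (f' i) (f'' i)) (hf'' : ∀ i j, SupBd T C 0 (f'' i j))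
    (hcont : ∀ i, ContT T (profPot μ gam (fun _ => 1) (f'' i i))) :
    HasDt T (profPot μ gam (fun _ => 1) f)
      (f + μ • ∑ i, profPot μ gam (fun _ => 1) (f'' i i)) := by
  obtain ⟨K, hK, h0, h1⟩ := gaussBd_gam (n := n)
  have hsc := continuous_heatScale μ
  refine hasDt_of_integral ?_ ?_
  · refine ContinuousOn.add hf.cont ?_
    have : ContinuousOn (fun p : ℝ × Spc n =>
        μ * ∑ i, profPot μ gam (fun _ => 1) (f'' i i) p.1 p.2) (Set.Icc 0 T ×ˢ Set.univ) :=
      continuousOn_const.mul (continuousOn_finsetSum _ fun i _ => hcont i)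
    refine this.congr fun p _ => ?_
    simp [Finset.sum_apply]
  · intro t ht x
    have hT : 0 ≤ T := ht.1.trans ht.2
    have hA : ∀ g, SupBd T C 0 g → ContinuousOn (fun p : ℝ × ℝ => avg gam (heatScale μ p.2) (g p.1) x)
        (Set.Icc 0 T ×ˢ Set.univ) := fun g hg => by
      have := continuousOn_avg h0 hK hg.cont fun t ht x => abs_le_of_weighted le_rfl (hg.sup t ht) x
      exact ContinuousOn.comp (g := fun p : ℝ × ℝ × Spc n => avg gam p.2.1 (g p.1) p.2.2) this
        (f := fun p : ℝ × ℝ => (p.1, heatScale μ p.2, x)) (by fun_prop)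
        (fun p hp => ⟨hp.1, trivial⟩)
    have hAτ : ∀ g, SupBd T C 0 g → ∀ τ ∈ Set.Icc 0 T,
        Continuous fun a => avg gam (heatScale μ a) (g τ) x := fun g hg τ hτ => by
      rw [← continuousOn_univ]
      exact (hA g hg).comp (f := fun a => (τ, a)) (by fun_prop) fun a _ => ⟨hτ, trivial⟩
    set S : ℝ → ℝ → ℝ := fun τ a => μ * ∑ i, avg gam (heatScale μ a) (f'' i i τ) x with hS
    have hScont : ContinuousOn (fun p : ℝ × ℝ => S p.1 p.2) (Set.Icc 0 T ×ˢ Set.univ) :=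
      continuousOn_const.mul (continuousOn_finsetSum _ fun i _ => hA _ (hf'' i i))
    have hSτ : ∀ τ ∈ Set.Icc 0 T, Continuous (S τ) := fun τ hτ =>
      continuous_const.mul (continuous_finsetSum _ fun i _ => hAτ _ (hf'' i i) τ hτ)
    have ftc : ∀ τ ∈ Set.Icc 0 T, ∀ r, 0 ≤ r →
        ∫ a in (0 : ℝ)..r, S τ a = avg gam (heatScale μ r) (f τ) x - f τ x := by
      intro τ hτ r hr
      have := intervalIntegral.integral_eq_sub_of_hasDerivAt_of_le hr
        (f := fun a => avg gam (heatScale μ a) (f τ) x) (f' := S τ)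
        (hAτ f hf τ hτ).continuousOn (fun a ha => ?_) ((hSτ τ hτ).intervalIntegrable _ _)
      · rw [this]
        simp [heatScale, avg_zero]
      · have d1 := hasDerivAt_avg_scale (fun x => abs_le_of_weighted le_rfl (hf.sup τ hτ) x)
          (hd τ hτ) (fun i => (hf' i).cont.space hτ)
          (fun i x => abs_le_of_weighted le_rfl ((hf' i).sup τ hτ) x) (fun i => hd' i τ hτ)
          (fun i j => (hf'' i j).cont.space hτ)
          (fun i j x => abs_le_of_weighted le_rfl ((hf'' i j).sup τ hτ) x) (heatScale μ a) x
        refine (HasDerivAt.comp a d1 (hasDerivAt_heatScale ha.1)).congr_deriv ?_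
        have s1 := Real.sq_sqrt (by linarith : (0 : ℝ) ≤ 4 * μ)
        have s2 := (Real.sqrt_pos.mpr ha.1).ne'
        have : heatScale μ a / 2 * (Real.sqrt (4 * μ) * (1 / (2 * Real.sqrt a))) = μ := by
          rw [heatScale]; field_simp; linarith
        simp only [hS]
        rw [mul_right_comm, this]
    have hz : profPot μ gam (fun _ => 1) f 0 x = 0 := by simp [profPot]
    have hIcc : Set.Icc 0 t ⊆ Set.Icc 0 T := Set.Icc_subset_Icc le_rfl ht.2
    have hH : ContinuousOn (Function.uncurry fun τ s => S τ (s - τ))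
        (Set.Icc 0 t ×ˢ Set.Icc 0 t) :=
      hScont.comp (f := fun p : ℝ × ℝ => (p.1, p.2 - p.1)) (by fun_prop)
        fun p hp => ⟨hIcc hp.1, trivial⟩
    have e1 : profPot μ gam (fun _ => 1) f t x =
        ∫ τ in (0 : ℝ)..t, (f τ x + ∫ s in τ..t, S τ (s - τ)) := by
      rw [profPot]
      refine intervalIntegral.integral_congr fun τ hτ => ?_
      rw [Set.uIcc_of_le ht.1] at hτ
      simp only [one_mul]
      rw [intervalIntegral.integral_comp_sub_right (fun a => S τ a), sub_self,
        ftc τ (hIcc hτ) _ (by linarith [hτ.2])]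
      ring
    have if1 : IntervalIntegrable (fun τ => f τ x) volume 0 t :=
      hf.cont.intervalIntegrable ⟨le_rfl, hT⟩ ht x
    have if2 : IntervalIntegrable (fun τ => ∫ s in τ..t, S τ (s - τ)) volume 0 t := by
      have i3 : IntervalIntegrable (fun τ => 1 * avg gam (heatScale μ (t - τ)) (f τ) x)
          volume 0 t :=
        profPot_intervalIntegrable (singWt_one T) (by positivity) h0 hK le_rfl hC hf ht x
      refine (i3.sub if1).congr fun τ hτ => ?_
      rw [Set.uIoc_of_le ht.1] at hτ
      have hτ' : τ ∈ Set.Icc 0 T := ⟨hτ.1.le, hτ.2.trans ht.2⟩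
      simp only [one_mul]
      rw [intervalIntegral.integral_comp_sub_right (fun a => S τ a), sub_self,
        ftc τ hτ' _ (by linarith [hτ.2])]
    rw [hz, zero_add, e1, intervalIntegral.integral_add if1 if2, integral_triangle_swap ht.1 hH,
      ← intervalIntegral.integral_add if1]
    · refine intervalIntegral.integral_congr fun s hs => ?_
      rw [Set.uIcc_of_le ht.1] at hs
      simp only [hS, Pi.add_apply, Pi.smul_apply, Finset.sum_apply, smul_eq_mul]
      rw [intervalIntegral.integral_const_mul, intervalIntegral.integral_finsetSum]
      · simp only [profPot, one_mul]
      · intro i _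
        have := profPot_intervalIntegrable (μ := μ) (singWt_one T) (by positivity) h0 hK le_rfl hC
          (hf'' i i) (hIcc hs) x
        simpa using this
    · have : ContinuousOn (fun s => ∑ i, μ * profPot μ gam (fun _ => 1) (f'' i i) s x)
          (Set.Icc 0 t) :=
        continuousOn_finsetSum _ fun i _ => continuousOn_const.mul (((hcont i).time x).mono hIcc)
      have i4 : IntervalIntegrable (fun s => ∑ i, μ * profPot μ gam (fun _ => 1) (f'' i i) s x)
          volume 0 t := by
        refine ContinuousOn.intervalIntegrable ?_
        rwa [Set.uIcc_of_le ht.1]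
      refine i4.congr fun s hs => ?_
      rw [Set.uIoc_of_le ht.1] at hs
      simp only [hS]
      rw [intervalIntegral.integral_const_mul, intervalIntegral.integral_finsetSum]
      · simp only [profPot, one_mul, Finset.mul_sum]
      · intro i _
        have := profPot_intervalIntegrable (μ := μ) (singWt_one T) (by positivity) h0 hK le_rfl hC
          (hf'' i i) (hIcc ⟨hs.1.le, hs.2⟩) x
        simpa using this

end derivs

section potential

variable {T μ lam : ℝ}

/-- The heat potential with scale-invariant notation. -/
def heatPot (μ : ℝ) (f : ℝ → Spc n → ℝ) : ℝ → Spc n → ℝ := profPot μ gam (fun _ => 1) f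

theorem ParReg.supBd_mono {C C' σ τ : ℝ} {s N : ℕ} {u : ℝ → Spc n → ℝ}
    (h : ParReg T (SupBd T C) s N σ u) (hC : C ≤ C') (hτ : τ ≤ σ) :
    ParReg T (SupBd T C') s N τ u := by
  have := ParReg.imp (Q := SupBd T C') (a := τ - σ) (σ₀ := σ)
      (fun τ u _ h => h.mono hC (by linarith)) le_rfl h
  rwa [add_sub_cancel] at this

theorem SpReg.supBd_mono {C C' σ τ : ℝ} {N : ℕ} {u : ℝ → Spc n → ℝ}
    (h : SpReg T (SupBd T C) N σ u) (hC : C ≤ C') (hτ : τ ≤ σ) :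
    SpReg T (SupBd T C') N τ u := ParReg.supBd_mono (s := 0) h hC hτ

theorem ParReg.dx_supBd {C σ : ℝ} {s K : ℕ} {u : ℝ → Spc n → ℝ} {g : Fin n → ℝ → Spc n → ℝ}
    (h : ParReg T (SupBd T C) s (K + 1) σ u) (hg : HasDx T u g) (i : Fin n) :
    ParReg T (SupBd T C) s K (σ + 1) (g i) :=
  h.dx (local_supBd T C) (fun _ _ h => h.cont) hg i

theorem spReg_heatPot (hT : 0 ≤ T) (hμ : 0 < μ) (hl : 0 < lam) (hl1 : lam < 1) (M : ℕ) {σ : ℝ}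
    (hσ : 0 ≤ σ) : ∃ K : ℝ, 0 ≤ K ∧ ∀ C : ℝ, 0 ≤ C → ∀ f : ℝ → Spc n → ℝ,
      SpReg T (SupBd T C) (M + 1) (σ + 2) f →
      SpReg T (HolBd T lam (K * C)) (M + 2) σ (heatPot μ f) := by
  obtain ⟨Kg, hKg, hg, hgD⟩ := gaussBd_gam (n := n)
  have hs : (0 : ℝ) ≤ 1 / Real.sqrt (4 * μ) := by positivity
  induction M generalizing σ with
  | zero =>
    obtain ⟨K₀, hK₀, H₀⟩ := holBd_profPot hT hμ (singWt_one T) (Real.sqrt_nonneg T) hg hKg hl hl1 hσ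
    obtain ⟨K₁, hK₁, H₁⟩ := holBd_profPot hT hμ (singWt_one T) (Real.sqrt_nonneg T) hg hKg hl hl1
      (by linarith : 0 ≤ σ + 1)
    have : ∀ i : Fin n, ∃ K' : ℝ, 0 ≤ K' ∧ ∀ C : ℝ, 0 ≤ C → ∀ g : ℝ → Spc n → ℝ,
        SupBd T C (σ + 2 + 1) g → HolBd T lam (K' * C) (σ + 2)
          (profPot μ (gamD i) (fun r => 1 / heatScale μ r) g) := fun i =>
      holBd_profPot hT hμ (singWt_inv hμ T) hs (hgD i) hKg hl hl1 (by linarith : 0 ≤ σ + 2)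
    choose K₂ hK₂ H₂ using this
    have hS : 0 ≤ ∑ i, K₂ i := Finset.sum_nonneg fun i _ => hK₂ i
    have hi : ∀ i, K₂ i ≤ ∑ i, K₂ i := fun i =>
      Finset.single_le_sum (fun j _ => hK₂ j) (Finset.mem_univ i)
    refine ⟨K₀ + K₁ + ∑ i, K₂ i, by positivity, fun C hC f hf => ?_⟩
    obtain ⟨h0, f', hd, h1⟩ := hf
    have h1 : ∀ i, SupBd T C (σ + 2 + 1) (f' i) := h1
    have h00 := h0.mono le_rfl (by linarith : (0 : ℝ) ≤ σ + 2)
    have h10 := fun i => (h1 i).mono le_rfl (by linarith : (0 : ℝ) ≤ σ + 2 + 1)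
    refine ⟨(H₀ C hC f (h0.mono le_rfl (by linarith))).mono (by gcongr; linarith) le_rfl, _,
      hasDx_profPot (singWt_one T) (Real.sqrt_nonneg T) hg hKg hC h00 hd h10, fun i =>
      ⟨(H₁ C hC _ ((h1 i).mono le_rfl (by linarith))).mono (by gcongr; linarith) le_rfl, _,
      HasDx.congr (hasDx_profPot (singWt_inv hμ T) hs (hgD i) hKg hC h00 hd h10)
        (profPot_gamD hμ h00 hd h10 i).symm, fun j => ?_⟩⟩
    exact (H₂ i C hC _ (h1 j)).mono (by gcongr; linarith [hi i]) (by linarith)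
  | succ M ih =>
    obtain ⟨K₀, hK₀, H₀⟩ := holBd_profPot hT hμ (singWt_one T) (Real.sqrt_nonneg T) hg hKg hl hl1 hσ
    obtain ⟨K₁, hK₁, H₁⟩ := ih (by linarith : 0 ≤ σ + 1)
    refine ⟨K₀ + K₁, by positivity, fun C hC f hf => ?_⟩
    obtain ⟨h0, f', hd, h1⟩ := hf
    refine ⟨(H₀ C hC f (h0.mono le_rfl (by linarith))).mono (by gcongr; linarith) le_rfl, _,
      hasDx_profPot (singWt_one T) (Real.sqrt_nonneg T) hg hKg hC
        (h0.mono le_rfl (by linarith)) hd fun i => (h1 i).base.mono le_rfl (by linarith),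
      fun i => ?_⟩
    have := h1 i
    rw [add_right_comm] at this
    exact (H₁ C hC _ this).holBd_mono (by gcongr; linarith)

/-- Mapping property of the heat potential in weighted parabolic spaces. -/
theorem parReg_heatPot (hT : 0 ≤ T) (hμ : 0 < μ) (hl : 0 < lam) (hl1 : lam < 1) (s k : ℕ) {σ : ℝ}
    (hσ : 0 ≤ σ) : ∃ K : ℝ, 0 ≤ K ∧ ∀ C : ℝ, 0 ≤ C → ∀ f : ℝ → Spc n → ℝ,
      ParReg T (SupBd T C) s (k + 1) (σ + 2) f →
      ParReg T (HolBd T lam (K * C)) s (k + 2) σ (heatPot μ f) := by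
  induction s with
  | zero => exact spReg_heatPot hT hμ hl hl1 k hσ
  | succ s ih =>
    obtain ⟨K₀, hK₀, H₀⟩ := spReg_heatPot (n := n) hT hμ hl hl1 (k + 2 * (s + 1)) hσ
    obtain ⟨K₁, hK₁, H₁⟩ := ih
    obtain ⟨K₂, hK₂, H₂⟩ := ParReg.holBd_of_supBd (n := n) hT hl hl1 s (k + 1) hσ
    set K₃ := K₂ + |μ| * (Fintype.card (Fin n) * K₁) with hK₃
    have hK₃0 : 0 ≤ K₃ := by positivity
    refine ⟨K₀ + K₃, by positivity, fun C hC f hf => ?_⟩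
    obtain ⟨f', hd⟩ := hf.exists_dx
    have hf' : ∀ i, ParReg T (SupBd T C) s (k + 1 + 1) (σ + 2 + 1) (f' i) :=
      hf.drop_time.dx_supBd hd
    have hd' : ∀ i, ∃ g, HasDx T (f' i) g := fun i => (hf' i).exists_dx
    choose f'' hd' using hd'
    have hf'' : ∀ i j, ParReg T (SupBd T C) s (k + 1) (σ + 2 + 1 + 1) (f'' i j) := fun i =>
      (hf' i).dx_supBd (hd' i)
    have hP : ∀ i, ParReg T (HolBd T lam (K₁ * C)) s (k + 2) σ (heatPot μ (f'' i i)) := fun i =>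
      H₁ C hC _ ((hf'' i i).supBd_mono le_rfl (by linarith))
    have hdt := hasDt_profPot hμ hC (hf.base.mono le_rfl (by linarith)) hd
      (fun i => (hf' i).base.mono le_rfl (by linarith)) hd'
      (fun i j => (hf'' i j).base.mono le_rfl (by linarith)) fun i => (hP i).base.cont
    refine ⟨?_, _, hdt, ?_⟩
    · have h1 := H₀ C hC f (by
        have := hf.spReg
        rwa [show k + 1 + 2 * (s + 1) = k + 2 * (s + 1) + 1 by ring] at this)
      rw [show k + 2 * (s + 1) + 2 = k + 2 + 2 * (s + 1) by ring] at h1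
      exact h1.holBd_mono (by gcongr; linarith)
    · have h2 := ParReg.sum_holBd Finset.univ fun i _ => hP i
      have h3 := h2.smul (c := μ) (Q := HolBd T lam (|μ| * ((Finset.univ : Finset (Fin n)).card *
        (K₁ * C)))) fun _ _ h => h.smul μ
      have h4 := (H₂ C hC f hf).add (R := HolBd T lam (K₂ * C + |μ| *
        ((Finset.univ : Finset (Fin n)).card * (K₁ * C)))) (fun _ _ _ => HolBd.add) h3
      refine h4.holBd_mono ?_
      have : K₂ * C + |μ| * ((Finset.univ : Finset (Fin n)).card * (K₁ * C)) = K₃ * C := by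
        rw [hK₃, Finset.card_univ]; ring
      rw [this]
      gcongr
      linarith

end potential

section holBdLinear

variable {T lam C σ : ℝ} {F G : Type*} [NormedAddCommGroup F] [NormedAddCommGroup G]

theorem HolBd.comp {u : ℝ → Spc n → F} (h : HolBd T lam C σ u) {L : F → G}
    (hL : ∀ a b, ‖L a - L b‖ ≤ ‖a - b‖) (h0 : L 0 = 0) :
    HolBd T lam C σ fun t x => L (u t x) := by
  have hc : Continuous L := by
    refine (LipschitzWith.of_dist_le_mul (K := 1) fun a b => ?_).continuous
    rw [dist_eq_norm, dist_eq_norm]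
    simpa using hL a b
  refine ⟨hc.comp_continuousOn h.cont, fun t ht x => ?_, fun t ht x y hxy h2 => ?_,
    fun t ht x y hx hy hxy => ?_, fun t ht t' ht' hne x => ?_⟩
  · refine le_trans ?_ (h.sup t ht x)
    have := hL (u t x) 0
    rw [h0, sub_zero, sub_zero] at this
    exact mul_le_mul_of_nonneg_left this (wt_rpow_pos x σ).le
  · refine le_trans ?_ (h.near t ht x y hxy h2)
    have := Real.rpow_nonneg (by linarith [one_le_wt2 x y] : 0 ≤ wt2 x y) (σ + lam)
    gcongr
    exact hL _ _
  · refine le_trans ?_ (h.ball t ht x y hx hy hxy)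
    gcongr
    exact hL _ _
  · refine le_trans ?_ (h.time t ht t' ht' hne x)
    have := (wt_rpow_pos x σ).le
    gcongr
    exact hL _ _

theorem HolBd.isometry [NormedSpace ℝ F] [NormedSpace ℝ G] {u : ℝ → Spc n → F}
    (h : HolBd T lam C σ u) (L : F ≃ₗᵢ[ℝ] G) : HolBd T lam C σ fun t x => L (u t x) :=
  h.comp (fun a b => by rw [← map_sub, LinearIsometryEquiv.norm_map]) (map_zero L)

theorem HolBd.compMultilinear [NormedSpace ℝ F] [NormedSpace ℝ G] {a : ℕ}
    {u : ℝ → Spc n → ContinuousMultilinearMap ℝ (fun _ : Fin a => Spc n) F}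
    (h : HolBd T lam C σ u) (L : F →L[ℝ] G) (hL : ‖L‖ ≤ 1) :
    HolBd T lam C σ fun t x => L.compContinuousMultilinearMap (u t x) := by
  refine h.comp (L := fun B => L.compContinuousMultilinearMap B) (fun A B => ?_) (by ext v; simp)
  have : L.compContinuousMultilinearMap A - L.compContinuousMultilinearMap B =
      L.compContinuousMultilinearMap (A - B) := by
    ext v; simp
  rw [this]
  refine (ContinuousLinearMap.norm_compContinuousMultilinearMap_le _ _).trans ?_
  nlinarith [norm_nonneg (A - B)]

theorem HolBd.zero : HolBd T lam 0 σ (0 : ℝ → Spc n → F) where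
  cont := continuousOn_const
  sup := by simp
  near := by simp
  ball := by simp
  time := by simp

theorem HolBd.sum {ι : Type*} (S : Finset ι) {u : ι → ℝ → Spc n → F}
    (h : ∀ i ∈ S, HolBd T lam C σ (u i)) : HolBd T lam (S.card * C) σ (∑ i ∈ S, u i) := by
  induction S using Finset.induction_on with
  | empty => simpa using HolBd.zero
  | insert a S ha ih =>
    rw [Finset.sum_insert ha, Finset.card_insert_of_notMem ha]
    have := (h a (Finset.mem_insert_self _ _)).add
      (ih fun i hi => h i (Finset.mem_insert_of_mem hi))
    rwa [show C + S.card * C = ((S.card + 1 : ℕ) : ℝ) * C by push_cast; ring] at this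

theorem HolBd.const_nonneg {u : ℝ → Spc n → F} (h : HolBd T lam C σ u) (hT : 0 ≤ T) : 0 ≤ C :=
  le_trans (by have := wt_rpow_pos (0 : Spc n) σ; positivity) (h.sup 0 ⟨le_rfl, hT⟩ 0)

end holBdLinear

section iterated

variable {T lam C : ℝ}

/-- Evaluation of a linear form at a basis vector. -/
def evalAt (i : Fin n) : (Spc n →L[ℝ] ℝ) →L[ℝ] ℝ :=
  ContinuousLinearMap.apply ℝ ℝ (EuclideanSpace.single i 1)

theorem norm_evalAt_le (i : Fin n) : ‖evalAt i‖ ≤ 1 := by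
  refine ContinuousLinearMap.opNorm_le_bound _ zero_le_one fun L => ?_
  simpa [evalAt, mul_comm] using L.le_opNorm (EuclideanSpace.single i 1)

/-- Splitting off the last argument of a multilinear form. -/
def curryLast (n a : ℕ) : ContinuousMultilinearMap ℝ (fun _ : Fin (a + 1) => Spc n) ℝ ≃ₗᵢ[ℝ]
    ContinuousMultilinearMap ℝ (fun _ : Fin a => Spc n) (Spc n →L[ℝ] ℝ) :=
  continuousMultilinearCurryRightEquiv' ℝ a (Spc n) ℝ

theorem iteratedFDeriv_succ_eq_curryLast (a : ℕ) (g : Spc n → ℝ) (x : Spc n) :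
    iteratedFDeriv ℝ (a + 1) g x = (curryLast n a).symm (iteratedFDeriv ℝ a (fderiv ℝ g) x) :=
  iteratedFDeriv_succ_eq_comp_right

theorem iteratedFDeriv_pd {N a : ℕ} {g : Spc n → ℝ} (hg : ContDiff ℝ (N + 1 : ℕ) g) (ha : a ≤ N)
    (i : Fin n) (x : Spc n) :
    iteratedFDeriv ℝ a (pd i g) x = (evalAt i).compContinuousMultilinearMap
      (curryLast n a (iteratedFDeriv ℝ (a + 1) g x)) := by
  have h1 : ContDiff ℝ N (fderiv ℝ g) := hg.fderiv_right (by norm_cast)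
  have := (evalAt i).iteratedFDeriv_comp_left h1.contDiffAt (x := x) (i := a) (by exact_mod_cast ha)
  rw [iteratedFDeriv_succ_eq_curryLast, LinearIsometryEquiv.apply_symm_apply]
  exact this

theorem spReg_of_iteratedFDeriv {N : ℕ} {σ : ℝ} {g : ℝ → Spc n → ℝ}
    (hg : ∀ t ∈ Set.Icc 0 T, ContDiff ℝ N (g t))
    (h : ∀ a ≤ N, HolBd T lam C (σ + a) fun t => iteratedFDeriv ℝ a (g t)) :
    SpReg T (HolBd T lam C) N σ g := by
  have h0 : HolBd T lam C σ g := by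
    have := h 0 (Nat.zero_le _)
    rw [Nat.cast_zero, add_zero] at this
    refine (this.comp (L := continuousMultilinearCurryFin0 ℝ (Spc n) ℝ)
      (fun a b => by rw [← map_sub, LinearIsometryEquiv.norm_map]) (map_zero _)).congr ?_
    intro t _ x
    simp [iteratedFDeriv_zero_eq_comp]
  induction N generalizing σ g with
  | zero => exact h0
  | succ N ih =>
    have hpd : ∀ i, ∀ a ≤ N, HolBd T lam C (σ + 1 + a) fun t => iteratedFDeriv ℝ a (pd i (g t)) := by
      intro i a ha
      have h1 := h (a + 1) (by omega)
      rw [show σ + ((a + 1 : ℕ) : ℝ) = σ + 1 + a by push_cast; ring] at h1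
      refine ((h1.isometry (curryLast n a)).compMultilinear (evalAt i) (norm_evalAt_le i)).congr ?_
      intro t ht x
      exact (iteratedFDeriv_pd (hg t ht) ha i x).symm
    refine ⟨h0, fun i t => pd i (g t), fun t ht x => ?_, fun i => ih (fun t ht => ?_) (hpd i) ?_⟩
    · have hd : DifferentiableAt ℝ (g t) x :=
        (hg t ht).differentiable (by norm_cast) x
      refine hd.hasFDerivAt.congr_fderiv ?_
      exact (gradForm_apply_single _).symm
    · have h1 : ContDiff ℝ N (fderiv ℝ (g t)) := (hg t ht).fderiv_right (by norm_cast)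
      exact (evalAt i).contDiff.comp h1
    · have := hpd i 0 (Nat.zero_le _)
      rw [Nat.cast_zero, add_zero] at this
      refine (this.comp (L := continuousMultilinearCurryFin0 ℝ (Spc n) ℝ)
        (fun a b => by rw [← map_sub, LinearIsometryEquiv.norm_map]) (map_zero _)).congr ?_
      intro t _ x
      simp [iteratedFDeriv_zero_eq_comp]

theorem SpReg.contDiff {P : ℝ → (ℝ → Spc n → ℝ) → Prop} (hPc : ∀ σ u, P σ u → ContT T u)
    {N : ℕ} {σ : ℝ} {g : ℝ → Spc n → ℝ} (h : SpReg T P N σ g) :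
    ∀ t ∈ Set.Icc 0 T, ContDiff ℝ N (g t) := by
  induction N generalizing σ g with
  | zero =>
    intro t ht
    exact contDiff_zero.mpr ((hPc _ _ h).space ht)
  | succ N ih =>
    obtain ⟨_, g', hg', h2⟩ := h
    intro t ht
    push_cast
    rw [contDiff_succ_iff_fderiv]
    refine ⟨fun x => (hg' t ht x).differentiableAt, fun h => by simp at h, ?_⟩
    have : fderiv ℝ (g t) = fun x => gradForm fun i => g' i t x := by
      ext1 x; exact (hg' t ht x).fderiv
    rw [this]
    unfold gradForm
    exact ContDiff.sum fun i _ => (ih (h2 i) t ht).smul contDiff_const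

/-- The linear form `r ↦ r • dx_i`. -/
def coordForm (i : Fin n) : ℝ →L[ℝ] (Spc n →L[ℝ] ℝ) :=
  ContinuousLinearMap.smulRight (1 : ℝ →L[ℝ] ℝ) (EuclideanSpace.proj i : Spc n →L[ℝ] ℝ)

theorem norm_coordForm_le (i : Fin n) : ‖coordForm i‖ ≤ 1 := by
  refine ContinuousLinearMap.opNorm_le_bound _ zero_le_one fun r => ?_
  refine ContinuousLinearMap.opNorm_le_bound _ (by positivity) fun v => ?_
  simp only [coordForm, ContinuousLinearMap.smulRight_apply, one_apply_eq_self,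
    smul_apply, norm_smul, one_mul]
  gcongr
  exact PiLp.norm_apply_le v i

theorem SpReg.iteratedFDeriv {N a : ℕ} (ha : a ≤ N) (hT : 0 ≤ T) {σ : ℝ} {g : ℝ → Spc n → ℝ}
    (h : SpReg T (HolBd T lam C) N σ g) :
    HolBd T lam ((n + 1) ^ a * C) (σ + a) fun t => iteratedFDeriv ℝ a (g t) := by
  induction a generalizing N σ g with
  | zero =>
    rw [Nat.cast_zero, add_zero, pow_zero, one_mul]
    refine (h.base.comp (L := (continuousMultilinearCurryFin0 ℝ (Spc n) ℝ).symm)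
      (fun a b => by rw [← map_sub, LinearIsometryEquiv.norm_map]) (map_zero _)).congr ?_
    intro t _ x
    simp [iteratedFDeriv_zero_eq_comp]
  | succ a ih =>
    have hC := h.base.const_nonneg hT
    obtain ⟨N, rfl⟩ : ∃ N', N = N' + 1 := ⟨N - 1, by omega⟩
    obtain ⟨_, g', hg', h2⟩ := h
    have hc := fun i => (h2 i).contDiff fun _ _ h => h.cont
    have h1 := fun i => ih (by omega) (h2 i)
    rw [show σ + 1 + (a : ℝ) = σ + ((a + 1 : ℕ) : ℝ) by push_cast; ring] at h1
    have h3 := fun i => (h1 i).compMultilinear (coordForm i) (norm_coordForm_le i)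
    have h4 := (HolBd.sum Finset.univ fun i _ => h3 i).isometry (curryLast n a).symm
    refine (h4.mono ?_ le_rfl).congr ?_
    · rw [Finset.card_univ, Fintype.card_fin, pow_succ']
      have : 0 ≤ ((n : ℝ) + 1) ^ a * C := by positivity
      nlinarith
    · intro t ht x
      have e : fderiv ℝ (g t) = ∑ i, (coordForm i ∘ g' i t) := by
        ext1 x
        rw [(hg' t ht x).fderiv, gradForm, Finset.sum_apply]
        rfl
      have hc' : ∀ i, ContDiff ℝ a (g' i t) := fun i => (hc i t ht).of_le (by norm_cast; omega)
      change _ = _root_.iteratedFDeriv ℝ (a + 1) (g t) x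
      rw [iteratedFDeriv_succ_eq_curryLast]
      rw [e, iteratedFDeriv_sum_apply fun i _ =>
        ((coordForm i).contDiff.comp (hc' i)).contDiffAt]
      simp only [Finset.sum_apply]
      refine congrArg (curryLast n a).symm (Finset.sum_congr rfl fun i _ => ?_)
      exact ((coordForm i).iteratedFDeriv_comp_left (hc' i).contDiffAt le_rfl).symm

end iterated

section conversion

variable {T lam C σ : ℝ} {F : Type*} [NormedAddCommGroup F]

theorem holBd_of_eAniso0_le {v : ℝ → Spc n → F} (hl : lam ≠ 0) (hC : 0 ≤ C) (hc : ContT T v)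
    (h : eAniso0 T lam σ v ≤ ENNReal.ofReal C) : HolBd T lam C σ v := by
  have key : ∀ r : ℝ, ENNReal.ofReal r ≤ ENNReal.ofReal C → r ≤ C := fun r hr =>
    (ENNReal.ofReal_le_ofReal_iff hC).1 hr
  rw [eAniso0, if_neg hl] at h
  have hs : ∀ t ∈ Set.Icc 0 T, eHol0 lam σ (v t) ≤ ENNReal.ofReal C := fun t ht =>
    ((le_iSup (fun t : Set.Icc 0 T => eHol0 lam σ (v t)) ⟨t, ht⟩).trans le_self_add).trans h
  simp only [eHol0, if_neg hl] at hs
  refine ⟨hc, fun t ht x => key _ ?_, fun t ht x y hne hxy => key _ ?_,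
    fun t ht x y hx hy hne => key _ ?_, fun t ht t' ht' hne x => key _ ?_⟩
  · have h1 : _ ≤ eWSup σ (v t) := le_iSup (fun x => ENNReal.ofReal (wt x ^ σ * ‖v t x‖)) x
    exact h1.trans ((le_add_self.trans le_self_add).trans (hs t ht))
  · refine le_trans ?_ (le_add_self.trans (hs t ht))
    exact le_iSup₂_of_le x y (le_iSup_of_le ⟨hne, hxy⟩ le_rfl)
  · refine le_trans ?_ ((le_self_add.trans le_self_add).trans (hs t ht))
    refine le_trans ?_ le_add_self
    exact le_iSup₂_of_le x y (le_iSup_of_le ⟨hx, hy, hne⟩ le_rfl)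
  · refine le_trans ?_ (le_add_self.trans h)
    exact le_iSup₂_of_le (⟨t, ht⟩ : Set.Icc 0 T) (⟨t', ht'⟩ : Set.Icc 0 T)
      (le_iSup₂_of_le hne x le_rfl)

theorem HolBd.eAniso0_le {v : ℝ → Spc n → F} (h : HolBd T lam C σ v) (hT : 0 ≤ T) (hσ : 0 ≤ σ) :
    eAniso0 T lam σ v ≤ ENNReal.ofReal (5 * C) := by
  have hC := h.const_nonneg hT
  have e : ENNReal.ofReal (5 * C) = (ENNReal.ofReal C + ENNReal.ofReal C + ENNReal.ofReal C +
      ENNReal.ofReal C) + ENNReal.ofReal C := by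
    rw [← ENNReal.ofReal_add, ← ENNReal.ofReal_add, ← ENNReal.ofReal_add, ← ENNReal.ofReal_add] <;>
      first | positivity | (congr 1; ring)
  rw [eAniso0, e]
  refine add_le_add (iSup_le fun t => ?_) ?_
  · have hsup : eWSup σ (v t) ≤ ENNReal.ofReal C :=
      iSup_le fun x => ENNReal.ofReal_le_ofReal (h.sup t t.2 x)
    rw [eHol0]
    split_ifs
    · exact hsup.trans le_add_self
    · refine add_le_add (add_le_add (add_le_add ?_ ?_) hsup) ?_
      · refine iSup₂_le fun x _ => ENNReal.ofReal_le_ofReal (le_trans ?_ (h.sup t t.2 x))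
        exact le_mul_of_one_le_left (norm_nonneg _) (one_le_wt_rpow x hσ)
      · exact iSup₂_le fun x y => iSup_le fun hh =>
          ENNReal.ofReal_le_ofReal (h.ball t t.2 x y hh.1 hh.2.1 hh.2.2)
      · exact iSup₂_le fun x y => iSup_le fun hh =>
          ENNReal.ofReal_le_ofReal (h.near t t.2 x y hh.1 hh.2)
  · split_ifs
    · exact zero_le
    · exact iSup₂_le fun t t' => iSup₂_le fun hh x =>
        ENNReal.ofReal_le_ofReal (h.time t t.2 t' t'.2 hh x)

theorem contT_iff {E : Type*} [TopologicalSpace E] {v : ℝ → Spc n → E} :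
    ContT T v ↔ Continuous fun p : Set.Icc (0 : ℝ) T × Spc n => v p.1 p.2 := by
  constructor
  · intro h
    exact h.comp_continuous (f := fun p : Set.Icc (0 : ℝ) T × Spc n => ((p.1 : ℝ), p.2))
      (by fun_prop) fun p => ⟨p.1.2, trivial⟩
  · intro h
    rw [ContT, continuousOn_iff_continuous_domRestrict]
    exact h.comp (g := fun p : Set.Icc (0 : ℝ) T × Spc n => v p.1 p.2)
      (f := fun p : (Set.Icc 0 T ×ˢ Set.univ : Set (ℝ × Spc n)) => (⟨p.1.1, p.2.1⟩, p.1.2))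
      (by fun_prop)

theorem cast_order (s j K : ℕ) :
    ((K + 2 * (s - j) : ℕ) : WithTop ℕ∞) = 2 * ((s : WithTop ℕ∞) - j) + K := by
  rw [add_comm]
  push_cast
  rfl

theorem parReg_of_family {P : ℝ → (ℝ → Spc n → ℝ) → Prop} {s K : ℕ} {v : ℕ → ℝ → Spc n → ℝ}
    (hd : ∀ j < s, HasDt T (v j) (v (j + 1)))
    (hr : ∀ j ≤ s, SpReg T P (K + 2 * (s - j)) σ (v j)) : ParReg T P s K σ (v 0) := by
  induction s generalizing v with
  | zero => exact hr 0 le_rfl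
  | succ s ih =>
    refine ⟨hr 0 (Nat.zero_le _), v 1, hd 0 (Nat.succ_pos _),
      ih (v := fun j => v (j + 1)) (fun j hj => hd (j + 1) (by omega)) fun j hj => ?_⟩
    have := hr (j + 1) (by omega)
    rwa [Nat.add_sub_add_right] at this

theorem eAniso0_le_eAnisoKS {k s b m j : ℕ} {δ : ℝ} (hb : b ≤ k) (h : m + 2 * j ≤ 2 * s)
    (u : ℝ → Spc n → ℝ) :
    eAniso0 T lam (δ + b + m) (mixDeriv T (b + m) j u) ≤ eAnisoKS T k s lam δ u := by
  rw [eAnisoKS]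
  refine le_trans ?_ (Finset.single_le_sum (fun _ _ => zero_le) (Finset.mem_range.2
    (Nat.lt_succ_of_le hb)))
  refine le_trans ?_ (Finset.single_le_sum (fun _ _ => zero_le) (Finset.mem_range.2
    (show m < 2 * s + 1 by omega)))
  refine le_trans ?_ (Finset.single_le_sum (fun _ _ => zero_le) (Finset.mem_range.2
    (show j < s + 1 by omega)))
  rw [if_pos h]

theorem AnisoReg.parReg {K s : ℕ} {δ : ℝ} {u : ℝ → Spc n → ℝ} (hT : 0 < T) (hl : lam ≠ 0)
    (hC : 0 ≤ C) (h : AnisoReg T K s u) (hu : eAnisoKS T K s lam δ u ≤ ENNReal.ofReal C) :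
    ParReg T (HolBd T lam C) s K δ u := by
  obtain ⟨hdt, hdx, hc⟩ := h
  have e : tDeriv T 0 u = u := by
    ext t x; rw [tDeriv, iteratedDerivWithin_zero]
  rw [← e]
  have huniq := uniqueDiffOn_Icc hT
  refine parReg_of_family (v := fun j => tDeriv T j u) (fun j hj t ht x => ?_) fun j hj => ?_
  · have h1 : DifferentiableOn ℝ (iteratedDerivWithin j (fun τ => u τ x) (Set.Icc 0 T))
        (Set.Icc 0 T) :=
      (hdt x).differentiableOn_iteratedDerivWithin (by exact_mod_cast hj) huniq
    have h2 := (h1 t ht).hasDerivWithinAt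
    rw [← iteratedDerivWithin_succ] at h2
    exact h2
  · refine spReg_of_iteratedFDeriv (fun t ht => (hdx j hj t ht).of_le (cast_order s j K).le)
      fun a ha => ?_
    · set m := min a (2 * (s - j)) with hm
      obtain ⟨b, hb⟩ : ∃ b, a = b + m := ⟨a - m, by omega⟩
      have hbK : b ≤ K := by omega
      have h3 := (eAniso0_le_eAnisoKS (lam := lam) (δ := δ) hbK
        (show m + 2 * j ≤ 2 * s by omega) u).trans hu
      rw [add_assoc, ← Nat.cast_add, ← hb] at h3
      exact holBd_of_eAniso0_le hl hC (contT_iff.2 (hc j a hj (by omega))) h3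

theorem ParReg.tDeriv {P : ℝ → (ℝ → Spc n → ℝ) → Prop} (hP : Local T P)
    (hPc : ∀ σ u, P σ u → ContT T u) (hT : 0 < T) {s K : ℕ} {u : ℝ → Spc n → ℝ}
    (h : ParReg T P s K σ u) : (∀ x, ContDiffOn ℝ s (fun t => u t x) (Set.Icc 0 T)) ∧
      ∀ j ≤ s, SpReg T P (K + 2 * (s - j)) σ (NSdeRham.tDeriv T j u) := by
  have e : ∀ u : ℝ → Spc n → ℝ, NSdeRham.tDeriv T 0 u = u := by
    intro u; ext t x; rw [NSdeRham.tDeriv, iteratedDerivWithin_zero]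
  induction s generalizing u with
  | zero =>
    refine ⟨fun x => ?_, fun j hj => ?_⟩
    · rw [Nat.cast_zero, contDiffOn_zero]
      exact (hPc _ _ h.base).time x
    · obtain rfl : j = 0 := by omega
      rw [e]; exact h
  | succ s ih =>
    obtain ⟨h1, g, hg, h2⟩ := h
    obtain ⟨h3, h4⟩ := ih h2
    have huniq := uniqueDiffOn_Icc hT
    have hd : ∀ x, Set.EqOn (derivWithin (fun τ => u τ x) (Set.Icc 0 T)) (fun τ => g τ x)
      (Set.Icc 0 T) := fun x t ht => (hg t ht x).derivWithin (huniq t ht)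
    refine ⟨fun x => ?_, fun j hj => ?_⟩
    · rw [Nat.cast_succ, contDiffOn_succ_iff_derivWithin huniq]
      refine ⟨fun t ht => (hg t ht x).differentiableWithinAt, fun hh => ?_, (h3 x).congr (hd x)⟩
      exact absurd hh (by simp)
    · cases j with
      | zero => rw [e]; exact h1
      | succ j =>
        rw [Nat.add_sub_add_right]
        refine (h4 j (by omega)).congr hP fun t ht x => ?_
        rw [NSdeRham.tDeriv, NSdeRham.tDeriv, iteratedDerivWithin_succ']
        exact iteratedDerivWithin_congr (fun τ hτ => (hd x hτ).symm) ht

theorem ParReg.aniso (hT : 0 < T) (lam : ℝ) {δ : ℝ} (hδ : 0 ≤ δ) (s K : ℕ) :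
    ∃ A : ℝ, 0 ≤ A ∧ ∀ C (u : ℝ → Spc n → ℝ), ParReg T (HolBd T lam C) s K δ u →
      AnisoReg T K s u ∧ eAnisoKS T K s lam δ u ≤ ENNReal.ofReal (A * C) := by
  refine ⟨((K + 1 : ℕ) * ((2 * s + 1 : ℕ) * ((s + 1 : ℕ) * (5 * (n + 1) ^ (K + 2 * s))))),
    by positivity, fun C u hu => ?_⟩
  have hC := hu.base.const_nonneg hT.le
  obtain ⟨h1, h2⟩ := hu.tDeriv (local_holBd T lam C) (fun _ _ h => h.cont) hT
  have h3 : ∀ j m : ℕ, j ≤ s → m + 2 * j ≤ 2 * s + K →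
      HolBd T lam ((n + 1) ^ m * C) (δ + m) (mixDeriv T m j u) := fun j m hj hm =>
    (h2 j hj).iteratedFDeriv (by omega) hT.le
  refine ⟨⟨h1, fun j hj t ht => ?_, fun j m hj hm => contT_iff.1 (h3 j m hj hm).cont⟩, ?_⟩
  · exact ((h2 j hj).contDiff (fun _ _ h => h.cont) t ht).of_le (cast_order s j K).ge
  · rw [eAnisoKS]
    have h4 : ∀ b ∈ Finset.range (K + 1), ∀ m ∈ Finset.range (2 * s + 1),
        ∀ j ∈ Finset.range (s + 1),
        (if m + 2 * j ≤ 2 * s then eAniso0 T lam (δ + b + m) (mixDeriv T (b + m) j u) else 0) ≤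
          ENNReal.ofReal (5 * (n + 1) ^ (K + 2 * s) * C) := by
      intro b hb m hm j hj
      simp only [Finset.mem_range] at hb hm hj
      split_ifs with hh
      · have h5 := h3 j (b + m) (by omega) (by omega)
        rw [add_assoc, ← Nat.cast_add]
        refine (h5.eAniso0_le hT.le (by positivity)).trans (ENNReal.ofReal_le_ofReal ?_)
        rw [mul_assoc]
        gcongr
        · linarith [(Nat.cast_nonneg n : (0 : ℝ) ≤ n)]
        · omega
        · omega
      · exact zero_le
    refine (Finset.sum_le_sum fun b hb => Finset.sum_le_sum fun m hm =>
      Finset.sum_le_sum fun j hj => h4 b hb m hm j hj).trans (le_of_eq ?_)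
    simp only [Finset.sum_const, Finset.card_range, nsmul_eq_mul]
    rw [← ENNReal.ofReal_natCast (s + 1), ← ENNReal.ofReal_natCast (2 * s + 1),
      ← ENNReal.ofReal_natCast (K + 1), ← ENNReal.ofReal_mul (by positivity),
      ← ENNReal.ofReal_mul (by positivity), ← ENNReal.ofReal_mul (by positivity)]
    congr 1
    ring

end conversion

section arzelaAscoli

variable {T lam C σ τ : ℝ}

theorem SupBd.abs_le {u : ℝ → Spc n → ℝ} (h : SupBd T C σ u) (hσ : 0 ≤ σ) {t : ℝ}
    (ht : t ∈ Set.Icc 0 T) (x : Spc n) : |u t x| ≤ C :=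
  (le_mul_of_one_le_left (abs_nonneg _) (one_le_wt_rpow x hσ)).trans (h.sup t ht x)

theorem HolBd.space_modulus {u : ℝ → Spc n → ℝ} (h : HolBd T lam C σ u) (hT : 0 ≤ T)
    (hl : 0 < lam) (hl1 : lam ≤ 1) (hσ : 0 ≤ σ) {t : ℝ} (ht : t ∈ Set.Icc 0 T) (x y : Spc n) :
    |u t x - u t y| ≤ 4 * C * ‖x - y‖ ^ lam := by
  have hC := h.const_nonneg hT
  rcases eq_or_ne x y with rfl | hne
  · simpa using by positivity
  have hp : 0 < ‖x - y‖ := norm_pos_iff.2 (sub_ne_zero.2 hne)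
  have hpl := Real.rpow_pos_of_pos hp lam
  have small : ∀ x y : Spc n, x ≠ y → ‖x - y‖ ≤ ‖x‖ / 2 →
      |u t x - u t y| ≤ C * ‖x - y‖ ^ lam := by
    intro x y hne hxy
    have hp : 0 < ‖x - y‖ := norm_pos_iff.2 (sub_ne_zero.2 hne)
    have h1 := (div_le_iff₀ (Real.rpow_pos_of_pos hp lam)).1 (h.near t ht x y hne hxy)
    refine le_trans ?_ h1
    exact le_mul_of_one_le_left (abs_nonneg _)
      (Real.one_le_rpow (one_le_wt2 x y) (by positivity))
  by_cases hb : ‖x‖ ≤ 1 ∧ ‖y‖ ≤ 1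
  · have := (div_le_iff₀ hpl).1 (h.ball t ht x y hb.1 hb.2 hne)
    rw [Real.norm_eq_abs] at this
    nlinarith [mul_nonneg hC hpl.le]
  by_cases h1 : ‖x - y‖ ≤ ‖x‖ / 2
  · have := small x y hne h1
    nlinarith [mul_nonneg hC hpl.le]
  by_cases h2 : ‖y - x‖ ≤ ‖y‖ / 2
  · have := small y x hne.symm h2
    rw [abs_sub_comm, norm_sub_rev] at this
    nlinarith [mul_nonneg hC hpl.le]
  have h3 : 1 / 2 ≤ ‖x - y‖ := by
    rw [norm_sub_rev y x] at h2
    by_contra h4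
    exact hb ⟨by linarith, by linarith⟩
  have h4 : 1 / 2 ≤ ‖x - y‖ ^ lam := by
    refine le_trans ?_ (Real.rpow_le_rpow (by norm_num) h3 hl.le)
    have := Real.rpow_le_rpow_of_exponent_ge (by norm_num : (0 : ℝ) < 1 / 2) (by norm_num) hl1
    rwa [Real.rpow_one] at this
  have h5 : ∀ x, |u t x| ≤ C := fun x =>
    (⟨h.cont, h.sup⟩ : SupBd T C σ u).abs_le hσ ht x
  have h6 := abs_sub (u t x) (u t y)
  nlinarith [h5 x, h5 y, mul_le_mul_of_nonneg_left h4 hC]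

theorem HolBd.time_modulus {u : ℝ → Spc n → ℝ} (h : HolBd T lam C σ u) (hl : 0 < lam)
    (hσ : 0 ≤ σ) {t t' : ℝ} (ht : t ∈ Set.Icc 0 T) (ht' : t' ∈ Set.Icc 0 T) (x : Spc n) :
    |u t x - u t' x| ≤ C * |t - t'| ^ (lam / 2) := by
  rcases eq_or_ne t t' with rfl | hne
  · have : lam / 2 ≠ 0 := by positivity
    simp [Real.zero_rpow this]
  have hp := Real.rpow_pos_of_pos (abs_pos.2 (sub_ne_zero.2 hne)) (lam / 2)
  refine le_trans ?_ ((div_le_iff₀ hp).1 (h.time t ht t' ht' hne x))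
  exact le_mul_of_one_le_left (abs_nonneg _) (one_le_wt_rpow x hσ)

theorem isCompact_modulus {X : Type*} [MetricSpace X] {b : ℝ → ℝ}
    (hb : Tendsto b (nhds 0) (nhds 0)) (C : ℝ) :
    IsCompact {f : C(X, ℝ) | (∀ x, |f x| ≤ C) ∧ ∀ x y, dist (f x) (f y) ≤ b (dist x y)} := by
  refine ArzelaAscoli.isCompact_of_equicontinuous _ ?_ ?_
  · have e : ContinuousMap.toFun '' {f : C(X, ℝ) | (∀ x, |f x| ≤ C) ∧
        ∀ x y, dist (f x) (f y) ≤ b (dist x y)} =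
        {f : X → ℝ | (∀ x, |f x| ≤ C) ∧ ∀ x y, dist (f x) (f y) ≤ b (dist x y)} := by
      ext f
      constructor
      · rintro ⟨g, hg, rfl⟩; exact hg
      · intro hf
        have := Metric.equicontinuous_of_continuity_modulus b hb (fun _ : Unit => f)
          fun x y _ => hf.2 x y
        exact ⟨⟨f, this.continuous ()⟩, hf, rfl⟩
    rw [e]
    refine (isCompact_univ_pi fun _ : X => isCompact_Icc (a := -C) (b := C)).of_isClosed_subset
      ?_ fun f hf x _ => abs_le.1 (hf.1 x)
    have e' : {f : X → ℝ | (∀ x, |f x| ≤ C) ∧ ∀ x y, dist (f x) (f y) ≤ b (dist x y)} =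
        (⋂ x, {f : X → ℝ | |f x| ≤ C}) ∩
          ⋂ x, ⋂ y, {f : X → ℝ | dist (f x) (f y) ≤ b (dist x y)} := by
      ext f; simp
    rw [e']
    exact (isClosed_iInter fun x => isClosed_le (by fun_prop) continuous_const).inter
      (isClosed_iInter fun x => isClosed_iInter fun y =>
        isClosed_le (by fun_prop) continuous_const)
  · exact Metric.equicontinuous_of_continuity_modulus b hb _ fun x y f => f.2.2 x y

theorem HolBd.exists_subseq (hT : 0 ≤ T) (hl : 0 < lam) (hl1 : lam ≤ 1) (hτ : 0 ≤ τ)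
    (hτσ : τ < σ) {u : ℕ → ℝ → Spc n → ℝ} (h : ∀ m, HolBd T lam C σ (u m)) :
    ∃ φ : ℕ → ℕ, StrictMono φ ∧ ∃ v, SupBd T C σ v ∧
      ∀ ε > 0, ∀ᶠ m in atTop, SupBd T ε τ (u (φ m) - v) := by
  have hσ : 0 ≤ σ := hτ.trans hτσ.le
  have hC := (h 0).const_nonneg hT
  let X := Set.Icc (0 : ℝ) T × Spc n
  let b : ℝ → ℝ := fun d => 4 * C * d ^ lam + C * d ^ (lam / 2)
  have hb : Tendsto b (nhds 0) (nhds 0) := by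
    have : Continuous b := by
      refine (continuous_const.mul ?_).add (continuous_const.mul ?_)
      · exact Real.continuous_rpow_const hl.le
      · exact Real.continuous_rpow_const (by positivity)
    have h0 : b 0 = 0 := by
      simp only [b]
      rw [Real.zero_rpow hl.ne', Real.zero_rpow (by positivity)]; simp
    simpa [h0] using this.tendsto 0
  let f : ℕ → C(X, ℝ) := fun m => ⟨fun p => u m p.1 p.2, contT_iff.1 (h m).cont⟩
  have hf : ∀ m, f m ∈ {f : C(X, ℝ) | (∀ x, |f x| ≤ C) ∧
      ∀ x y, dist (f x) (f y) ≤ b (dist x y)} := by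
    intro m
    refine ⟨fun p => (⟨(h m).cont, (h m).sup⟩ : SupBd T C σ (u m)).abs_le hσ p.1.2 p.2,
      fun p q => ?_⟩
    have h1 := (h m).space_modulus hT hl hl1 hσ p.1.2 p.2 q.2
    have h2 := (h m).time_modulus hl hσ p.1.2 q.1.2 q.2
    have h3 : ‖p.2 - q.2‖ ≤ dist p q := by
      rw [← dist_eq_norm]; exact le_max_right _ _
    have h4 : |(p.1 : ℝ) - q.1| ≤ dist p q := le_max_left (dist p.1 q.1) _
    have h5 : |u m p.1 p.2 - u m q.1 q.2| ≤
        4 * C * ‖p.2 - q.2‖ ^ lam + C * |(p.1 : ℝ) - q.1| ^ (lam / 2) := by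
      refine le_trans ?_ (add_le_add h1 h2)
      exact abs_sub_le _ _ _
    refine h5.trans ?_
    simp only [b]
    gcongr
  obtain ⟨g, -, φ, hφ, hg⟩ := (isCompact_modulus hb C).tendsto_subseq hf
  rw [ContinuousMap.tendsto_iff_forall_isCompact_tendstoUniformlyOn] at hg
  let v : ℝ → Spc n → ℝ := fun t x => g (Set.projIcc 0 T hT t, x)
  have hv : ∀ (t) (ht : t ∈ Set.Icc 0 T) (x), v t x = g (⟨t, ht⟩, x) := fun t ht x => by
    simp only [v]; rw [Set.projIcc_of_mem hT ht]
  have hlim : ∀ t ∈ Set.Icc 0 T, ∀ x, Tendsto (fun m => u (φ m) t x) atTop (nhds (v t x)) := by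
    intro t ht x
    have := (hg {(⟨t, ht⟩, x)} isCompact_singleton).tendsto_at (Set.mem_singleton _)
    rw [hv t ht x]
    exact this
  have hvS : SupBd T C σ v := by
    refine ⟨contT_iff.2 ?_, fun t ht x => ?_⟩
    · have : (fun p : Set.Icc (0 : ℝ) T × Spc n => v p.1 p.2) = g := by
        ext p; exact hv p.1 p.1.2 p.2
      rw [this]; exact g.continuous
    · exact le_of_tendsto (((hlim t ht x).norm).const_mul _)
        (Eventually.of_forall fun m => (h (φ m)).sup t ht x)
  refine ⟨φ, hφ, v, hvS, fun ε hε => ?_⟩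
  have htail : Tendsto (fun R : ℝ => 2 * C * R ^ (-(σ - τ))) atTop (nhds 0) := by
    simpa using (tendsto_rpow_neg_atTop (sub_pos.2 hτσ)).const_mul (2 * C)
  obtain ⟨R, hR1, hR⟩ : ∃ R : ℝ, 1 ≤ R ∧ 2 * C * R ^ (-(σ - τ)) ≤ ε :=
    ((eventually_ge_atTop 1).and (htail.eventually (eventually_le_nhds hε))).exists
  have hK : IsCompact (Set.univ ×ˢ Metric.closedBall 0 R : Set X) :=
    isCompact_univ.prod (isCompact_closedBall _ _)
  have hpos : 0 < (1 + R) ^ τ := Real.rpow_pos_of_pos (by linarith) _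
  filter_upwards [Metric.tendstoUniformlyOn_iff.1 (hg _ hK) (ε / (1 + R) ^ τ) (by positivity)]
    with m hm
  refine ⟨(h (φ m)).cont.sub hvS.cont, fun t ht x => ?_⟩
  rw [Pi.sub_apply, Pi.sub_apply]
  rcases le_total ‖x‖ R with hx | hx
  · have h1 := hm (⟨t, ht⟩, x) ⟨trivial, by simpa using hx⟩
    rw [dist_comm, Real.dist_eq, ← hv t ht x] at h1
    have h2 : wt x ^ τ ≤ (1 + R) ^ τ :=
      Real.rpow_le_rpow (wt_pos x).le ((wt_le_one_add_norm x).trans (by linarith)) hτ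
    calc wt x ^ τ * ‖u (φ m) t x - v t x‖ ≤ (1 + R) ^ τ * (ε / (1 + R) ^ τ) := by
          gcongr; exact h1.le
      _ = ε := by field_simp
  · have h1 := (h (φ m)).sup t ht x
    have h2 := hvS.sup t ht x
    have h3 := norm_sub_le (u (φ m) t x) (v t x)
    have h4 : wt x ^ τ = wt x ^ (-(σ - τ)) * wt x ^ σ := by
      rw [← Real.rpow_add (wt_pos x)]; congr 1; ring
    have h5 : wt x ^ (-(σ - τ)) ≤ R ^ (-(σ - τ)) :=
      Real.rpow_le_rpow_of_nonpos (by linarith) (hx.trans (norm_le_wt x)) (by linarith)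
    have h6 : wt x ^ σ * ‖u (φ m) t x - v t x‖ ≤ 2 * C := by
      have := mul_le_mul_of_nonneg_left h3 (wt_rpow_pos x σ).le
      linarith
    calc wt x ^ τ * ‖u (φ m) t x - v t x‖
        = wt x ^ (-(σ - τ)) * (wt x ^ σ * ‖u (φ m) t x - v t x‖) := by rw [h4]; ring
      _ ≤ R ^ (-(σ - τ)) * (2 * C) := by
          gcongr
          exact mul_nonneg (wt_rpow_pos x σ).le (norm_nonneg _)
      _ ≤ ε := by linarith

end arzelaAscoli

theorem exists_common_subseq {ι : Type*} (S : Finset ι) {Q : ι → (ℕ → ℕ) → Prop}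
    (hs : ∀ i φ (ψ : ℕ → ℕ), StrictMono ψ → Q i φ → Q i (φ ∘ ψ))
    (he : ∀ i φ, StrictMono φ → ∃ ψ : ℕ → ℕ, StrictMono ψ ∧ Q i (φ ∘ ψ)) :
    ∃ φ, StrictMono φ ∧ ∀ i ∈ S, Q i φ := by
  induction S using Finset.induction_on with
  | empty => exact ⟨id, strictMono_id, by simp⟩
  | insert a S _ ih =>
    obtain ⟨φ, hφ, h⟩ := ih
    obtain ⟨ψ, hψ, h'⟩ := he a φ hφ
    refine ⟨φ ∘ ψ, hφ.comp hψ, fun i hi => ?_⟩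
    rcases Finset.mem_insert.1 hi with rfl | hi
    · exact h'
    · exact hs i φ ψ hψ (h i hi)

section convergence

variable {T lam C σ τ : ℝ}

/-- Convergence of a sequence, together with all its derivatives, in weighted sup-norms. -/
def ParTendsto (T : ℝ) (s K : ℕ) (τ : ℝ) (u : ℕ → ℝ → Spc n → ℝ) (v : ℝ → Spc n → ℝ) : Prop :=
  ∀ ε > 0, ∀ᶠ m in atTop, ParReg T (SupBd T ε) s K τ (u m - v)

theorem ParTendsto.comp {s K : ℕ} {u : ℕ → ℝ → Spc n → ℝ} {v : ℝ → Spc n → ℝ}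
    (h : ParTendsto T s K τ u v) {ψ : ℕ → ℕ} (hψ : StrictMono ψ) :
    ParTendsto T s K τ (fun m => u (ψ m)) v := fun ε hε =>
  hψ.tendsto_atTop.eventually (h ε hε)

theorem ParTendsto.tendstoUniformlyOn {s K : ℕ} {u : ℕ → ℝ → Spc n → ℝ} {v : ℝ → Spc n → ℝ}
    (h : ParTendsto T s K τ u v) (hτ : 0 ≤ τ) {ε : ℝ} (hε : 0 < ε) :
    ∀ᶠ m in atTop, ∀ t ∈ Set.Icc 0 T, ∀ x, |u m t x - v t x| ≤ ε := by
  filter_upwards [h ε hε] with m hm t ht x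
  exact hm.base.abs_le hτ ht x

theorem ParTendsto.tendsto {s K : ℕ} {u : ℕ → ℝ → Spc n → ℝ} {v : ℝ → Spc n → ℝ}
    (h : ParTendsto T s K τ u v) (hτ : 0 ≤ τ) {t : ℝ} (ht : t ∈ Set.Icc 0 T) (x : Spc n) :
    Tendsto (fun m => u m t x) atTop (nhds (v t x)) := by
  rw [Metric.tendsto_atTop']
  intro ε hε
  obtain ⟨N, hN⟩ := eventually_atTop.1 (h.tendstoUniformlyOn hτ (half_pos hε))
  exact ⟨N, fun m hm => (hN m hm.le t ht x).trans_lt (half_lt_self hε)⟩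

theorem HasDx.of_tendsto {s K s' K' : ℕ} {τ' : ℝ} {u : ℕ → ℝ → Spc n → ℝ} {v : ℝ → Spc n → ℝ}
    {g : ℕ → Fin n → ℝ → Spc n → ℝ} {w : Fin n → ℝ → Spc n → ℝ} (hτ : 0 ≤ τ) (hτ' : 0 ≤ τ')
    (hd : ∀ m, HasDx T (u m) (g m)) (hu : ParTendsto T s K τ u v)
    (hg : ∀ i, ParTendsto T s' K' τ' (fun m => g m i) (w i)) : HasDx T v w := by
  intro t ht
  refine hasFDerivAt_of_tendstoUniformly (l := atTop) (f := fun m => u m t)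
    (f' := fun m x => gradForm fun i => g m i t x) ?_ (fun m x => hd m t ht x)
    fun x => hu.tendsto hτ ht x
  rw [Metric.tendstoUniformly_iff]
  intro ε hε
  have h1 := eventually_all.2 fun i =>
    (hg i).tendstoUniformlyOn hτ' (show 0 < ε / (n + 1) by positivity)
  filter_upwards [h1] with m hm x
  rw [dist_comm, dist_eq_norm, gradForm_sub]
  refine (norm_gradForm_le _ fun i => hm i t ht x).trans_lt ?_
  rw [mul_div_assoc', div_lt_iff₀ (by positivity)]
  linarith

theorem HasDt.of_tendsto {s K s' K' : ℕ} {τ' : ℝ} {u : ℕ → ℝ → Spc n → ℝ} {v : ℝ → Spc n → ℝ}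
    {g : ℕ → ℝ → Spc n → ℝ} {w : ℝ → Spc n → ℝ} (hT : 0 ≤ T) (hτ : 0 ≤ τ) (hτ' : 0 ≤ τ')
    (hd : ∀ m, HasDt T (u m) (g m)) (hgc : ∀ m, ContT T (g m)) (hw : ContT T w)
    (hu : ParTendsto T s K τ u v)
    (hg : ParTendsto T s' K' τ' g w) : HasDt T v w := by
  have h0 : (0 : ℝ) ∈ Set.Icc 0 T := ⟨le_rfl, hT⟩
  refine hasDt_of_integral hw fun t ht x => ?_
  have h_int : Tendsto (fun m => ∫ r in (0 : ℝ)..t, g m r x) atTop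
      (nhds (∫ r in (0 : ℝ)..t, w r x)) := by
    rw [Metric.tendsto_atTop']
    intro ε hε
    obtain ⟨N, hN⟩ := eventually_atTop.1
      (hg.tendstoUniformlyOn hτ' (show 0 < ε / (T + 1) by positivity))
    refine ⟨N, fun m hm => ?_⟩
    rw [dist_eq_norm, ← intervalIntegral.integral_sub ((hgc m).intervalIntegrable h0 ht x)
      (hw.intervalIntegrable h0 ht x)]
    have := intervalIntegral.norm_integral_le_of_norm_le_const (a := 0) (b := t)
      (f := fun r => g m r x - w r x) (C := ε / (T + 1)) fun r hr => by
        rw [Set.uIoc_of_le ht.1] at hr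
        exact hN m hm.le r ⟨hr.1.le, hr.2.trans ht.2⟩ x
    refine this.trans_lt ?_
    rw [sub_zero, abs_of_nonneg ht.1, div_mul_eq_mul_div, div_lt_iff₀ (by positivity)]
    nlinarith [ht.2]
  have h1 : ∀ m, u m t x = u m 0 x + ∫ r in (0 : ℝ)..t, g m r x := fun m => by
    rw [(hd m).integral_eq (hgc m) h0 ht x]; ring
  refine tendsto_nhds_unique (hu.tendsto hτ ht x) ?_
  simp only [h1]
  exact (hu.tendsto hτ h0 x).add h_int

theorem HasDx.sub {u v : ℝ → Spc n → ℝ} {g g' : Fin n → ℝ → Spc n → ℝ} (h : HasDx T u g)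
    (h' : HasDx T v g') : HasDx T (u - v) (g - g') := by
  intro t ht x
  refine ((h t ht x).sub (h' t ht x)).congr_fderiv ?_
  rw [gradForm_sub]; rfl

theorem HasDt.sub {u v g g' : ℝ → Spc n → ℝ} (h : HasDt T u g) (h' : HasDt T v g') :
    HasDt T (u - v) (g - g') := fun t ht x => (h t ht x).sub (h' t ht x)

theorem SpReg.exists_subseq (hT : 0 ≤ T) (hl : 0 < lam) (hl1 : lam ≤ 1) {η : ℝ} (hη : 0 < η)
    {N : ℕ} (hσ : η ≤ σ) {u : ℕ → ℝ → Spc n → ℝ} (h : ∀ m, SpReg T (HolBd T lam C) N σ (u m)) :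
    ∃ φ : ℕ → ℕ, StrictMono φ ∧ ∃ v, SpReg T (SupBd T C) N σ v ∧
      ParTendsto T 0 N (σ - η) (fun m => u (φ m)) v := by
  induction N generalizing σ u with
  | zero => exact HolBd.exists_subseq hT hl hl1 (by linarith) (by linarith) h
  | succ N ih =>
    choose h1 g hg h2 using h
    obtain ⟨φ, hφ, v, hv, hc⟩ := HolBd.exists_subseq hT hl hl1 (τ := σ - η) (by linarith)
      (by linarith) h1
    have hc0 : ParTendsto T 0 0 (σ - η) (fun m => u (φ m)) v := hc
    obtain ⟨ψ, hψ, h3⟩ := exists_common_subseq (Finset.univ : Finset (Fin n))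
      (Q := fun i ψ => ∃ w, SpReg T (SupBd T C) N (σ + 1) w ∧
        ParTendsto T 0 N (σ + 1 - η) (fun m => g (φ (ψ m)) i) w)
      (fun i a b hb ⟨w, hw, hw'⟩ => ⟨w, hw, hw'.comp hb⟩)
      (fun i a ha => ih (by linarith) fun m => h2 (φ (a m)) i)
    choose! w hw hcw using h3
    simp only [Finset.mem_univ, true_implies] at hw hcw
    have hc1 := hc0.comp hψ
    have hd : HasDx T v w := HasDx.of_tendsto (by linarith) (by linarith)
      (fun m => hg (φ (ψ m))) hc1 hcw
    refine ⟨φ ∘ ψ, hφ.comp hψ, v, ⟨hv, w, hd, hw⟩, fun ε hε => ?_⟩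
    filter_upwards [hc1 ε hε, eventually_all.2 fun i => hcw i ε hε] with m hm hm'
    refine ⟨hm, _, (hg (φ (ψ m))).sub hd, fun i => ?_⟩
    rw [show σ - η + 1 = σ + 1 - η by ring]
    exact hm' i

theorem ParReg.exists_subseq (hT : 0 ≤ T) (hl : 0 < lam) (hl1 : lam ≤ 1) {η : ℝ} (hη : 0 < η)
    {s K : ℕ} (hσ : η ≤ σ) {u : ℕ → ℝ → Spc n → ℝ}
    (h : ∀ m, ParReg T (HolBd T lam C) s K σ (u m)) :
    ∃ φ : ℕ → ℕ, StrictMono φ ∧ ∃ v, ParReg T (SupBd T C) s K σ v ∧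
      ParTendsto T s K (σ - η) (fun m => u (φ m)) v := by
  induction s generalizing u with
  | zero => exact SpReg.exists_subseq hT hl hl1 hη hσ h
  | succ s ih =>
    choose h1 g hg h2 using h
    obtain ⟨φ, hφ, v, hv, hc⟩ := SpReg.exists_subseq hT hl hl1 hη hσ h1
    obtain ⟨ψ, hψ, w, hw, hcw⟩ := ih fun m => h2 (φ m)
    have hc1 := hc.comp hψ
    have hd : HasDt T v w := HasDt.of_tendsto hT (by linarith) (by linarith)
      (fun m => hg (φ (ψ m))) (fun m => (h2 (φ (ψ m))).base.cont) hw.base.cont hc1 hcw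
    refine ⟨φ ∘ ψ, hφ.comp hψ, v, ⟨hv, w, hd, hw⟩, fun ε hε => ?_⟩
    filter_upwards [hc1 ε hε, hcw ε hε] with m hm hm'
    exact ⟨hm, _, (hg (φ (ψ m))).sub hd, hm'⟩

end convergence

section firstOrder

variable {T : ℝ} {ι κ ρ : Type*} [Fintype ι]

/-- Homogeneous first order differential operator with constant coefficients acting on
families of functions. -/
def FOp (c : κ → Fin n → ι → ℝ) (u : ι → ℝ → Spc n → ℝ) : κ → ℝ → Spc n → ℝ := fun J t x =>
  ∑ p : Fin n × ι, c J p.1 p.2 * pd p.1 (u p.2 t) x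

theorem FOp_eqT (c : κ → Fin n → ι → ℝ) {u : ι → ℝ → Spc n → ℝ} {g : ι → Fin n → ℝ → Spc n → ℝ}
    (h : ∀ I, HasDx T (u I) (g I)) (J : κ) :
    EqT T (∑ p : Fin n × ι, c J p.1 p.2 • g p.2 p.1) (FOp c u J) := by
  intro t ht x
  simp only [Finset.sum_apply, Pi.smul_apply, smul_eq_mul, FOp]
  exact Finset.sum_congr rfl fun p _ => by rw [(h p.2).pd_eq ht x p.1]

theorem FOp_sub (c : κ → Fin n → ι → ℝ) {u v : ι → ℝ → Spc n → ℝ}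
    {g g' : ι → Fin n → ℝ → Spc n → ℝ}
    (h : ∀ I, HasDx T (u I) (g I)) (h' : ∀ I, HasDx T (v I) (g' I)) (J : κ) :
    EqT T (FOp c (u - v) J) (FOp c u J - FOp c v J) := by
  intro t ht x
  rw [Pi.sub_apply, Pi.sub_apply, ← FOp_eqT c h J t ht x, ← FOp_eqT c h' J t ht x,
    ← FOp_eqT c (u := u - v) (fun I => (h I).sub (h' I)) J t ht x]
  simp only [Finset.sum_apply, Pi.smul_apply, smul_eq_mul, Pi.sub_apply, mul_sub,
    Finset.sum_sub_distrib]

/-- Linear combinations of a finite family of regular functions are regular. -/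
theorem ParReg.linearCombination [Fintype κ] (a : κ → ι → ℝ) : ∃ A : ℝ, 0 ≤ A ∧ ∀ C, 0 ≤ C → ∀ s K : ℕ, ∀ σ,
    ∀ f : ι → ℝ → Spc n → ℝ, (∀ i, ParReg T (SupBd T C) s K σ (f i)) →
      ∀ j, ParReg T (SupBd T (A * C)) s K σ (∑ i, a j i • f i) := by
  refine ⟨Fintype.card ι * ∑ j, ∑ i, |a j i|, by positivity, fun C hC s K σ f hf j => ?_⟩
  have h1 : ∀ i ∈ Finset.univ,
      ParReg T (SupBd T ((∑ j, ∑ i, |a j i|) * C)) s K σ (a j i • f i) := fun i _ => by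
    refine ((hf i).smul (c := a j i) fun σ u h => SupBd.smul (a j i) h).supBd_mono ?_ le_rfl
    refine mul_le_mul_of_nonneg_right ?_ hC
    calc |a j i| ≤ ∑ i, |a j i| :=
          Finset.single_le_sum (f := fun i => |a j i|) (fun _ _ => abs_nonneg _) (Finset.mem_univ i)
      _ ≤ _ := Finset.single_le_sum (f := fun j => ∑ i, |a j i|)
          (fun _ _ => Finset.sum_nonneg fun _ _ => abs_nonneg _) (Finset.mem_univ j)
  have := ParReg.sum_supBd Finset.univ h1
  rwa [← mul_assoc, Finset.card_univ] at this

theorem FOp_parReg [Fintype κ] (c : κ → Fin n → ι → ℝ) : ∃ A : ℝ, 0 ≤ A ∧ ∀ C, 0 ≤ C → ∀ s K : ℕ, ∀ σ,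
    ∀ u : ι → ℝ → Spc n → ℝ, (∀ I, ParReg T (SupBd T C) s (K + 1) σ (u I)) →
      ∀ J, ParReg T (SupBd T (A * C)) s K (σ + 1) (FOp c u J) := by
  obtain ⟨A, hA, H⟩ := ParReg.linearCombination (n := n) (T := T)
    fun (J : κ) (p : Fin n × ι) => c J p.1 p.2
  refine ⟨A, hA, fun C hC s K σ u hu J => ?_⟩
  choose g hg using fun I => (hu I).exists_dx
  exact (H C hC s K (σ + 1) _ (fun p => (hu p.2).dx_supBd (hg p.2) p.1) J).congr
    (local_supBd T _) (FOp_eqT c hg J)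

theorem bilin_expand [Fintype κ] (L : (ι → ℝ) →ₗ[ℝ] (κ → ℝ) →ₗ[ℝ] (ρ → ℝ)) (a : ι → ℝ) (b : κ → ℝ) (r : ρ) :
    L a b r = ∑ p : ι × κ, L (fun j => if p.1 = j then 1 else 0)
      (fun j => if p.2 = j then 1 else 0) r * (a p.1 * b p.2) := by
  rw [LinearMap.pi_apply_eq_sum_univ L a, Fintype.sum_prod_type]
  simp only [LinearMap.coe_sum, Finset.sum_apply, LinearMap.smul_apply, Pi.smul_apply, smul_eq_mul]
  refine Finset.sum_congr rfl fun i _ => ?_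
  rw [LinearMap.pi_apply_eq_sum_univ (L fun j => if i = j then 1 else 0) b]
  simp only [Finset.sum_apply, Pi.smul_apply, smul_eq_mul, Finset.mul_sum]
  exact Finset.sum_congr rfl fun j _ => by ring

theorem bilin_parReg [Fintype κ] [Fintype ρ] (L : (ι → ℝ) →ₗ[ℝ] (κ → ℝ) →ₗ[ℝ] (ρ → ℝ)) (s K : ℕ) :
    ∃ A : ℝ, 0 ≤ A ∧ ∀ C C', 0 ≤ C → 0 ≤ C' → ∀ σ σ', ∀ a : ι → ℝ → Spc n → ℝ,
      ∀ b : κ → ℝ → Spc n → ℝ, (∀ i, ParReg T (SupBd T C) s K σ (a i)) →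
      (∀ j, ParReg T (SupBd T C') s K σ' (b j)) → ∀ r, ParReg T (SupBd T (A * (C * C'))) s K (σ + σ')
        fun t x => L (fun i => a i t x) (fun j => b j t x) r := by
  obtain ⟨A, hA, H⟩ := ParReg.linearCombination (n := n) (T := T) fun (r : ρ) (p : ι × κ) =>
    L (fun j => if p.1 = j then 1 else 0) (fun j => if p.2 = j then 1 else 0) r
  refine ⟨A * 2 ^ (K + 2 * s + s), by positivity, fun C C' hC hC' σ σ' a b ha hb r => ?_⟩
  have := H (2 ^ (K + 2 * s + s) * (C * C')) (by positivity) s K (σ + σ')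
    (fun p => a p.1 * b p.2) (fun p => (ha p.1).mul_supBd hC hC' (hb p.2)) r
  rw [← mul_assoc] at this
  refine this.congr (local_supBd T _) fun t _ x => ?_
  rw [bilin_expand]
  simp only [Finset.sum_apply, Pi.smul_apply, Pi.mul_apply, smul_eq_mul]

theorem FOp_tendsto [Fintype κ] (c : κ → Fin n → ι → ℝ) {s K : ℕ} {τ : ℝ}
    {u : ℕ → ι → ℝ → Spc n → ℝ} {v : ι → ℝ → Spc n → ℝ} {g : ℕ → ι → Fin n → ℝ → Spc n → ℝ}
    {g' : ι → Fin n → ℝ → Spc n → ℝ}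
    (h : ∀ m I, HasDx T (u m I) (g m I)) (h' : ∀ I, HasDx T (v I) (g' I))
    (hu : ∀ I, ParTendsto T s (K + 1) τ (fun m => u m I) (v I)) (J : κ) :
    ParTendsto T s K (τ + 1) (fun m => FOp c (u m) J) (FOp c v J) := by
  intro ε hε
  obtain ⟨A, hA, H⟩ := FOp_parReg (n := n) (T := T) c
  have hev : ∀ᶠ m in atTop, ∀ I, ParReg T (SupBd T (ε / (A + 1))) s (K + 1) τ (u m I - v I) :=
    eventually_all.2 fun I => hu I _ (by positivity)
  filter_upwards [hev] with m hm
  have := (H _ (by positivity) s K τ (u m - v) hm J).congr (local_supBd T _)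
    (FOp_sub c (h m) h' J)
  refine this.supBd_mono ?_ le_rfl
  rw [mul_div_assoc', div_le_iff₀ (by positivity)]
  nlinarith

end firstOrder

section potentialLinear

variable {T μ : ℝ} {ι κ : Type*} [Fintype ι]

theorem volPot_congr (μ : ℝ) {f g : ℝ → Spc n → ℝ} (h : EqT T f g) :
    EqT T (volPot μ f) (volPot μ g) := by
  intro t ht x
  refine setIntegral_congr_fun measurableSet_Ioc fun τ hτ => ?_
  have : f τ = g τ := funext fun y => h τ ⟨hτ.1.le, hτ.2.trans ht.2⟩ y
  simp only [this]

theorem volPot_linearCombination (hμ : 0 < μ) {C : ℝ} (hC : 0 ≤ C) (a : ι → ℝ)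
    {f : ι → ℝ → Spc n → ℝ} (hf : ∀ i, SupBd T C 0 (f i)) :
    EqT T (volPot μ (∑ i, a i • f i)) (∑ i, a i • volPot μ (f i)) := by
  intro t ht x
  obtain ⟨K, hK, hg, -⟩ := gaussBd_gam (n := n)
  simp only [Finset.sum_apply, Pi.smul_apply, smul_eq_mul, volPot_eq hμ _ ht.1, profPot]
  simp_rw [← intervalIntegral.integral_const_mul]
  rw [← intervalIntegral.integral_finsetSum fun i _ => (profPot_intervalIntegrable (singWt_one T)
    (Real.sqrt_nonneg T) hg hK le_rfl hC (hf i) ht x).const_mul (a i)]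
  refine intervalIntegral.integral_congr fun τ hτ => ?_
  rw [Set.uIcc_of_le ht.1] at hτ
  have hτ' : τ ∈ Set.Icc 0 T := ⟨hτ.1, hτ.2.trans ht.2⟩
  simp only [one_mul, avg, Finset.sum_apply, Pi.smul_apply, smul_eq_mul]
  simp_rw [← integral_const_mul]
  rw [← integral_finsetSum]
  · simp only [Finset.mul_sum]
    exact integral_congr_ae (Eventually.of_forall fun z => Finset.sum_congr rfl fun i _ => by ring)
  · intro i _
    refine (integrable_avg (C := C) hg hK ((hf i).cont.space hτ') (fun y => ?_) _ x).const_mul (a i)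
    simpa using (hf i).sup τ hτ' y

theorem volPot_sub (hμ : 0 < μ) {C : ℝ} (hC : 0 ≤ C) {f g : ℝ → Spc n → ℝ}
    (hf : SupBd T C 0 f) (hg : SupBd T C 0 g) :
    EqT T (volPot μ (f - g)) (volPot μ f - volPot μ g) := by
  have := volPot_linearCombination (T := T) hμ hC (fun b : Bool => if b then 1 else -1)
    (f := fun b => if b then f else g) (by simp [hf, hg])
  simpa [sub_eq_add_neg] using this

theorem hasDx_volPot (hμ : 0 < μ) {C : ℝ} (hC : 0 ≤ C) {f : ℝ → Spc n → ℝ}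
    {f' : Fin n → ℝ → Spc n → ℝ} (hf : SupBd T C 0 f) (hd : HasDx T f f')
    (hf' : ∀ i, SupBd T C 0 (f' i)) :
    HasDx T (volPot μ f) fun i => volPot μ (f' i) := by
  obtain ⟨K, hK, hg, -⟩ := gaussBd_gam (n := n)
  have h1 := hasDx_profPot (μ := μ) (singWt_one T) (Real.sqrt_nonneg T) hg hK hC hf hd hf'
  intro t ht x
  have e : ∀ g : ℝ → Spc n → ℝ, volPot μ g t = profPot μ gam (fun _ => 1) g t :=
    fun g => funext fun y => volPot_eq hμ g ht.1 y
  simp only [e]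
  exact h1 t ht x

theorem FOp_volPot (hμ : 0 < μ) {C : ℝ} (hC : 0 ≤ C) (c : κ → Fin n → ι → ℝ)
    {f : ι → ℝ → Spc n → ℝ} {f' : ι → Fin n → ℝ → Spc n → ℝ} (hf : ∀ I, SupBd T C 0 (f I))
    (hd : ∀ I, HasDx T (f I) (f' I)) (hf' : ∀ I i, SupBd T C 0 (f' I i)) (J : κ) :
    EqT T (volPot μ (FOp c f J)) (FOp c (fun I => volPot μ (f I)) J) := by
  intro t ht x
  rw [← volPot_congr μ (FOp_eqT c hd J) t ht x,
    ← FOp_eqT c (fun I => hasDx_volPot hμ hC (hf I) (hd I) (hf' I)) J t ht x,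
    volPot_linearCombination hμ hC _ (fun p : Fin n × ι => hf' p.2 p.1) t ht x]

end potentialLinear

section families

variable {T : ℝ} {ι κ ρ : Type*} {s K : ℕ} {σ τ : ℝ}

/-- A family of functions with uniformly bounded weighted derivatives. -/
def FBdd (T : ℝ) (s K : ℕ) (σ : ℝ) (u : ι → ℝ → Spc n → ℝ) : Prop :=
  ∃ C, 0 ≤ C ∧ ∀ I, ParReg T (SupBd T C) s K σ (u I)

theorem FBdd.mono {u : ι → ℝ → Spc n → ℝ} (h : FBdd T s K σ u) {L : ℕ} (hL : L ≤ K) (hτ : τ ≤ σ) :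
    FBdd T s L τ u := by
  obtain ⟨C, hC, h⟩ := h
  exact ⟨C, hC, fun I => ((h I).mono_order hL).supBd_mono le_rfl hτ⟩

theorem FBdd.add {u v : ι → ℝ → Spc n → ℝ} (h : FBdd T s K σ u) (h' : FBdd T s K σ v) :
    FBdd T s K σ (u + v) := by
  obtain ⟨C, hC, h⟩ := h
  obtain ⟨C', hC', h'⟩ := h'
  exact ⟨C + C', by positivity, fun I => ParReg.add (R := SupBd T (C + C')) (fun _ _ _ => SupBd.add)
    (h I) (h' I)⟩

theorem FBdd.congr {u v : ι → ℝ → Spc n → ℝ} (h : FBdd T s K σ u) (huv : ∀ I, EqT T (u I) (v I)) :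
    FBdd T s K σ v := by
  obtain ⟨C, hC, h⟩ := h
  exact ⟨C, hC, fun I => (h I).congr (local_supBd T C) (huv I)⟩

theorem FBdd.fop [Fintype ι] [Fintype κ] (c : κ → Fin n → ι → ℝ) {u : ι → ℝ → Spc n → ℝ}
    (h : FBdd T s (K + 1) σ u) : FBdd T s K (σ + 1) (FOp c u) := by
  obtain ⟨C, hC, h⟩ := h
  obtain ⟨A, hA, H⟩ := FOp_parReg (n := n) (T := T) c
  exact ⟨A * C, by positivity, H C hC s K σ u h⟩

theorem FBdd.bilin [Fintype ι] [Fintype κ] [Fintype ρ] (L : (ι → ℝ) →ₗ[ℝ] (κ → ℝ) →ₗ[ℝ] (ρ → ℝ))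
    {a : ι → ℝ → Spc n → ℝ} {b : κ → ℝ → Spc n → ℝ} (ha : FBdd T s K σ a) (hb : FBdd T s K τ b) :
    FBdd T s K (σ + τ) fun r t x => L (fun i => a i t x) (fun j => b j t x) r := by
  obtain ⟨C, hC, ha⟩ := ha
  obtain ⟨C', hC', hb⟩ := hb
  obtain ⟨A, hA, H⟩ := bilin_parReg (n := n) (T := T) L s K
  exact ⟨A * (C * C'), by positivity, H C C' hC hC' σ τ a b ha hb⟩

theorem ParTendsto.mono {u : ℕ → ℝ → Spc n → ℝ} {v : ℝ → Spc n → ℝ} (h : ParTendsto T s K σ u v)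
    {L : ℕ} (hL : L ≤ K) (hτ : τ ≤ σ) : ParTendsto T s L τ u v := fun ε hε =>
  (h ε hε).mono fun _ hm => (hm.mono_order hL).supBd_mono le_rfl hτ

theorem ParTendsto.congr {u : ℕ → ℝ → Spc n → ℝ} {v w : ℝ → Spc n → ℝ} (h : ParTendsto T s K σ u v)
    (hvw : EqT T v w) : ParTendsto T s K σ u w := fun ε hε =>
  (h ε hε).mono fun m hm => hm.congr (local_supBd T ε) fun t ht x => by
    simp only [Pi.sub_apply, hvw t ht x]

theorem ParTendsto.add {u u' : ℕ → ℝ → Spc n → ℝ} {v v' : ℝ → Spc n → ℝ}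
    (h : ParTendsto T s K σ u v) (h' : ParTendsto T s K σ u' v') :
    ParTendsto T s K σ (fun m => u m + u' m) (v + v') := by
  intro ε hε
  filter_upwards [h (ε / 2) (half_pos hε), h' (ε / 2) (half_pos hε)] with m hm hm'
  have := ParReg.add (R := SupBd T (ε / 2 + ε / 2)) (fun _ _ _ => SupBd.add) hm hm'
  rw [add_halves] at this
  rwa [add_sub_add_comm]

theorem ParTendsto.bilin [Fintype ι] [Fintype κ] [Fintype ρ]
    (L : (ι → ℝ) →ₗ[ℝ] (κ → ℝ) →ₗ[ℝ] (ρ → ℝ)) {a : ℕ → ι → ℝ → Spc n → ℝ} {a' : ι → ℝ → Spc n → ℝ}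
    {b : κ → ℝ → Spc n → ℝ} (ha : ∀ I, ParTendsto T s K σ (fun m => a m I) (a' I))
    (hb : FBdd T s K τ b) (r : ρ) :
    ParTendsto T s K (σ + τ) (fun m t x => L (fun i => a m i t x) (fun j => b j t x) r)
      fun t x => L (fun i => a' i t x) (fun j => b j t x) r := by
  intro ε hε
  obtain ⟨C, hC, hb⟩ := hb
  obtain ⟨A, hA, H⟩ := bilin_parReg (n := n) (T := T) L s K
  have hev : ∀ᶠ m in atTop, ∀ I, ParReg T (SupBd T (ε / (A * C + 1))) s K σ (a m I - a' I) :=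
    eventually_all.2 fun I => ha I _ (by positivity)
  filter_upwards [hev] with m hm
  have := H _ C (by positivity) hC σ τ (a m - a') b hm hb r
  refine (this.congr (local_supBd T _) fun t ht x => ?_).supBd_mono ?_ le_rfl
  · have e : (fun i => (a m - a') i t x) = (fun i => a m i t x) - fun i => a' i t x := rfl
    rw [e, map_sub]
    rfl
  · rw [show A * (ε / (A * C + 1) * C) = (A * C) * ε / (A * C + 1) by ring,
      div_le_iff₀ (by positivity)]
    nlinarith

end families

section formOperators

variable {q : ℕ}

theorem dT_eq_FOp : ∃ c : Idx n (q + 1) → Fin n → Idx n q → ℝ, ∀ u : FormT n q, dT u = FOp c u := by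
  refine ⟨fun J i I => if h : i ∈ J.1 then
    (if I = ⟨J.1.erase i, by simp [Finset.card_erase_of_mem h, J.2]⟩ then
      (-1 : ℝ) ^ (J.1.filter fun j => j < i).card else 0) else 0, fun u => ?_⟩
  ext J t x
  simp only [dT, dS, FOp, Fintype.sum_prod_type]
  refine Finset.sum_congr rfl fun i _ => ?_
  by_cases h : i ∈ J.1
  · rw [dif_pos h, Finset.sum_eq_single
      ⟨J.1.erase i, by simp [Finset.card_erase_of_mem h, J.2]⟩] <;> simp +contextual [h]
  · simp only [dif_neg h, zero_mul, Finset.sum_const_zero]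

theorem dLowT_eq_FOp :
    ∃ c : Idx n q → Fin n → Idx n (q - 1) → ℝ, ∀ p : FormT n (q - 1), dLowT p = FOp c p := by
  refine ⟨fun J i I => if h : i ∈ J.1 ∧ (J.1.erase i).card = q - 1 then
    (if I = ⟨J.1.erase i, h.2⟩ then
      (-1 : ℝ) ^ (J.1.filter fun j => j < i).card else 0) else 0, fun u => ?_⟩
  ext J t x
  simp only [dLowT, dLowS, FOp, Fintype.sum_prod_type]
  refine Finset.sum_congr rfl fun i _ => ?_
  by_cases h : i ∈ J.1 ∧ (J.1.erase i).card = q - 1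
  · rw [dif_pos h, Finset.sum_eq_single ⟨J.1.erase i, h.2⟩] <;> simp +contextual [h]
  · simp only [dif_neg h, zero_mul, Finset.sum_const_zero]

theorem coDT_eq_FOp :
    ∃ c : Idx n (q - 1) → Fin n → Idx n q → ℝ, ∀ u : FormT n q, coDT u = FOp c u := by
  refine ⟨fun J i I => if h : i ∉ J.1 ∧ (insert i J.1).card = q then
    (if I = ⟨insert i J.1, h.2⟩ then
      -(-1 : ℝ) ^ (J.1.filter fun j => j < i).card else 0) else 0, fun u => ?_⟩
  ext J t x
  simp only [coDT, coDS, FOp, Fintype.sum_prod_type, ← Finset.sum_neg_distrib]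
  refine Finset.sum_congr rfl fun i _ => ?_
  by_cases h : i ∉ J.1 ∧ (insert i J.1).card = q
  · rw [dif_pos h, Finset.sum_eq_single ⟨insert i J.1, h.2⟩] <;> simp +contextual [h]
  · simp only [dif_neg h, zero_mul, Finset.sum_const_zero, neg_zero]

variable {T : ℝ} {s K : ℕ} {σ τ : ℝ} {w : FormT n q}

theorem Wop_eq (M₁ : M1Type n q) (w u : FormT n q) :
    Wop M₁ w u = (((fun r t x => M₁.comp (LinearMap.inl ℝ _ _) (fun i => dT u i t x)
      (fun j => w j t x) r) + fun r t x => M₁.comp (LinearMap.inr ℝ _ _) (fun i => coDT u i t x)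
      (fun j => w j t x) r) + ((fun r t x => (M₁.comp (LinearMap.inl ℝ _ _)).flip
      (fun i => u i t x) (fun j => dT w j t x) r) + fun r t x =>
      (M₁.comp (LinearMap.inr ℝ _ _)).flip (fun i => u i t x) (fun j => coDT w j t x) r)) := by
  have e : ∀ (a : Fib n (q + 1)) (c : Fib n (q - 1)) (b : Fib n q) (r : Idx n q),
      M₁ (a, c) b r = M₁ (a, 0) b r + M₁ (0, c) b r := fun a c b r => by
    rw [← Pi.add_apply, ← LinearMap.add_apply, ← map_add, Prod.mk_add_mk, add_zero, zero_add]
  ext r t x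
  simp only [Pi.add_apply, LinearMap.flip_apply, LinearMap.comp_apply, LinearMap.inl_apply,
    LinearMap.inr_apply]
  rw [← e, ← e]
  rfl

theorem FBdd.wop (M₁ : M1Type n q) (hw : FBdd T s K σ w) (hw1 : FBdd T s K (σ + 1) (dT w))
    (hw2 : FBdd T s K (σ + 1) (coDT w)) {u : FormT n q} (hu : FBdd T s K τ u)
    (hu1 : FBdd T s K (τ + 1) (dT u)) (hu2 : FBdd T s K (τ + 1) (coDT u)) :
    FBdd T s K (σ + τ + 1) (Wop M₁ w u) := by
  rw [Wop_eq]
  have e1 : σ + τ + 1 = τ + 1 + σ := by ring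
  have e2 : σ + τ + 1 = τ + (σ + 1) := by ring
  refine FBdd.add (FBdd.add ?_ ?_) (FBdd.add ?_ ?_)
  · rw [e1]; exact hu1.bilin _ hw
  · rw [e1]; exact hu2.bilin _ hw
  · rw [e2]; exact hu.bilin _ hw1
  · rw [e2]; exact hu.bilin _ hw2

theorem Wop_tendsto (M₁ : M1Type n q) (hw : FBdd T s K σ w) (hw1 : FBdd T s K (σ + 1) (dT w))
    (hw2 : FBdd T s K (σ + 1) (coDT w)) {u : ℕ → FormT n q} {v : FormT n q}
    (hu : ∀ I, ParTendsto T s K τ (fun m => u m I) (v I))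
    (hu1 : ∀ I, ParTendsto T s K (τ + 1) (fun m => dT (u m) I) (dT v I))
    (hu2 : ∀ I, ParTendsto T s K (τ + 1) (fun m => coDT (u m) I) (coDT v I)) (I : Idx n q) :
    ParTendsto T s K (σ + τ + 1) (fun m => Wop M₁ w (u m) I) (Wop M₁ w v I) := by
  simp only [Wop_eq]
  have e1 : σ + τ + 1 = τ + 1 + σ := by ring
  have e2 : σ + τ + 1 = τ + (σ + 1) := by ring
  refine ParTendsto.add (ParTendsto.add ?_ ?_) (ParTendsto.add ?_ ?_)
  · rw [e1]; exact ParTendsto.bilin _ hu1 hw I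
  · rw [e1]; exact ParTendsto.bilin _ hu2 hw I
  · rw [e2]; exact ParTendsto.bilin _ hu hw1 I
  · rw [e2]; exact ParTendsto.bilin _ hu hw2 I

theorem FBdd.dT {u : FormT n q} (hu : FBdd T s (K + 1) σ u) : FBdd T s K (σ + 1) (dT u) := by
  obtain ⟨c, hc⟩ := dT_eq_FOp (n := n) (q := q)
  rw [hc]; exact hu.fop c

theorem FBdd.coDT {u : FormT n q} (hu : FBdd T s (K + 1) σ u) : FBdd T s K (σ + 1) (coDT u) := by
  obtain ⟨c, hc⟩ := coDT_eq_FOp (n := n) (q := q)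
  rw [hc]; exact hu.fop c

theorem FBdd.exists_dx {ι : Type*} {u : ι → ℝ → Spc n → ℝ} (hu : FBdd T s (K + 1) σ u) :
    ∃ g : ι → Fin n → ℝ → Spc n → ℝ, ∀ I, HasDx T (u I) (g I) := by
  obtain ⟨C, _, hu⟩ := hu
  choose g hg using fun I => (hu I).exists_dx
  exact ⟨g, hg⟩

theorem FOp_tendsto_of_fBdd {ι κ : Type*} [Fintype ι] [Fintype κ] (c : κ → Fin n → ι → ℝ)
    {u : ℕ → ι → ℝ → Spc n → ℝ} {v : ι → ℝ → Spc n → ℝ} (hu : ∀ m, FBdd T s (K + 1) σ (u m))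
    (hv : FBdd T s (K + 1) σ v) (h : ∀ I, ParTendsto T s (K + 1) τ (fun m => u m I) (v I)) (J : κ) :
    ParTendsto T s K (τ + 1) (fun m => FOp c (u m) J) (FOp c v J) := by
  choose g hg using fun m => (hu m).exists_dx
  obtain ⟨g', hg'⟩ := hv.exists_dx
  exact FOp_tendsto c hg hg' h J

/-- The zero order part of the potential term of `Bop`. -/
def symM2 (M₂ : M2Type n q) (w u : FormT n q) : FormT n (q - 1) := fun r t x =>
  M₂ (fib u t x) (fib w t x) r + M₂ (fib w t x) (fib u t x) r

theorem FBdd.symM2 (M₂ : M2Type n q) (hw : FBdd T s K σ w) {u : FormT n q} (hu : FBdd T s K τ u) :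
    FBdd T s K (σ + τ) (symM2 M₂ w u) := by
  have h := (hu.bilin M₂ hw).add (hu.bilin M₂.flip hw)
  rwa [add_comm τ σ] at h

theorem symM2_tendsto (M₂ : M2Type n q) (hw : FBdd T s K σ w) {u : ℕ → FormT n q} {v : FormT n q}
    (hu : ∀ I, ParTendsto T s K τ (fun m => u m I) (v I)) (r : Idx n (q - 1)) :
    ParTendsto T s K (σ + τ) (fun m => NSdeRham.symM2 M₂ w (u m) r) (NSdeRham.symM2 M₂ w v r) := by
  have h := (ParTendsto.bilin M₂ hu hw r).add (ParTendsto.bilin M₂.flip hu hw r)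
  rwa [add_comm τ σ] at h

theorem Bop_eq (M₁ : M1Type n q) (M₂ : M2Type n q) (w u : FormT n q) :
    Bop M₁ M₂ w u = Wop M₁ w u + dLowT (NSdeRham.symM2 M₂ w u) := rfl

theorem FBdd.bop (M₁ : M1Type n q) (M₂ : M2Type n q) (hw : FBdd T s (K + 1) σ w) {u : FormT n q}
    (hu : FBdd T s (K + 1) τ u) : FBdd T s K (σ + τ + 1) (Bop M₁ M₂ w u) := by
  obtain ⟨c, hc⟩ := dLowT_eq_FOp (n := n) (q := q)
  rw [Bop_eq, hc]
  exact (FBdd.wop M₁ (hw.mono K.le_succ le_rfl) hw.dT hw.coDT (hu.mono K.le_succ le_rfl)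
    hu.dT hu.coDT).add ((hw.symM2 M₂ hu).fop c)

theorem Bop_tendsto (M₁ : M1Type n q) (M₂ : M2Type n q) (hw : FBdd T s (K + 1) σ w)
    {u : ℕ → FormT n q} {v : FormT n q} (hu : ∀ m, FBdd T s (K + 1) τ (u m))
    (hv : FBdd T s (K + 1) τ v) (h : ∀ I, ParTendsto T s (K + 1) τ (fun m => u m I) (v I))
    (I : Idx n q) :
    ParTendsto T s K (σ + τ + 1) (fun m => Bop M₁ M₂ w (u m) I) (Bop M₁ M₂ w v I) := by
  obtain ⟨c, hc⟩ := dLowT_eq_FOp (n := n) (q := q)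
  obtain ⟨c₁, hc₁⟩ := dT_eq_FOp (n := n) (q := q)
  obtain ⟨c₂, hc₂⟩ := coDT_eq_FOp (n := n) (q := q)
  simp only [Bop_eq, hc]
  refine ParTendsto.add ?_ ?_
  · refine Wop_tendsto M₁ (hw.mono K.le_succ le_rfl) hw.dT hw.coDT
      (fun I => (h I).mono K.le_succ le_rfl) (fun J => ?_) (fun J => ?_) I
    · simp only [hc₁]; exact FOp_tendsto_of_fBdd c₁ hu hv h J
    · simp only [hc₂]; exact FOp_tendsto_of_fBdd c₂ hu hv h J
  · exact FOp_tendsto_of_fBdd c (fun m => hw.symM2 M₂ (hu m)) (hw.symM2 M₂ hv)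
      (symM2_tendsto M₂ hw h) I

end formOperators

section compactness

variable {T lam lam' μ σ : ℝ} {q s k : ℕ}

theorem eFF_volPot_le (hT : 0 < T) (hμ : 0 < μ) (hl : 0 < lam) (hl1 : lam < 1) (hl' : 0 < lam')
    (hl1' : lam' < 1) (hk : 1 ≤ k) (s : ℕ) (hσ : 0 ≤ σ) :
    ∃ A : ℝ, 0 ≤ A ∧ ∀ C, 0 ≤ C → ∀ f : FormT n q,
      (∀ I, ParReg T (SupBd T C) s k (σ + 2) (f I)) → ∀ g : FormT n q,
      (∀ I, EqT T (volPot μ (f I)) (g I)) →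
      (∀ I, AnisoReg T (k + 1) s (g I)) ∧ eFF T k s lam lam' σ g ≤ ENNReal.ofReal (A * C) := by
  obtain ⟨k, rfl⟩ := Nat.exists_eq_add_of_le' hk
  obtain ⟨K, hK, H⟩ := parReg_heatPot (n := n) hT.le hμ hl hl1 s k hσ
  obtain ⟨K', hK', H'⟩ := parReg_heatPot (n := n) hT.le hμ hl' hl1' s k hσ
  obtain ⟨A, hA, HA⟩ := ParReg.aniso (n := n) hT lam hσ s (k + 2)
  obtain ⟨A', hA', HA'⟩ := ParReg.aniso (n := n) hT lam' hσ s (k + 1)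
  refine ⟨Fintype.card (Idx n q) * (A * K + A' * K'), by positivity, fun C hC f hf g hg => ?_⟩
  have e : ∀ I, EqT T (heatPot μ (f I)) (g I) := fun I t ht x => by
    rw [← hg I t ht x, volPot_eq hμ _ ht.1]; rfl
  have h1 := fun I => HA _ _ ((H C hC _ (hf I)).congr (local_holBd T _ _) (e I))
  have h2 := fun I => HA' _ _ (((H' C hC _ (hf I)).congr (local_holBd T _ _) (e I)).mono_order
    (Nat.le_succ (k + 1)))
  refine ⟨fun I => (h1 I).1, ?_⟩
  calc eFF T (k + 1) s lam lam' σ g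
      ≤ ∑ _I : Idx n q, ENNReal.ofReal ((A * K + A' * K') * C) := by
        refine Finset.sum_le_sum fun I _ => (add_le_add (h1 I).2 (h2 I).2).trans ?_
        rw [← ENNReal.ofReal_add (by positivity) (by positivity)]
        exact ENNReal.ofReal_le_ofReal (by linarith)
    _ ≤ _ := by
        rw [Finset.sum_const, Finset.card_univ, ← ENNReal.ofReal_nsmul, nsmul_eq_mul, mul_assoc]

theorem fMemF_volPot (hT : 0 < T) (hμ : 0 < μ) (hl : 0 < lam) (hl1 : lam < 1) (hl' : 0 < lam')
    (hl1' : lam' < 1) (hk : 1 ≤ k) (hσ : 0 ≤ σ) {f g : FormT n q} (hf : FBdd T s k (σ + 2) f)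
    (hg : ∀ I, EqT T (volPot μ (f I)) (g I)) : FMemF T k s lam lam' σ g := by
  obtain ⟨A, -, H⟩ := eFF_volPot_le (n := n) (q := q) hT hμ hl hl1 hl' hl1' hk s hσ
  obtain ⟨C, hC, hf⟩ := hf
  obtain ⟨h1, h2⟩ := H C hC f hf g hg
  exact ⟨h1, (h2.trans_lt ENNReal.ofReal_lt_top).ne⟩

theorem eFF_volPot_tendsto (hT : 0 < T) (hμ : 0 < μ) (hl : 0 < lam) (hl1 : lam < 1) (hl' : 0 < lam')
    (hl1' : lam' < 1) (hk : 1 ≤ k) (hσ : 0 ≤ σ) {f : ℕ → FormT n q} {f₀ : FormT n q}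
    {g : ℕ → FormT n q} (hf : ∀ m, FBdd T s k (σ + 2) (f m)) (hf₀ : FBdd T s k (σ + 2) f₀)
    (hlim : ∀ I, ParTendsto T s k (σ + 2) (fun m => f m I) (f₀ I))
    (hg : ∀ m I, EqT T (volPot μ (f m I) - volPot μ (f₀ I)) (g m I)) :
    Tendsto (fun m => eFF T k s lam lam' σ (g m)) atTop (nhds 0) := by
  obtain ⟨A, hA, H⟩ := eFF_volPot_le (n := n) (q := q) hT hμ hl hl1 hl' hl1' hk s hσ
  refine ENNReal.tendsto_nhds_zero.2 fun ε hε => ?_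
  obtain ⟨r, hr, hrε⟩ := ENNReal.lt_iff_exists_nnreal_btwn.1 hε
  have hr' : (0 : ℝ) < r := by exact_mod_cast hr
  have hev : ∀ᶠ m in atTop, ∀ I, ParReg T (SupBd T (r / (A + 1))) s k (σ + 2) (f m I - f₀ I) :=
    eventually_all.2 fun I => hlim I _ (by positivity)
  filter_upwards [hev] with m hm
  obtain ⟨C, hC, h1⟩ := hf m
  obtain ⟨C', hC', h2⟩ := hf₀
  have h3 := (H _ (by positivity) (f m - f₀) hm (g m) fun I t ht x => by
    rw [← hg m I t ht x]
    exact volPot_sub hμ (le_max_of_le_left hC : 0 ≤ max C C')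
      ((h1 I).base.mono (le_max_left _ _) (by linarith))
      ((h2 I).base.mono (le_max_right _ _) (by linarith)) t ht x).2
  refine (h3.trans ?_).trans hrε.le
  rw [← ENNReal.ofReal_coe_nnreal]
  refine ENNReal.ofReal_le_ofReal ?_
  rw [mul_div_assoc', div_le_iff₀ (by positivity)]
  nlinarith

theorem FMemF.parReg (hT : 0 < T) (hl : 0 < lam) {δ : ℝ} {u : FormT n q}
    (h : FMemF T k s lam lam' δ u) {C : ℝ≥0∞} (hC : C ≠ ⊤) (hu : eFF T k s lam lam' δ u ≤ C)
    (I : Idx n q) : ParReg T (HolBd T lam C.toReal) s (k + 1) δ (u I) := by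
  refine (h.1 I).parReg hT hl.ne' ENNReal.toReal_nonneg ?_
  rw [ENNReal.ofReal_toReal hC]
  refine le_trans (le_trans ?_ (Finset.single_le_sum (f := fun I => eFn T k s lam lam' δ (u I))
    (fun _ _ => zero_le) (Finset.mem_univ I))) hu
  exact le_self_add

theorem FMemF.fBdd (hT : 0 < T) (hl : 0 < lam) {δ : ℝ} {u : FormT n q}
    (h : FMemF T k s lam lam' δ u) : FBdd T s (k + 1) δ u :=
  ⟨_, ENNReal.toReal_nonneg, fun I => ParReg.imp (a := 0) (σ₀ := δ)
    (Q := SupBd T (eFF T k s lam lam' δ u).toReal) (fun σ v _ hv => by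
      rw [add_zero]; exact hv.supBd) le_rfl (h.parReg hT hl h.2 le_rfl I) |> fun h => by
      rwa [add_zero] at h⟩

/-- Bounded sequences of families are relatively compact in a weaker norm. -/
theorem exists_family_subseq {ι : Type*} [Fintype ι] (hT : 0 ≤ T) (hl : 0 < lam) (hl1 : lam ≤ 1)
    {δ τ C : ℝ} (hτ : 0 ≤ τ) (hτδ : τ < δ) (hC : 0 ≤ C) {K : ℕ} {u : ℕ → ι → ℝ → Spc n → ℝ}
    (h : ∀ m I, ParReg T (HolBd T lam C) s K δ (u m I)) :
    ∃ φ : ℕ → ℕ, StrictMono φ ∧ ∃ v : ι → ℝ → Spc n → ℝ, FBdd T s K δ v ∧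
      ∀ I, ParTendsto T s K τ (fun m => u (φ m) I) (v I) := by
  obtain ⟨φ, hφ, H⟩ := exists_common_subseq (Finset.univ : Finset ι)
    (Q := fun I φ => ∃ v, ParReg T (SupBd T C) s K δ v ∧ ParTendsto T s K τ (fun m => u (φ m) I) v)
    (fun I φ ψ hψ ⟨v, hv, hv'⟩ => ⟨v, hv, hv'.comp hψ⟩) fun I φ _ => by
      obtain ⟨ψ, hψ, v, hv, hv'⟩ := ParReg.exists_subseq hT hl hl1 (η := δ - τ) (by linarith)
        (by linarith) fun m => h (φ m) I
      rw [sub_sub_cancel] at hv'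
      exact ⟨ψ, hψ, v, hv, hv'⟩
  choose v hv hv' using fun I => H I (Finset.mem_univ I)
  exact ⟨φ, hφ, v, ⟨C, hC, hv⟩, hv'⟩

/-- The limit of a first order operator applied to a convergent sequence. -/
theorem FOp_limit_eqT {ι κ : Type*} [Fintype ι] [Fintype κ] (c : κ → Fin n → ι → ℝ) {K : ℕ}
    {τ τ' δ : ℝ} (hτ : 0 ≤ τ) (hτ' : 0 ≤ τ') {u : ℕ → ι → ℝ → Spc n → ℝ} {v : ι → ℝ → Spc n → ℝ}
    {a : κ → ℝ → Spc n → ℝ} (hu : ∀ m, FBdd T s (K + 1) δ (u m)) (hv : FBdd T s (K + 1) δ v)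
    (h : ∀ I, ParTendsto T s (K + 1) τ (fun m => u m I) (v I)) (J : κ)
    (ha : ParTendsto T s (K + 1) τ' (fun m => FOp c (u m) J) (a J)) :
    EqT T (a J) (FOp c v J) := fun t ht x =>
  tendsto_nhds_unique (ha.tendsto hτ' ht x)
    ((FOp_tendsto_of_fBdd c hu hv h J).tendsto (by linarith) ht x)

theorem FOp_volPot_of_fBdd {ι κ : Type*} [Fintype ι] [Fintype κ] (hμ : 0 < μ)
    (c : κ → Fin n → ι → ℝ) {K : ℕ} (hσ : 0 ≤ σ) {f : ι → ℝ → Spc n → ℝ}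
    (hf : FBdd T s (K + 1) σ f) (J : κ) :
    EqT T (volPot μ (FOp c f J)) (FOp c (fun I => volPot μ (f I)) J) := by
  obtain ⟨C, hC, hf⟩ := hf
  choose g hg using fun I => (hf I).exists_dx
  exact FOp_volPot hμ hC c (fun I => (hf I).base.mono le_rfl hσ) hg
    (fun I i => ((hf I).dx_supBd (hg I) i).base.mono le_rfl (by linarith)) J

theorem FOp_volPot_sub {ι κ : Type*} [Fintype ι] [Fintype κ] (hμ : 0 < μ)
    (c : κ → Fin n → ι → ℝ) {K : ℕ} (hσ : 0 ≤ σ) {f f₀ : ι → ℝ → Spc n → ℝ}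
    (hf : FBdd T s (K + 1) σ f) (hf₀ : FBdd T s (K + 1) σ f₀) (J : κ) :
    EqT T (volPot μ (FOp c f J) - volPot μ (FOp c f₀ J))
      (FOp c ((fun I => volPot μ (f I)) - fun I => volPot μ (f₀ I)) J) := by
  intro t ht x
  have key : ∀ {f : ι → ℝ → Spc n → ℝ}, FBdd T s (K + 1) σ f →
      ∃ g : ι → Fin n → ℝ → Spc n → ℝ, ∀ I, HasDx T (volPot μ (f I)) (g I) := by
    rintro f ⟨C, hC, hf⟩
    choose g hg using fun I => (hf I).exists_dx
    exact ⟨_, fun I => hasDx_volPot hμ hC ((hf I).base.mono le_rfl hσ) (hg I)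
      fun i => ((hf I).dx_supBd (hg I) i).base.mono le_rfl (by linarith)⟩
  obtain ⟨g, hg⟩ := key hf
  obtain ⟨g₀, hg₀⟩ := key hf₀
  rw [FOp_sub c hg hg₀ J t ht x]
  simp only [Pi.sub_apply]
  rw [FOp_volPot_of_fBdd hμ c hσ hf J t ht x, FOp_volPot_of_fBdd hμ c hσ hf₀ J t ht x]

theorem compact_volPot_Bop (hk : 1 ≤ k) {δ : ℝ} (h1 : 0 < lam) (h2 : lam < lam') (h3 : lam' < 1)
    (hδ : 1 < δ) (hμ : 0 < μ) (hT : 0 < T) (M₁ : M1Type n q) (M₂ : M2Type n q) {w : FormT n q}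
    (hw : FMemF T k s lam lam' δ w) (u : ℕ → FormT n q) {C : ℝ≥0∞} (hC : C ≠ ⊤)
    (hu : ∀ m, FMemF T k s lam lam' δ (u m) ∧ eFF T k s lam lam' δ (u m) ≤ C) :
    ∃ φ : ℕ → ℕ, StrictMono φ ∧ ∃ v : FormT n q, FMemF T k s lam lam' δ v ∧
      Tendsto (fun m => eFF T k s lam lam' δ (volPotF μ (Bop M₁ M₂ w (u (φ m))) - v))
        atTop (nhds 0) := by
  obtain ⟨φ, hφ, v, hv, hlim⟩ := exists_family_subseq (τ := 1) hT.le h1 (h2.trans h3).le zero_le_one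
    hδ ENNReal.toReal_nonneg fun m I => (hu m).1.parReg hT h1 hC (hu m).2 I
  have hw' := hw.fBdd hT h1
  have hu' : ∀ m, FBdd T s (k + 1) 1 (u (φ m)) := fun m =>
    ((hu (φ m)).1.fBdd hT h1).mono le_rfl hδ.le
  have hv' : FBdd T s (k + 1) 1 v := hv.mono le_rfl hδ.le
  have e : δ + 1 + 1 = δ + 2 := by ring
  have hB := FBdd.bop M₁ M₂ hw' hv'
  have hBm := fun m => FBdd.bop M₁ M₂ hw' (hu' m)
  have hBl := Bop_tendsto M₁ M₂ hw' hu' hv' hlim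
  rw [e] at hB hBl
  simp only [e] at hBm
  refine ⟨φ, hφ, volPotF μ (Bop M₁ M₂ w v), ?_, ?_⟩
  · exact fMemF_volPot hT hμ h1 (h2.trans h3) (h1.trans h2) h3 hk (by linarith) hB
      fun I t ht x => rfl
  · exact eFF_volPot_tendsto hT hμ h1 (h2.trans h3) (h1.trans h2) h3 hk (by linarith) hBm hB hBl
      fun m I t ht x => rfl

theorem compact_volPot_Wop (hk : 1 ≤ k) {δ : ℝ} (h1 : 0 < lam) (h2 : lam < lam') (h3 : lam' < 1)
    (hδ : 1 < δ) (hμ : 0 < μ) (hT : 0 < T) (M₁ : M1Type n q) {w : FormT n q}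
    (hw : FMemD T k s lam lam' δ w) (u : ℕ → FormT n q) {C : ℝ≥0∞} (hC : C ≠ ⊤)
    (hu : ∀ m, FMemD T k s lam lam' δ (u m) ∧ eFD T k s lam lam' δ (u m) ≤ C) :
    ∃ φ : ℕ → ℕ, StrictMono φ ∧ ∃ v : FormT n q, FMemD T k s lam lam' δ v ∧
      Tendsto (fun m => eFD T k s lam lam' δ (volPotF μ (Wop M₁ w (u (φ m))) - v))
        atTop (nhds 0) := by
  obtain ⟨c₁, hc₁⟩ := dT_eq_FOp (n := n) (q := q)
  obtain ⟨c₂, hc₂⟩ := coDT_eq_FOp (n := n) (q := q)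
  have hl := (h2.trans h3).le
  have hb0 := fun m => le_trans (le_trans le_self_add le_self_add) (hu m).2
  have hb1 := fun m => le_trans (le_trans le_add_self le_self_add) (hu m).2
  have hb2 := fun m => le_trans le_add_self (hu m).2
  obtain ⟨φ₀, hφ₀, v, hv, hl0⟩ := exists_family_subseq (τ := 1) hT.le h1 hl zero_le_one
    hδ ENNReal.toReal_nonneg fun m I => (hu m).1.1.parReg hT h1 hC (hb0 m) I
  obtain ⟨φ₁, hφ₁, a, ha, hl1⟩ := exists_family_subseq (τ := 1 + 1) hT.le h1 hl (by norm_num)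
    (by linarith) ENNReal.toReal_nonneg fun m I =>
      (hu (φ₀ m)).1.2.1.parReg hT h1 hC (hb1 (φ₀ m)) I
  obtain ⟨φ₂, hφ₂, b, hb, hl2⟩ := exists_family_subseq (τ := 1 + 1) hT.le h1 hl (by norm_num)
    (by linarith) ENNReal.toReal_nonneg fun m I =>
      (hu (φ₀ (φ₁ m))).1.2.2.parReg hT h1 hC (hb2 (φ₀ (φ₁ m))) I
  set φ := φ₀ ∘ φ₁ ∘ φ₂ with hφ
  have l0 : ∀ I, ParTendsto T s (k + 1) 1 (fun m => u (φ m) I) (v I) := fun I =>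
    (hl0 I).comp (hφ₁.comp hφ₂)
  have l1 : ∀ I, ParTendsto T s (k + 1) (1 + 1) (fun m => dT (u (φ m)) I) (a I) := fun I =>
    (hl1 I).comp hφ₂
  have l2 : ∀ I, ParTendsto T s (k + 1) (1 + 1) (fun m => coDT (u (φ m)) I) (b I) := hl2
  have u0 : ∀ m, FBdd T s (k + 1) δ (u (φ m)) := fun m => (hu (φ m)).1.1.fBdd hT h1
  have u1 : ∀ m, FBdd T s (k + 1) (δ + 1) (dT (u (φ m))) := fun m => (hu (φ m)).1.2.1.fBdd hT h1
  have u2 : ∀ m, FBdd T s (k + 1) (δ + 1) (coDT (u (φ m))) := fun m => (hu (φ m)).1.2.2.fBdd hT h1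
  have e1 : ∀ J, EqT T (a J) (dT v J) := fun J => by
    rw [hc₁]
    simp only [hc₁] at l1
    exact FOp_limit_eqT c₁ zero_le_one (by norm_num) u0 hv l0 J (l1 J)
  have e2 : ∀ J, EqT T (b J) (coDT v J) := fun J => by
    rw [hc₂]
    simp only [hc₂] at l2
    exact FOp_limit_eqT c₂ zero_le_one (by norm_num) u0 hv l0 J (l2 J)
  have w0 := hw.1.fBdd hT h1
  have w1 := hw.2.1.fBdd hT h1
  have w2 := hw.2.2.fBdd hT h1
  have hδ' : (1 : ℝ) + 1 ≤ δ + 1 := by linarith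
  have hW := FBdd.wop M₁ w0 w1 w2 (hv.mono le_rfl hδ.le) ((ha.congr e1).mono le_rfl hδ')
    ((hb.congr e2).mono le_rfl hδ')
  have hWm := fun m => FBdd.wop M₁ w0 w1 w2 ((u0 m).mono le_rfl hδ.le) ((u1 m).mono le_rfl hδ')
    ((u2 m).mono le_rfl hδ')
  have hWl := Wop_tendsto M₁ w0 w1 w2 l0 (fun J => (l1 J).congr (e1 J)) fun J => (l2 J).congr (e2 J)
  have e : δ + 1 + 1 = δ + 2 := by ring
  rw [e] at hW hWl
  simp only [e] at hWm
  have hδ0 : (0 : ℝ) ≤ δ + 2 := by linarith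
  have mem : ∀ {p : ℕ} {c : Idx n p → Fin n → Idx n q → ℝ},
      FMemF T k s lam lam' (δ + 1) (FOp c (volPotF μ (Wop M₁ w v))) := fun {p c} => by
    have := hW.fop c
    rw [show δ + 2 + 1 = δ + 1 + 2 by ring] at this
    exact fMemF_volPot hT hμ h1 (h2.trans h3) (h1.trans h2) h3 hk (by linarith) this
      (FOp_volPot_of_fBdd hμ c hδ0 hW)
  have lim : ∀ {p : ℕ} {c : Idx n p → Fin n → Idx n q → ℝ}, Tendsto (fun m =>
      eFF T k s lam lam' (δ + 1) (FOp c (volPotF μ (Wop M₁ w (u (φ m))) - volPotF μ (Wop M₁ w v))))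
      atTop (nhds 0) := fun {p c} => by
    have t1 := hW.fop c
    have t2 := fun m => (hWm m).fop c
    have t3 := FOp_tendsto_of_fBdd c hWm hW hWl
    simp only [show δ + 2 + 1 = δ + 1 + 2 by ring] at t1 t2 t3
    exact eFF_volPot_tendsto hT hμ h1 (h2.trans h3) (h1.trans h2) h3 hk (by linarith) t2 t1 t3
      fun m J => FOp_volPot_sub hμ c hδ0 (hWm m) hW J
  refine ⟨φ, hφ₀.comp (hφ₁.comp hφ₂), volPotF μ (Wop M₁ w v), ⟨?_, ?_, ?_⟩, ?_⟩
  · exact fMemF_volPot hT hμ h1 (h2.trans h3) (h1.trans h2) h3 hk (by linarith)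
      (hW.mono k.le_succ le_rfl) fun I t ht x => rfl
  · rw [hc₁]; exact mem
  · rw [hc₂]; exact mem
  · have l := eFF_volPot_tendsto (lam := lam) (lam' := lam') (σ := δ)
      (g := fun m => volPotF μ (Wop M₁ w (u (φ m))) - volPotF μ (Wop M₁ w v)) hT hμ h1
      (h2.trans h3) (h1.trans h2) h3 hk (by linarith) (fun m => (hWm m).mono k.le_succ le_rfl)
      (hW.mono k.le_succ le_rfl) (fun I => (hWl I).mono k.le_succ le_rfl) fun m I t ht x => rfl
    have := (l.add (lim (c := c₁))).add (lim (c := c₂))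
    simp only [add_zero] at this
    simpa only [eFD, hc₁, hc₂] using this

end compactness

/-- compactness of `Ψ_{μ,q}B_q(w,·)` on `𝓕^{k,𝐬(s,λ,λ',δ)}_{T,Λ^q}` and of
`Ψ_{μ,q}W_q` on `𝓕^{k,𝐬(s,λ,λ',δ)}_{T,Λ^q,𝒟_{d⊕d*}}`. -/
theorem stmt7 (n q s k : ℕ) (hn : 2 ≤ n) (hq : q ≤ n) (hs : 1 ≤ s) (hk : 1 ≤ k)
    (lam lam' δ μ T : ℝ) (h1 : 0 < lam) (h2 : lam < lam') (h3 : lam' < 1)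
    (hδ : 1 < δ) (hμ : 0 < μ) (hT : 0 < T)
    (M₁ : M1Type n q) (M₂ : M2Type n q) (w : FormT n q)
    (hw : FMemD T k s lam lam' δ w) :
    (∀ u : ℕ → FormT n q,
      (∃ C : ℝ≥0∞, C ≠ ⊤ ∧ ∀ m, FMemF T k s lam lam' δ (u m) ∧
        eFF T k s lam lam' δ (u m) ≤ C) →
      ∃ φ : ℕ → ℕ, StrictMono φ ∧ ∃ v : FormT n q, FMemF T k s lam lam' δ v ∧
        Tendsto (fun m => eFF T k s lam lam' δ (volPotF μ (Bop M₁ M₂ w (u (φ m))) - v))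
          atTop (nhds 0)) ∧
    (∀ u : ℕ → FormT n q,
      (∃ C : ℝ≥0∞, C ≠ ⊤ ∧ ∀ m, FMemD T k s lam lam' δ (u m) ∧
        eFD T k s lam lam' δ (u m) ≤ C) →
      ∃ φ : ℕ → ℕ, StrictMono φ ∧ ∃ v : FormT n q, FMemD T k s lam lam' δ v ∧
        Tendsto (fun m => eFD T k s lam lam' δ (volPotF μ (Wop M₁ w (u (φ m))) - v))
          atTop (nhds 0)) := by
  refine ⟨fun u ⟨C, hC, hu⟩ => ?_, fun u ⟨C, hC, hu⟩ => ?_⟩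
  · exact compact_volPot_Bop hk h1 h2 h3 hδ hμ hT M₁ M₂ hw.1 u hC hu
  · exact compact_volPot_Wop hk h1 h2 h3 hδ hμ hT M₁ hw u hC hu
end NSdeRham

end
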